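/- arXiv:math/9408216 — 2 statements merged into one kernel-verified Lean document; each statement's English description precedes it below -/
import Mathlib

section
/- Let K ⊂ ℝ² be a compact strictly convex set with nonempty interior, C¹ boundary Γ = ∂K, and support function p with p' Lipschitz. Suppose there are an open interval J ⊂ ℝ of length less than 2π and a point θ̂ ∈ J such that p is C² on J ∖ {θ̂}, the radius of curvature ρ = p + p'' is continuous and strictly positive on J ∖ {θ̂}, and the one-sided limits ρ⁺ = lim_{θ→θ̂⁺} ρ(θ) and ρ⁻ = lim_{θ→θ̂⁻} ρ(θ) exist, are finite, and satisfy ρ⁺ ≠ ρ⁻ (a jump discontinuity of ρ at θ̂). Then there exists ε > 0 such that no homotopically nontrivial Φ-invariant circle is contained in {z ∈ ℝ² ∖ K : dist(z, K) < ε}. -/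
open Real

noncomputable def suppFn (K : Set (ℝ × ℝ)) (θ : ℝ) : ℝ :=
  sSup ((fun z : ℝ × ℝ => z.1 * Real.cos θ + z.2 * Real.sin θ) '' K)

def DBInvCircle (K : Set (ℝ × ℝ)) (Φ : ℝ × ℝ → ℝ × ℝ) (Ω : Set (ℝ × ℝ)) : Prop :=
  Ω ⊆ Kᶜ ∧ IsCompact Ω ∧ Φ '' Ω = Ω ∧
    ∃ ℓ : C(AddCircle (2 * Real.pi), (Kᶜ : Set (ℝ × ℝ))),
      Function.Injective ℓ ∧ ¬ ContinuousMap.Nullhomotopic ℓ ∧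
      Ω = Subtype.val '' Set.range ℓ

/-- The data used from a planar convex body: its support function `p` in direction `θ`,
together with its derivative `q`. -/
structure SupportData (p q : ℝ → ℝ) : Prop where
  hasDeriv : ∀ θ, HasDerivAt p (q θ) θ
  cont : Continuous q
  periodic : Function.Periodic p (2 * π)
  periodic' : Function.Periodic q (2 * π)
  supp : ∀ θ φ, p θ * cos (φ - θ) + q θ * sin (φ - θ) ≤ p φ
  width : ∀ θ, 0 < p θ + p (θ + π)

/-- Distance along the forward tangent from the support point at `θ` to the intersection
of the support lines at `θ` and `φ`. -/
noncomputable def lamP (p q : ℝ → ℝ) (θ φ : ℝ) : ℝ :=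
  (p φ - p θ * cos (φ - θ)) / sin (φ - θ) - q θ

/-- Distance along the backward tangent from the support point at `φ` to the intersection
of the support lines at `θ` and `φ`. -/
noncomputable def lamM (p q : ℝ → ℝ) (θ φ : ℝ) : ℝ :=
  q φ - (p φ * cos (φ - θ) - p θ) / sin (φ - θ)

lemma lamP_reflect (p q : ℝ → ℝ) (θ φ : ℝ) :
    lamP (fun x => p (-x)) (fun x => -q (-x)) (-φ) (-θ) = lamM p q θ φ := by
  unfold lamP lamM
  rw [show -θ - -φ = φ - θ by ring]
  simp only [neg_neg]
  rw [show p φ * cos (φ - θ) - p θ = -(p θ - p φ * cos (φ - θ)) by ring, neg_div]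
  ring

lemma lamM_reflect (p q : ℝ → ℝ) (θ φ : ℝ) :
    lamM (fun x => p (-x)) (fun x => -q (-x)) (-φ) (-θ) = lamP p q θ φ := by
  unfold lamP lamM
  rw [show -θ - -φ = φ - θ by ring]
  simp only [neg_neg]
  rw [show p θ * cos (φ - θ) - p φ = -(p φ - p θ * cos (φ - θ)) by ring, neg_div]
  ring

namespace SupportData

variable {p q : ℝ → ℝ}

lemma reflect (h : SupportData p q) :
    SupportData (fun x => p (-x)) (fun x => -q (-x)) where
  hasDeriv θ := by
    have := (h.hasDeriv (-θ)).comp θ (hasDerivAt_neg θ)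
    simpa [Function.comp_def] using this
  cont := (h.cont.comp continuous_neg).neg
  periodic θ := by
    have := h.periodic (-(θ + 2 * π))
    rw [show -(θ + 2 * π) + 2 * π = -θ by ring] at this
    exact this.symm
  periodic' θ := by
    have := h.periodic' (-(θ + 2 * π))
    rw [show -(θ + 2 * π) + 2 * π = -θ by ring] at this
    simp only [this]
  supp θ φ := by
    have := h.supp (-θ) (-φ)
    rw [show -φ - -θ = -(φ - θ) by ring, cos_neg, sin_neg] at this
    linarith
  width θ := by
    have := h.width (-(θ + π))
    rw [show -(θ + π) + π = -θ by ring] at this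
    linarith

lemma continuous_p (h : SupportData p q) : Continuous p :=
  continuous_iff_continuousAt.2 fun θ => (h.hasDeriv θ).continuousAt

lemma lamP_mul {θ φ : ℝ} (hs : sin (φ - θ) ≠ 0) :
    lamP p q θ φ * sin (φ - θ) = p φ - p θ * cos (φ - θ) - q θ * sin (φ - θ) := by
  unfold lamP; field_simp

lemma lamM_mul {θ φ : ℝ} (hs : sin (φ - θ) ≠ 0) :
    lamM p q θ φ * sin (φ - θ) = p θ - p φ * cos (φ - θ) + q φ * sin (φ - θ) := by
  unfold lamM; field_simp; ring

lemma p_eq {θ φ : ℝ} (hs : sin (φ - θ) ≠ 0) :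
    p φ = p θ * cos (φ - θ) + (q θ + lamP p q θ φ) * sin (φ - θ) := by
  have := lamP_mul (p := p) (q := q) hs; linarith

lemma q_eq {θ φ : ℝ} (hs : sin (φ - θ) ≠ 0) :
    q φ = lamM p q θ φ - p θ * sin (φ - θ) + (q θ + lamP p q θ φ) * cos (φ - θ) := by
  have h1 := lamM_mul (p := p) (q := q) hs
  have h2 := p_eq (p := p) (q := q) hs
  have h3 := sin_sq_add_cos_sq (φ - θ)
  apply mul_right_cancel₀ hs
  generalize sin (φ - θ) = s at *
  generalize cos (φ - θ) = c at *
  linear_combination -h1 + c * h2 + p θ * h3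

lemma sin_pos' {θ φ : ℝ} (h1 : θ < φ) (h2 : φ < θ + π) : 0 < sin (φ - θ) :=
  sin_pos_of_pos_of_lt_pi (by linarith) (by linarith)

lemma lamP_nonneg (h : SupportData p q) {θ φ : ℝ} (h1 : θ < φ) (h2 : φ < θ + π) :
    0 ≤ lamP p q θ φ := by
  have hs := sin_pos' h1 h2
  have := lamP_mul (p := p) (q := q) hs.ne'
  have h3 := h.supp θ φ
  by_contra hc
  push Not at hc
  have := mul_neg_of_neg_of_pos hc hs
  linarith

lemma lamM_nonneg (h : SupportData p q) {θ φ : ℝ} (h1 : θ < φ) (h2 : φ < θ + π) :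
    0 ≤ lamM p q θ φ := by
  rw [← lamP_reflect]
  exact h.reflect.lamP_nonneg (by linarith) (by linarith)

/-- Contact of the support point at `θ` with the support line at `φ` determines `q φ`. -/
lemma q_of_contact (h : SupportData p q) {u v φ : ℝ}
    (hle : ∀ ψ, u * cos ψ + v * sin ψ ≤ p ψ) (he : u * cos φ + v * sin φ = p φ) :
    q φ = - u * sin φ + v * cos φ := by
  have hd : HasDerivAt (fun ψ => p ψ - (u * cos ψ + v * sin ψ))
      (q φ - (u * (-sin φ) + v * cos φ)) φ :=
    (h.hasDeriv φ).sub (((hasDerivAt_cos φ).const_mul u).add ((hasDerivAt_sin φ).const_mul v))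
  have hmin : IsLocalMin (fun ψ => p ψ - (u * cos ψ + v * sin ψ)) φ := by
    refine Filter.Eventually.of_forall fun ψ => ?_
    have := hle ψ
    simp only
    linarith
  have := hmin.hasDerivAt_eq_zero hd
  linarith

lemma lamM_eq_zero (h : SupportData p q) {θ φ : ℝ} (h1 : θ < φ) (h2 : φ < θ + π)
    (h0 : lamP p q θ φ = 0) : lamM p q θ φ = 0 := by
  have hs := sin_pos' h1 h2
  have e1 := p_eq (p := p) (q := q) hs.ne'
  have e2 := q_eq (p := p) (q := q) hs.ne'
  rw [h0] at e1 e2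
  have key := h.q_of_contact (u := p θ * cos θ - q θ * sin θ) (v := p θ * sin θ + q θ * cos θ)
    (φ := φ) (fun ψ => by
      have := h.supp θ ψ
      rw [cos_sub, sin_sub] at this
      linarith) (by rw [e1, cos_sub, sin_sub]; ring)
  rw [cos_sub, sin_sub] at e2
  linarith

lemma lamP_pos_iff (h : SupportData p q) {θ φ : ℝ} (h1 : θ < φ) (h2 : φ < θ + π) :
    0 < lamP p q θ φ ↔ 0 < lamM p q θ φ := by
  have a := h.lamP_nonneg h1 h2
  have b := h.lamM_nonneg h1 h2
  constructor
  · intro hp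
    refine lt_of_le_of_ne b fun e => hp.ne' ?_
    rw [← lamM_reflect]
    refine h.reflect.lamM_eq_zero (by linarith) (by linarith) ?_
    rw [lamP_reflect]; exact e.symm
  · intro hp
    exact lt_of_le_of_ne a fun e => hp.ne' (h.lamM_eq_zero h1 h2 e.symm)

lemma lamP_step (h : SupportData p q) {θ φ₁ φ₂ : ℝ} (h1 : θ < φ₁) (h2 : φ₁ < θ + π) :
    lamP p q θ φ₁ * sin (φ₂ - θ) + lamM p q θ φ₁ * sin (φ₂ - φ₁)
      ≤ p φ₂ - p θ * cos (φ₂ - θ) - q θ * sin (φ₂ - θ) := by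
  have hs := (sin_pos' h1 h2).ne'
  have e1 := p_eq (p := p) (q := q) hs
  have e2 := q_eq (p := p) (q := q) hs
  have := h.supp φ₁ φ₂
  rw [show φ₂ - θ = (φ₁ - θ) + (φ₂ - φ₁) by ring, sin_add, cos_add]
  rw [e1, e2] at this
  linarith

lemma lamP_mono (h : SupportData p q) {θ φ₁ φ₂ : ℝ} (h1 : θ < φ₁) (h12 : φ₁ ≤ φ₂)
    (h2 : φ₂ < θ + π) : lamP p q θ φ₁ ≤ lamP p q θ φ₂ := by
  have hs := sin_pos' (h1.trans_le h12) h2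
  have := h.lamP_step (φ₂ := φ₂) h1 (h12.trans_lt h2)
  rw [← lamP_mul hs.ne'] at this
  have h3 : 0 ≤ lamM p q θ φ₁ * sin (φ₂ - φ₁) :=
    mul_nonneg (h.lamM_nonneg h1 (h12.trans_lt h2))
      (sin_nonneg_of_nonneg_of_le_pi (by linarith) (by linarith))
  exact le_of_mul_le_mul_right (by linarith) hs

lemma lamP_strictMono (h : SupportData p q) {θ φ₁ φ₂ : ℝ} (h1 : θ < φ₁) (h12 : φ₁ < φ₂)
    (h2 : φ₂ < θ + π) (hpos : 0 < lamP p q θ φ₁) : lamP p q θ φ₁ < lamP p q θ φ₂ := by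
  have hs := sin_pos' (h1.trans h12) h2
  have := h.lamP_step (φ₂ := φ₂) h1 (h12.trans h2)
  rw [← lamP_mul hs.ne'] at this
  have h3 : 0 < lamM p q θ φ₁ * sin (φ₂ - φ₁) :=
    mul_pos ((h.lamP_pos_iff h1 (h12.trans h2)).1 hpos)
      (sin_pos_of_pos_of_lt_pi (by linarith) (by linarith))
  exact lt_of_mul_lt_mul_right (by linarith) hs.le

lemma lamM_anti (h : SupportData p q) {θ₁ θ₂ φ : ℝ} (h1 : φ - π < θ₁) (h12 : θ₁ ≤ θ₂)
    (h2 : θ₂ < φ) : lamM p q θ₂ φ ≤ lamM p q θ₁ φ := by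
  rw [← lamP_reflect, ← lamP_reflect]
  exact h.reflect.lamP_mono (by linarith) (by linarith) (by linarith)

lemma exists_lamP_eq (h : SupportData p q) (θ : ℝ) {l : ℝ} (hl : 0 < l) :
    ∃ φ, θ < φ ∧ φ < θ + π ∧ lamP p q θ φ = l := by
  set g : ℝ → ℝ := fun φ => p φ - p θ * cos (φ - θ) - (q θ + l) * sin (φ - θ) with hg
  have hcont : Continuous g := by
    have := h.continuous_p
    fun_prop
  have hd : HasDerivAt g (-l) θ := by
    have h1 : HasDerivAt (fun φ : ℝ => φ - θ) 1 θ := (hasDerivAt_id θ).sub_const θ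
    have := ((h.hasDeriv θ).sub ((h1.cos).const_mul (p θ))).sub ((h1.sin).const_mul (q θ + l))
    refine this.congr_deriv ?_
    simp
  have h0 : g θ = 0 := by simp [hg]
  have hpi : 0 < g (θ + π) := by
    have := h.width θ
    simp [hg]; linarith
  obtain ⟨φ₀, h1, h2, h3⟩ : ∃ φ₀, θ < φ₀ ∧ φ₀ < θ + π ∧ g φ₀ < 0 := by
    have := hd.tendsto_slope
    have hev : ∀ᶠ x in nhdsWithin θ {θ}ᶜ, slope g θ x < 0 :=
      this.eventually_lt_const (by linarith)
    have hev' : ∀ᶠ x in nhdsWithin θ (Set.Ioi θ), slope g θ x < 0 :=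
      hev.filter_mono (nhdsWithin_mono _ fun x hx => ne_of_gt hx)
    have hev2 : ∀ᶠ x in nhdsWithin θ (Set.Ioi θ), x ∈ Set.Ioo θ (θ + π) :=
      Ioo_mem_nhdsGT (by linarith [pi_pos])
    obtain ⟨x, hx1, hx2⟩ := (hev'.and hev2).exists
    refine ⟨x, hx2.1, hx2.2, ?_⟩
    rw [slope_def_field, h0, sub_zero, div_lt_iff₀ (by linarith [hx2.1])] at hx1
    linarith
  obtain ⟨φ, hφ, e⟩ := intermediate_value_Ioo h2.le hcont.continuousOn ⟨h3, hpi⟩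
  refine ⟨φ, h1.trans hφ.1, hφ.2, ?_⟩
  have hs := (sin_pos' (h1.trans hφ.1) hφ.2).ne'
  apply mul_right_cancel₀ hs
  rw [lamP_mul hs]
  have e' : p φ - p θ * cos (φ - θ) - (q θ + l) * sin (φ - θ) = 0 := e
  linarith

end SupportData

/-- Pairs of an angle and a positive tangent length. -/
abbrev Strip := {x : ℝ × ℝ // 0 < x.2}

namespace Strip

/-- The deck translation by `2 * π * j`. -/
noncomputable def shift (j : ℤ) (x : Strip) : Strip := ⟨(x.1.1 + 2 * π * j, x.1.2), x.2⟩

/-- The reflection `θ ↦ -θ`. -/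
def flip (x : Strip) : Strip := ⟨(-x.1.1, x.1.2), x.2⟩

lemma flip_flip (x : Strip) : x.flip.flip = x := by
  simp [flip]

lemma continuous_flip : Continuous flip := by
  unfold flip; fun_prop

lemma continuous_shift (j : ℤ) : Continuous (shift j) := by
  unfold shift; fun_prop

end Strip

namespace SupportData

variable {p q : ℝ → ℝ}

/-- The angle of the image of a point under the lifted dual billiards map. -/
noncomputable def angle (h : SupportData p q) (x : Strip) : ℝ :=
  (h.exists_lamP_eq x.1.1 x.2).choose

lemma lt_angle (h : SupportData p q) (x : Strip) : x.1.1 < h.angle x :=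
  (h.exists_lamP_eq x.1.1 x.2).choose_spec.1

lemma angle_lt (h : SupportData p q) (x : Strip) : h.angle x < x.1.1 + π :=
  (h.exists_lamP_eq x.1.1 x.2).choose_spec.2.1

lemma lamP_angle (h : SupportData p q) (x : Strip) : lamP p q x.1.1 (h.angle x) = x.1.2 :=
  (h.exists_lamP_eq x.1.1 x.2).choose_spec.2.2

lemma lamP_le_of_le_angle (h : SupportData p q) {x : Strip} {φ : ℝ} (h1 : x.1.1 < φ)
    (hφ : φ ≤ h.angle x) : lamP p q x.1.1 φ ≤ x.1.2 := by
  rw [← h.lamP_angle x]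
  exact h.lamP_mono h1 hφ (h.angle_lt x)

lemma lt_lamP_of_angle_lt (h : SupportData p q) {x : Strip} {φ : ℝ} (h2 : φ < x.1.1 + π)
    (hφ : h.angle x < φ) : x.1.2 < lamP p q x.1.1 φ := by
  have := h.lamP_strictMono (h.lt_angle x) hφ h2 (by rw [h.lamP_angle]; exact x.2)
  rwa [h.lamP_angle] at this

lemma lamP_lt_of_lt_angle (h : SupportData p q) {x : Strip} {φ : ℝ} (h1 : x.1.1 < φ)
    (hφ : φ < h.angle x) : lamP p q x.1.1 φ < x.1.2 := by
  rcases (h.lamP_nonneg h1 (hφ.trans (h.angle_lt x))).eq_or_lt with h0 | h0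
  · rw [← h0]; exact x.2
  · have := h.lamP_strictMono h1 hφ (h.angle_lt x) h0
    rwa [h.lamP_angle] at this

lemma lt_angle_of_lamP_lt (h : SupportData p q) {x : Strip} {φ : ℝ} (h2 : φ < x.1.1 + π)
    (hl : lamP p q x.1.1 φ < x.1.2) : φ < h.angle x := by
  by_contra hc
  rcases (not_lt.1 hc).eq_or_lt with e | e
  · rw [← e, h.lamP_angle] at hl; exact lt_irrefl _ hl
  · exact absurd (h.lt_lamP_of_angle_lt h2 e) (not_lt.2 hl.le)

lemma angle_lt_of_lt_lamP (h : SupportData p q) {x : Strip} {φ : ℝ} (h1 : x.1.1 < φ)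
    (hl : x.1.2 < lamP p q x.1.1 φ) : h.angle x < φ := by
  by_contra hc
  exact absurd (h.lamP_le_of_le_angle h1 (not_lt.1 hc)) (not_le.2 hl)

lemma angle_unique (h : SupportData p q) {x : Strip} {φ : ℝ} (h1 : x.1.1 < φ)
    (h2 : φ < x.1.1 + π) (hl : lamP p q x.1.1 φ = x.1.2) : φ = h.angle x := by
  rcases lt_trichotomy φ (h.angle x) with e | e | e
  · exact absurd hl (h.lamP_lt_of_lt_angle h1 e).ne
  · exact e
  · exact absurd hl (h.lt_lamP_of_angle_lt h2 e).ne'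

lemma continuousAt_lamP (h : SupportData p q) {θ φ : ℝ} (hs : sin (φ - θ) ≠ 0) :
    ContinuousAt (fun z : ℝ × ℝ => lamP p q z.1 z.2) (θ, φ) := by
  have h1 := h.continuous_p
  have h2 := h.cont
  unfold lamP
  refine ContinuousAt.sub (ContinuousAt.div ?_ ?_ hs) ?_
  · exact Continuous.continuousAt (by fun_prop)
  · exact Continuous.continuousAt (by fun_prop)
  · exact Continuous.continuousAt (by fun_prop)

lemma continuousAt_lamM (h : SupportData p q) {θ φ : ℝ} (hs : sin (φ - θ) ≠ 0) :
    ContinuousAt (fun z : ℝ × ℝ => lamM p q z.1 z.2) (θ, φ) := by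
  have h1 := h.continuous_p
  have h2 := h.cont
  unfold lamM
  refine ContinuousAt.sub ?_ (ContinuousAt.div ?_ ?_ hs)
  · exact Continuous.continuousAt (by fun_prop)
  · exact Continuous.continuousAt (by fun_prop)
  · exact Continuous.continuousAt (by fun_prop)

lemma continuous_angle (h : SupportData p q) : Continuous h.angle := by
  refine continuous_iff_continuousAt.2 fun x => ?_
  have cont₁ : ∀ φ, sin (φ - x.1.1) ≠ 0 →
      ContinuousAt (fun y : Strip => lamP p q y.1.1 φ) x := fun φ hs =>
    (h.continuousAt_lamP hs).comp_of_eq (g := fun z : ℝ × ℝ => lamP p q z.1 z.2)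
      (f := fun y : Strip => (y.1.1, φ)) (Continuous.continuousAt (by fun_prop)) rfl
  have c1 : ContinuousAt (fun y : Strip => y.1.1) x := Continuous.continuousAt (by fun_prop)
  have c2 : ContinuousAt (fun y : Strip => y.1.2) x := Continuous.continuousAt (by fun_prop)
  have c3 : ContinuousAt (fun y : Strip => y.1.1 + π) x := Continuous.continuousAt (by fun_prop)
  have hx1 := h.lt_angle x
  have hx2 := h.angle_lt x
  refine tendsto_order.2 ⟨fun a ha => ?_, fun b hb => ?_⟩
  · obtain ⟨φ, hφ1, hφ2⟩ := exists_between (max_lt ha hx1)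
    have k1 : x.1.1 < φ := (le_max_right _ _).trans_lt hφ1
    have hl := h.lamP_lt_of_lt_angle k1 hφ2
    filter_upwards [(cont₁ φ (sin_pos' k1 (hφ2.trans hx2)).ne').eventually_lt c2 hl,
      c3.eventually_const_lt (hφ2.trans hx2)] with y hy1 hy2
    exact (le_max_left _ _).trans_lt (hφ1.trans (h.lt_angle_of_lamP_lt hy2 hy1))
  · obtain ⟨φ, hφ1, hφ2⟩ := exists_between (lt_min hb hx2)
    have k1 : φ < x.1.1 + π := hφ2.trans_le (min_le_right _ _)
    have hl := h.lt_lamP_of_angle_lt k1 hφ1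
    filter_upwards [c2.eventually_lt (cont₁ φ (sin_pos' (hx1.trans hφ1) k1).ne') hl,
      c1.eventually_lt_const (hx1.trans hφ1)] with y hy1 hy2
    exact (h.angle_lt_of_lt_lamP hy2 hy1).trans (hφ2.trans_le (min_le_left _ _))

/-- The forward lifted map. -/
noncomputable def step (h : SupportData p q) (x : Strip) : Strip :=
  ⟨(h.angle x, lamM p q x.1.1 (h.angle x)), by
    rw [← h.lamP_pos_iff (h.lt_angle x) (h.angle_lt x), h.lamP_angle]
    exact x.2⟩

lemma continuous_step (h : SupportData p q) : Continuous h.step := by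
  have h1 := h.continuous_angle
  refine Continuous.subtype_mk (h1.prodMk (continuous_iff_continuousAt.2 fun x => ?_)) _
  have := h.continuousAt_lamM (sin_pos' (h.lt_angle x) (h.angle_lt x)).ne'
  exact this.comp_of_eq (g := fun z : ℝ × ℝ => lamM p q z.1 z.2)
      (f := fun y : Strip => (y.1.1, h.angle y)) (Continuous.continuousAt (by fun_prop)) rfl

lemma step_eq_of_lam (h : SupportData p q) {x y : Strip} (h1 : x.1.1 < y.1.1)
    (h2 : y.1.1 < x.1.1 + π) (hP : lamP p q x.1.1 y.1.1 = x.1.2)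
    (hM : lamM p q x.1.1 y.1.1 = y.1.2) : h.step x = y := by
  have e := h.angle_unique h1 h2 hP
  refine Subtype.ext (Prod.ext e.symm ?_)
  show lamM p q x.1.1 (h.angle x) = y.1.2
  rw [← e, hM]

lemma step_flip (h : SupportData p q) (x : Strip) :
    h.step (h.reflect.step x.flip).flip = x := by
  have a := h.reflect.lt_angle x.flip
  have b := h.reflect.angle_lt x.flip
  have c := h.reflect.lamP_angle x.flip
  have e : x.1.1 = -x.flip.1.1 := by simp [Strip.flip]
  refine h.step_eq_of_lam ?_ ?_ ?_ ?_
  · show -h.reflect.angle x.flip < x.1.1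
    rw [e]; linarith
  · show x.1.1 < -h.reflect.angle x.flip + π
    rw [e]; linarith
  · show lamP p q (-h.reflect.angle x.flip) x.1.1 =
      lamM (fun t => p (-t)) (fun t => -q (-t)) (-x.1.1) (h.reflect.angle x.flip)
    rw [← lamM_reflect, neg_neg]
  · show lamM p q (-h.reflect.angle x.flip) x.1.1 = x.1.2
    rw [← lamP_reflect, neg_neg, e, neg_neg, c]
    rfl

lemma flip_step (h : SupportData p q) (x : Strip) :
    (h.reflect.step (h.step x).flip).flip = x := by
  have a := h.lt_angle x
  have b := h.angle_lt x
  have c := h.lamP_angle x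
  rw [← x.flip_flip]
  congr 1
  refine h.reflect.step_eq_of_lam ?_ ?_ ?_ ?_
  · show -h.angle x.flip.flip < -x.1.1
    rw [x.flip_flip]; linarith
  · show -x.1.1 < -h.angle x.flip.flip + π
    rw [x.flip_flip]; linarith
  · show lamP _ _ (-h.angle x.flip.flip) (-x.1.1) = lamM _ _ _ _
    rw [x.flip_flip, lamP_reflect]
  · show lamM _ _ (-h.angle x.flip.flip) (-x.1.1) = x.1.2
    rw [x.flip_flip, lamM_reflect, c]

/-- The lifted dual billiards map. -/
noncomputable def lift (h : SupportData p q) : Strip ≃ₜ Strip where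
  toFun := h.step
  invFun x := (h.reflect.step x.flip).flip
  left_inv := h.flip_step
  right_inv := h.step_flip
  continuous_toFun := h.continuous_step
  continuous_invFun := Strip.continuous_flip.comp
    (h.reflect.continuous_step.comp Strip.continuous_flip)

lemma lift_fst (h : SupportData p q) (x : Strip) : (h.lift x).1.1 = h.angle x := rfl

lemma lift_snd (h : SupportData p q) (x : Strip) :
    (h.lift x).1.2 = lamM p q x.1.1 (h.angle x) := rfl

lemma lift_twist (h : SupportData p q) {x y : Strip} (h1 : x.1.1 = y.1.1)
    (h2 : y.1.2 < x.1.2) : (h.lift y).1.1 < (h.lift x).1.1 := by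
  rw [lift_fst, lift_fst]
  refine h.lt_angle_of_lamP_lt ?_ ?_
  · rw [h1]; exact h.angle_lt y
  · rw [h1, h.lamP_angle]; exact h2

lemma lift_twist' (h : SupportData p q) {x y : Strip} (h1 : (h.lift x).1.1 = (h.lift y).1.1)
    (h2 : (h.lift y).1.2 < (h.lift x).1.2) : x.1.1 < y.1.1 := by
  rw [lift_fst, lift_fst] at h1
  rw [lift_snd, lift_snd, h1] at h2
  by_contra hc
  have a := h.angle_lt y
  have b := h.lt_angle x
  rw [h1] at b
  exact absurd (h.lamM_anti (by linarith) (not_lt.1 hc) b) (not_le.2 h2)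

lemma periodic_int (h : SupportData p q) (θ : ℝ) (j : ℤ) : p (θ + 2 * π * j) = p θ := by
  rw [mul_comm]; exact h.periodic.int_mul j θ

lemma periodic_int' (h : SupportData p q) (θ : ℝ) (j : ℤ) : q (θ + 2 * π * j) = q θ := by
  rw [mul_comm]; exact h.periodic'.int_mul j θ

lemma lift_shift (h : SupportData p q) (j : ℤ) (x : Strip) :
    h.lift (x.shift j) = (h.lift x).shift j := by
  have a := h.lt_angle x
  have b := h.angle_lt x
  have c := h.lamP_angle x
  have eP : ∀ θ φ, lamP p q (θ + 2 * π * j) (φ + 2 * π * j) = lamP p q θ φ := by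
    intro θ φ
    unfold lamP
    rw [h.periodic_int, h.periodic_int, h.periodic_int', add_sub_add_right_eq_sub]
  have eM : ∀ θ φ, lamM p q (θ + 2 * π * j) (φ + 2 * π * j) = lamM p q θ φ := by
    intro θ φ
    unfold lamM
    rw [h.periodic_int, h.periodic_int, h.periodic_int', add_sub_add_right_eq_sub]
  refine h.step_eq_of_lam ?_ ?_ ?_ ?_
  · show x.1.1 + 2 * π * j < h.angle x + 2 * π * j
    linarith
  · show h.angle x + 2 * π * j < x.1.1 + 2 * π * j + π
    linarith
  · show lamP p q (x.1.1 + 2 * π * j) (h.angle x + 2 * π * j) = x.1.2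
    rw [eP, c]
  · show lamM p q (x.1.1 + 2 * π * j) (h.angle x + 2 * π * j) = lamM _ _ _ _
    rw [eM]

end SupportData

open Filter Topology

/-- Relative position of `y` with respect to `x`: `1` to the right, `3` to the left,
`2` below and `4` above. -/
noncomputable def relPos (y x : Strip) : ℤ :=
  if x.1.1 < y.1.1 then 1 else if y.1.1 < x.1.1 then 3 else if y.1.2 < x.1.2 then 2 else 4

lemma relPos_eq_one {y x : Strip} : relPos y x = 1 ↔ x.1.1 < y.1.1 := by
  unfold relPos; split_ifs <;> simp_all

lemma relPos_eq_three {y x : Strip} : relPos y x = 3 ↔ y.1.1 < x.1.1 := by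
  unfold relPos; split_ifs <;> simp_all
  linarith

lemma relPos_eq_two {y x : Strip} : relPos y x = 2 ↔ y.1.1 = x.1.1 ∧ y.1.2 < x.1.2 := by
  unfold relPos; split_ifs with h1 h2 h3 <;> simp
  · intro h; linarith
  · intro h; linarith
  · exact ⟨by linarith, h3⟩
  · intro _; linarith

lemma relPos_eq_four {y x : Strip} (hne : y ≠ x) :
    relPos y x = 4 ↔ y.1.1 = x.1.1 ∧ x.1.2 < y.1.2 := by
  unfold relPos; split_ifs with h1 h2 h3 <;> simp
  · intro h; linarith
  · intro h; linarith
  · intro _; linarith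
  · have e : y.1.1 = x.1.1 := by linarith
    refine ⟨e, lt_of_le_of_ne (not_lt.1 h3) fun h => hne (Subtype.ext (Prod.ext e h.symm))⟩

lemma relPos_mem (y x : Strip) :
    relPos y x = 1 ∨ relPos y x = 2 ∨ relPos y x = 3 ∨ relPos y x = 4 := by
  unfold relPos; split_ifs <;> simp

lemma relPos_eventually {γ : ℝ → Strip} (hγ : Continuous γ) {y : Strip} (hne : ∀ s, y ≠ γ s)
    (s : ℝ) : ∀ᶠ t in 𝓝 s, (relPos y (γ s) % 2 = 1 → relPos y (γ t) = relPos y (γ s)) ∧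
      (relPos y (γ t) - relPos y (γ s)) % 4 ≠ 2 := by
  have c1 : ContinuousAt (fun t => (γ t).1.1) s := Continuous.continuousAt (by fun_prop)
  have c2 : ContinuousAt (fun t => (γ t).1.2) s := Continuous.continuousAt (by fun_prop)
  rcases relPos_mem y (γ s) with e | e | e | e
  · filter_upwards [c1.eventually_lt_const (relPos_eq_one.1 e)] with t ht
    rw [e, relPos_eq_one.2 ht]; simp
  · filter_upwards [c2.eventually_const_lt (relPos_eq_two.1 e).2] with t ht
    have : relPos y (γ t) ≠ 4 := fun h => by
      have := ((relPos_eq_four (hne t)).1 h).2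
      linarith
    rcases relPos_mem y (γ t) with e' | e' | e' | e' <;> rw [e, e'] <;> simp_all
  · filter_upwards [c1.eventually_const_lt (relPos_eq_three.1 e)] with t ht
    rw [e, relPos_eq_three.2 ht]; simp
  · filter_upwards [c2.eventually_lt_const ((relPos_eq_four (hne s)).1 e).2] with t ht
    have : relPos y (γ t) ≠ 2 := fun h => by
      have := (relPos_eq_two.1 h).2
      linarith
    rcases relPos_mem y (γ t) with e' | e' | e' | e' <;> rw [e, e'] <;> simp_all

/-- Continuity of an integer-valued function for the digital line topology in which odd
numbers are open points. -/
def DigitalContinuous (I : ℝ → ℤ) : Prop :=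
  ∀ s, ∀ᶠ t in 𝓝 s, (I s % 2 = 1 → I t = I s) ∧ |I t - I s| ≤ 1

lemma DigitalContinuous.lt_or_lt {I : ℝ → ℤ} (hI : DigitalContinuous I) {v : ℤ}
    (hv : v % 2 = 0) (hne : ∀ s, I s ≠ v) : (∀ s, I s < v) ∨ ∀ s, v < I s := by
  have o1 : IsOpen {s | I s < v} := isOpen_iff_mem_nhds.2 fun s hs => by
    filter_upwards [hI s] with t ht
    have h1 : I s < v := hs
    have h3 := abs_le.1 ht.2
    have h4 := ht.1
    have h5 := hne t
    show I t < v
    omega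
  have o2 : IsOpen {s | v < I s} := isOpen_iff_mem_nhds.2 fun s hs => by
    filter_upwards [hI s] with t ht
    have h1 : v < I s := hs
    have h3 := abs_le.1 ht.2
    have h4 := ht.1
    have h5 := hne t
    show v < I t
    omega
  have hc : IsClopen {s | I s < v} := by
    refine ⟨?_, o1⟩
    have : {s | I s < v} = {s | v < I s}ᶜ := by
      ext s
      have := hne s
      simp only [Set.mem_ofPred_eq, Set.mem_compl_iff]
      omega
    rw [this]
    exact o2.isClosed_compl
  rcases isClopen_iff.1 hc with e | e
  · right
    intro s
    have : s ∉ {s | I s < v} := by rw [e]; simp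
    have h1 : ¬ I s < v := this
    have := hne s
    omega
  · left
    intro s
    have : s ∈ {s | I s < v} := by rw [e]; simp
    exact this

/-- Every point of `O` lies on a curve in `O` that is unbounded in angle on both sides. -/
def HasLines (O : Set Strip) : Prop :=
  ∀ x ∈ O, ∃ γ : ℝ → Strip, Continuous γ ∧ (∀ s, γ s ∈ O) ∧ (∃ s, γ s = x) ∧
    Tendsto (fun s => (γ s).1.1) atTop atTop ∧ Tendsto (fun s => (γ s).1.1) atBot atBot

/-- The points lying strictly below all points of `O` with the same angle. -/
def Under (O : Set Strip) : Set Strip := {y | ∀ x ∈ O, x.1.1 = y.1.1 → y.1.2 < x.1.2}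

namespace SupportData

variable {p q : ℝ → ℝ} (h : SupportData p q)

/-- The position of `F^k y` relative to `F^k x`, lifted to the integers. -/
noncomputable def index (y x : Strip) : ℕ → ℤ
  | 0 => relPos y x
  | k + 1 => index y x k +
      (relPos (h.lift^[k + 1] y) (h.lift^[k + 1] x) - relPos (h.lift^[k] y) (h.lift^[k] x)) % 4

lemma index_modEq (y x : Strip) (k : ℕ) :
    h.index y x k % 4 = relPos (h.lift^[k] y) (h.lift^[k] x) % 4 := by
  induction k with
  | zero => rfl
  | succ k ih =>
    rw [index]
    omega

lemma relPos_lift {y x : Strip} (hne : y ≠ x) :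
    (relPos y x = 1 → relPos (h.lift y) (h.lift x) ≠ 4) ∧
    (relPos y x = 2 → relPos (h.lift y) (h.lift x) = 3) ∧
    (relPos y x = 3 → relPos (h.lift y) (h.lift x) ≠ 2) ∧
    (relPos y x = 4 → relPos (h.lift y) (h.lift x) = 1) := by
  have hne' : h.lift y ≠ h.lift x := fun e => hne (h.lift.injective e)
  refine ⟨fun e e' => ?_, fun e => ?_, fun e e' => ?_, fun e => ?_⟩
  · rw [relPos_eq_one] at e
    rw [relPos_eq_four hne'] at e'
    exact absurd (h.lift_twist' e'.1 e'.2) (not_lt.2 e.le)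
  · rw [relPos_eq_two] at e
    rw [relPos_eq_three]
    exact h.lift_twist e.1.symm e.2
  · rw [relPos_eq_three] at e
    rw [relPos_eq_two] at e'
    exact absurd (h.lift_twist' e'.1.symm e'.2) (not_lt.2 e.le)
  · rw [relPos_eq_four hne] at e
    rw [relPos_eq_one]
    exact h.lift_twist e.1 e.2

lemma index_succ_bounds {y x : Strip} (hne : y ≠ x) (k : ℕ) :
    h.index y x k ≤ h.index y x (k + 1) ∧ h.index y x (k + 1) ≤ h.index y x k + 2 ∧
      (h.index y x k % 2 = 0 → h.index y x (k + 1) = h.index y x k + 1) := by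
  have hne' : h.lift^[k] y ≠ h.lift^[k] x := fun e => hne (h.lift.injective.iterate k e)
  have key := h.relPos_lift hne'
  rw [← Function.iterate_succ_apply' h.lift, ← Function.iterate_succ_apply' h.lift] at key
  have a := relPos_mem (h.lift^[k] y) (h.lift^[k] x)
  have b := relPos_mem (h.lift^[k + 1] y) (h.lift^[k + 1] x)
  have c := h.index_modEq y x k
  rw [index]
  simp only [Nat.succ_eq_add_one] at key
  omega

lemma index_mono {y x : Strip} (hne : y ≠ x) : Monotone (h.index y x) :=
  monotone_nat_of_le_succ fun k => (h.index_succ_bounds hne k).1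

lemma digitalContinuous_index {γ : ℝ → Strip} (hγ : Continuous γ) {y : Strip}
    (hne : ∀ s, y ≠ γ s) (h0 : ∀ s, relPos y (γ s) ≠ 4) (k : ℕ) :
    DigitalContinuous fun s => h.index y (γ s) k := by
  induction k with
  | zero =>
    intro s
    filter_upwards [relPos_eventually hγ hne s] with t ht
    have a := relPos_mem y (γ t)
    have b := relPos_mem y (γ s)
    have c := h0 t
    have d := h0 s
    simp only [index]
    refine ⟨ht.1, abs_le.2 ?_⟩
    have := ht.1
    omega
  | succ k ih =>
    intro s
    have hk : ∀ s, h.lift^[k + 1] y ≠ h.lift^[k + 1] (γ s) := fun s e =>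
      hne s (h.lift.injective.iterate (k + 1) e)
    have hcont : Continuous fun s => h.lift^[k + 1] (γ s) :=
      (h.lift.continuous.iterate (k + 1)).comp hγ
    filter_upwards [relPos_eventually hcont hk s, ih s] with t ht ht'
    have a := h.index_succ_bounds (hne t) k
    have b := h.index_succ_bounds (hne s) k
    have a' := h.index_modEq y (γ t) (k + 1)
    have b' := h.index_modEq y (γ s) (k + 1)
    have c := ht.1
    have d := ht.2
    have e := ht'.1
    have f := abs_le.1 ht'.2
    have g := relPos_mem (h.lift^[k + 1] y) (h.lift^[k + 1] (γ t))
    have g' := relPos_mem (h.lift^[k + 1] y) (h.lift^[k + 1] (γ s))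
    clear ht ht' ih hcont
    have key : |h.index y (γ t) (k + 1) - h.index y (γ s) (k + 1)| ≤ 1 := by
      rw [abs_le]; omega
    refine ⟨?_, key⟩
    rw [abs_le] at key
    omega

lemma iterate_bounds (x : Strip) (k : ℕ) :
    x.1.1 ≤ (h.lift^[k] x).1.1 ∧ (h.lift^[k] x).1.1 ≤ x.1.1 + k * π := by
  induction k with
  | zero => simp
  | succ k ih =>
    rw [Function.iterate_succ_apply', lift_fst]
    have a := h.lt_angle (h.lift^[k] x)
    have b := h.angle_lt (h.lift^[k] x)
    push_cast
    constructor <;> nlinarith [ih.1, ih.2]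

lemma index_eq_three {y x : Strip} (k : ℕ) (hx : y.1.1 + k * π < x.1.1) :
    h.index y x k = 3 := by
  have key : ∀ j ≤ k, relPos (h.lift^[j] y) (h.lift^[j] x) = 3 := by
    intro j hj
    rw [relPos_eq_three]
    have a := (h.iterate_bounds y j).2
    have b := (h.iterate_bounds x j).1
    have : (j : ℝ) * π ≤ k * π := by
      have : (j : ℝ) ≤ k := by exact_mod_cast hj
      nlinarith [pi_pos]
    linarith
  clear hx
  induction k with
  | zero => exact key 0 le_rfl
  | succ k ih =>
    rw [index, ih fun j hj => key j (by omega), key k (by omega), key (k + 1) le_rfl]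
    rfl

lemma index_eq_one {y x : Strip} (k : ℕ) (hx : x.1.1 + k * π < y.1.1) :
    h.index y x k = 1 := by
  have key : ∀ j ≤ k, relPos (h.lift^[j] y) (h.lift^[j] x) = 1 := by
    intro j hj
    rw [relPos_eq_one]
    have a := (h.iterate_bounds x j).2
    have b := (h.iterate_bounds y j).1
    have : (j : ℝ) * π ≤ k * π := by
      have : (j : ℝ) ≤ k := by exact_mod_cast hj
      nlinarith [pi_pos]
    linarith
  clear hx
  induction k with
  | zero => exact key 0 le_rfl
  | succ k ih =>
    rw [index, ih fun j hj => key j (by omega), key k (by omega), key (k + 1) le_rfl]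
    rfl

section Invariant

variable {O : Set Strip}

lemma iterate_mem_iff (hO : ∀ x, h.lift x ∈ O ↔ x ∈ O) (k : ℕ) (x : Strip) :
    h.lift^[k] x ∈ O ↔ x ∈ O := by
  induction k with
  | zero => rfl
  | succ k ih => rw [Function.iterate_succ_apply', hO, ih]

lemma _root_.ne_of_mem_under {y x : Strip} (hy : y ∈ Under O) (hx : x ∈ O) : y ≠ x := by
  rintro rfl
  exact lt_irrefl _ (hy y hx rfl)

lemma _root_.relPos_ne_four_of_mem_under {y x : Strip} (hy : y ∈ Under O) (hx : x ∈ O) :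
    relPos y x ≠ 4 := fun e => by
  have := (relPos_eq_four (ne_of_mem_under hy hx)).1 e
  linarith [hy x hx this.1.symm]

/-- The orbit of a point under `O` is never above all of `O`. -/
lemma exists_above (hO : ∀ x, h.lift x ∈ O ↔ x ∈ O) (hl : HasLines O) (hne : O.Nonempty)
    {y : Strip} (hy : y ∈ Under O) (n : ℕ) :
    ∃ x ∈ O, x.1.1 = (h.lift^[n] y).1.1 ∧ (h.lift^[n] y).1.2 < x.1.2 := by
  obtain ⟨x₀, hx₀⟩ := hne
  obtain ⟨γ, hγ, hγO, -, hT, hB⟩ := hl x₀ hx₀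
  have hneγ : ∀ s, y ≠ γ s := fun s => ne_of_mem_under hy (hγO s)
  have hI := h.digitalContinuous_index hγ hneγ
    (fun s => relPos_ne_four_of_mem_under hy (hγO s)) n
  by_contra hc
  push Not at hc
  have hne2 : ∀ s, h.index y (γ s) n ≠ 2 := fun s e => by
    have a := h.index_modEq y (γ s) n
    have b := relPos_mem (h.lift^[n] y) (h.lift^[n] (γ s))
    have : relPos (h.lift^[n] y) (h.lift^[n] (γ s)) = 2 := by omega
    rw [relPos_eq_two] at this
    exact absurd this.2
      (not_lt.2 (hc _ ((h.iterate_mem_iff hO n _).2 (hγO s)) this.1.symm))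
  obtain ⟨s₁, hs₁⟩ := (hT.eventually_gt_atTop (y.1.1 + n * π)).exists
  obtain ⟨s₂, hs₂⟩ := (hB.eventually_lt_atBot (y.1.1 - n * π)).exists
  have e₁ := h.index_eq_three (x := γ s₁) n hs₁
  have e₂ := h.index_eq_one (y := y) (x := γ s₂) n (by linarith)
  rcases hI.lt_or_lt (v := 2) (by norm_num) hne2 with e | e
  · have := e s₁; omega
  · have := e s₂; omega

/-- The relative position is monotone along orbit segments with both ends under `O`. -/
lemma relPos_mono (hO : ∀ x, h.lift x ∈ O ↔ x ∈ O) (hl : HasLines O) {y x : Strip} {n : ℕ}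
    (hy : y ∈ Under O) (hyn : h.lift^[n] y ∈ Under O) (hx : x ∈ O) {j k : ℕ} (hjk : j ≤ k)
    (hkn : k ≤ n) :
    relPos (h.lift^[j] y) (h.lift^[j] x) ≤ relPos (h.lift^[k] y) (h.lift^[k] x) := by
  obtain ⟨γ, hγ, hγO, ⟨s, rfl⟩, hT, hB⟩ := hl x hx
  have hneγ : ∀ s, y ≠ γ s := fun s => ne_of_mem_under hy (hγO s)
  have hI := h.digitalContinuous_index hγ hneγ
    (fun s => relPos_ne_four_of_mem_under hy (hγO s)) n
  have hmod : ∀ s, h.index y (γ s) n % 4 ≠ 0 := fun s e => by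
    have a := h.index_modEq y (γ s) n
    have b := relPos_mem (h.lift^[n] y) (h.lift^[n] (γ s))
    have c := relPos_ne_four_of_mem_under hyn ((h.iterate_mem_iff hO n _).2 (hγO s))
    omega
  obtain ⟨s₁, hs₁⟩ := (hT.eventually_gt_atTop (y.1.1 + n * π)).exists
  have e₁ := h.index_eq_three (x := γ s₁) n hs₁
  have up : h.index y (γ s) n < 4 := by
    rcases hI.lt_or_lt (v := 4) (by norm_num)
      (fun s e => hmod s (by omega)) with e | e
    · exact e s
    · have := e s₁; omega
  have mono := h.index_mono (hneγ s)
  have m0 := mono (Nat.zero_le j)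
  have m1 := mono hjk
  have m2 := mono hkn
  have a0 : h.index y (γ s) 0 = relPos y (γ s) := rfl
  have a1 := relPos_mem y (γ s)
  have b1 := relPos_mem (h.lift^[j] y) (h.lift^[j] (γ s))
  have b2 := relPos_mem (h.lift^[k] y) (h.lift^[k] (γ s))
  have c1 := h.index_modEq y (γ s) j
  have c2 := h.index_modEq y (γ s) k
  omega

end Invariant

end SupportData

open MeasureTheory

/-- The point with coordinates `(p θ, t)` in the orthonormal frame with first vector
`(cos θ, sin θ)`. -/
noncomputable def framePt (p : ℝ → ℝ) (z : ℝ × ℝ) : ℝ × ℝ :=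
  (p z.1 * cos z.1 - z.2 * sin z.1, p z.1 * sin z.1 + z.2 * cos z.1)

lemma framePt_inner (p : ℝ → ℝ) (z : ℝ × ℝ) (φ : ℝ) :
    (framePt p z).1 * cos φ + (framePt p z).2 * sin φ =
      p z.1 * cos (φ - z.1) + z.2 * sin (φ - z.1) := by
  rw [cos_sub, sin_sub, framePt]; ring

lemma framePt_tangent (p : ℝ → ℝ) (z : ℝ × ℝ) :
    -(framePt p z).1 * sin z.1 + (framePt p z).2 * cos z.1 = z.2 := by
  have := sin_sq_add_cos_sq z.1
  simp only [framePt]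
  linear_combination z.2 * this

lemma eq_framePt (p : ℝ → ℝ) {w : ℝ × ℝ} {θ t : ℝ} (h1 : w.1 * cos θ + w.2 * sin θ = p θ)
    (h2 : -w.1 * sin θ + w.2 * cos θ = t) : w = framePt p (θ, t) := by
  have := sin_sq_add_cos_sq θ
  subst h2
  refine Prod.ext ?_ ?_ <;> simp only [framePt] <;> rw [← h1]
  · linear_combination -w.1 * this
  · linear_combination -w.2 * this

/-- The end of the tangent segment described by `x`, forward for `ε = 1` and backward for
`ε = -1`. -/
noncomputable def tangentPt (p q : ℝ → ℝ) (ε : ℝ) (x : Strip) : ℝ × ℝ :=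
  framePt p (x.1.1, q x.1.1 + ε * x.1.2)

/-- The derivative of `framePt`. -/
noncomputable def framePtDeriv (p q : ℝ → ℝ) (z : ℝ × ℝ) : ℝ × ℝ →L[ℝ] ℝ × ℝ :=
  (Matrix.toLin (.finTwoProd ℝ) (.finTwoProd ℝ)
    !![(q z.1 - z.2) * cos z.1 - p z.1 * sin z.1, -sin z.1;
       (q z.1 - z.2) * sin z.1 + p z.1 * cos z.1, cos z.1]).toContinuousLinearMap

lemma framePtDeriv_det (p q : ℝ → ℝ) (z : ℝ × ℝ) :
    (framePtDeriv p q z).det = q z.1 - z.2 := by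
  have := sin_sq_add_cos_sq z.1
  unfold framePtDeriv
  simp only [LinearMap.det_toContinuousLinearMap, LinearMap.det_toLin, Matrix.det_fin_two_of]
  linear_combination (q z.1 - z.2) * this

namespace SupportData

variable {p q : ℝ → ℝ} (h : SupportData p q)
include h

lemma hasFDerivAt_framePt (z : ℝ × ℝ) : HasFDerivAt (framePt p) (framePtDeriv p q z) z := by
  unfold framePtDeriv
  rw [Matrix.toLin_finTwoProd_toContinuousLinearMap]
  have h1 : HasFDerivAt (fun w : ℝ × ℝ => w.1) (ContinuousLinearMap.fst ℝ ℝ ℝ) z :=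
    hasFDerivAt_fst
  have hp := (h.hasDeriv z.1).comp_hasFDerivAt z h1
  have hc := (hasDerivAt_cos z.1).comp_hasFDerivAt z h1
  have hs := (hasDerivAt_sin z.1).comp_hasFDerivAt z h1
  have h2 : HasFDerivAt (fun w : ℝ × ℝ => w.2) (ContinuousLinearMap.snd ℝ ℝ ℝ) z :=
    hasFDerivAt_snd
  refine (((hp.mul hc).sub (h2.mul hs)).prodMk ((hp.mul hs).add (h2.mul hc))).congr_fderiv ?_
  ext <;> simp <;> ring

lemma lt_p_of_lt {ε : ℝ} (hε : ε = 1 ∨ ε = -1) {x y : Strip}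
    (e : tangentPt p q ε x = tangentPt p q ε y) (h1 : x.1.1 < y.1.1) (h2 : y.1.1 < x.1.1 + π) :
    False := by
  have hs := sin_pos' h1 h2
  unfold tangentPt at e
  rcases hε with rfl | rfl
  · have a := framePt_inner p (x.1.1, q x.1.1 + 1 * x.1.2) x.1.1
    rw [e, framePt_inner] at a
    have b := h.supp y.1.1 x.1.1
    have c : sin (x.1.1 - y.1.1) = - sin (y.1.1 - x.1.1) := by
      rw [← sin_neg]; congr 1; ring
    simp only [c, sub_self, cos_zero, sin_zero] at a b
    nlinarith [mul_pos hs y.2]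
  · have a := framePt_inner p (x.1.1, q x.1.1 + -1 * x.1.2) y.1.1
    rw [e, framePt_inner] at a
    have b := h.supp x.1.1 y.1.1
    simp only [sub_self, cos_zero, sin_zero] at a b
    nlinarith [mul_pos hs x.2]

lemma tangentPt_shift (ε : ℝ) (j : ℤ) (x : Strip) :
    tangentPt p q ε (x.shift j) = tangentPt p q ε x := by
  simp only [tangentPt, framePt, Strip.shift, h.periodic_int, h.periodic_int']
  rw [mul_comm (2 * π) (j : ℝ), cos_add_int_mul_two_pi, sin_add_int_mul_two_pi]

lemma tangentPt_eq_of_lt {ε : ℝ} (hε : ε = 1 ∨ ε = -1) {x y : Strip}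
    (e : tangentPt p q ε x = tangentPt p q ε y) (h1 : x.1.1 ≤ y.1.1)
    (h2 : y.1.1 < x.1.1 + 2 * π) : x = y := by
  rcases h1.eq_or_lt with h1 | h1
  · have a := framePt_tangent p (x.1.1, q x.1.1 + ε * x.1.2)
    have b := framePt_tangent p (y.1.1, q y.1.1 + ε * y.1.2)
    unfold tangentPt at e
    rw [e] at a
    simp only [h1] at a b
    rw [b] at a
    have hε0 : ε ≠ 0 := by rcases hε with rfl | rfl <;> norm_num
    exact Subtype.ext (Prod.ext h1 (mul_left_cancel₀ hε0 (add_left_cancel a)).symm)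
  · exfalso
    rcases lt_trichotomy y.1.1 (x.1.1 + π) with h3 | h3 | h3
    · exact h.lt_p_of_lt hε e h1 h3
    · have a := framePt_inner p (x.1.1, q x.1.1 + ε * x.1.2) (x.1.1 + π)
      have b := framePt_inner p (y.1.1, q y.1.1 + ε * y.1.2) y.1.1
      unfold tangentPt at e
      rw [e, ← h3] at a
      rw [a] at b
      simp only [h3, add_sub_cancel_left, sub_self, cos_pi, sin_pi, cos_zero, sin_zero] at b
      have := h.width x.1.1
      linarith
    · rw [← h.tangentPt_shift ε 1 x] at e
      refine h.lt_p_of_lt hε e.symm ?_ ?_ <;> simp [Strip.shift] <;> linarith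

lemma exists_shift_of_eq {ε : ℝ} (hε : ε = 1 ∨ ε = -1) {x y : Strip}
    (e : tangentPt p q ε x = tangentPt p q ε y) : ∃ j : ℤ, x.shift j = y := by
  obtain ⟨j, hj, -⟩ := existsUnique_add_zsmul_mem_Ico two_pi_pos x.1.1 (y.1.1 - 2 * π + 0)
  set k : ℤ := j + 1
  have e1 : (x.shift k).1.1 = x.1.1 + 2 * π * j + 2 * π := by
    simp only [Strip.shift, k]; push_cast; ring
  have hj1 := hj.1
  have hj2 := hj.2
  simp only [zsmul_eq_mul] at hj1 hj2
  refine ⟨k, (h.tangentPt_eq_of_lt hε (x := y) (y := x.shift k) ?_ ?_ ?_).symm⟩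
  · rw [h.tangentPt_shift, e]
  · rw [e1]; linarith
  · rw [e1]; linarith

lemma tangentPt_lift (x : Strip) : tangentPt p q (-1) (h.lift x) = tangentPt p q 1 x := by
  have hs := (sin_pos' (h.lt_angle x) (h.angle_lt x)).ne'
  have a := p_eq (p := p) (q := q) hs
  have b := q_eq (p := p) (q := q) hs
  rw [h.lamP_angle] at a b
  symm
  unfold tangentPt
  apply eq_framePt
  · rw [framePt_inner, h.lift_fst, a]; ring
  · have h3 := sin_sq_add_cos_sq x.1.1
    rw [h.lift_fst, h.lift_snd, b]
    rw [sin_sub, cos_sub, framePt]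
    ring

/-- The plane area of the region swept by the tangent segments with parameters in an
invariant set. -/
lemma volume_tangentPt {ε : ℝ} (hε : ε = 1 ∨ ε = -1) {A : Set Strip} (hA : MeasurableSet A)
    (hT : ∀ j : ℤ, ∀ x ∈ A, x.shift j ∈ A) (a : ℝ) :
    MeasurableSet (tangentPt p q ε '' A) ∧ volume (tangentPt p q ε '' A) =
      ∫⁻ z in Subtype.val '' A ∩ {z | z.1 ∈ Set.Ico a (a + 2 * π)}, ENNReal.ofReal |z.2| := by
  set A₀ : Set (ℝ × ℝ) := Subtype.val '' A ∩ {z | z.1 ∈ Set.Ico a (a + 2 * π)} with hA₀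
  have hm : MeasurableSet A₀ := by
    refine MeasurableSet.inter ?_ (measurable_fst measurableSet_Ico)
    exact (MeasurableEmbedding.subtype_coe
      (isOpen_lt continuous_const continuous_snd).measurableSet).measurableSet_image.2 hA
  set σ : ℝ × ℝ → ℝ × ℝ := fun z => (z.1, ε * (z.2 - q z.1)) with hσ
  have hεε : ε * ε = 1 := by rcases hε with rfl | rfl <;> norm_num
  have hσm : MeasurePreserving σ volume volume := by
    have := (MeasurePreserving.id (volume : Measure ℝ)).skew_product
      (g := fun θ t => ε * (t - q θ)) (μc := volume) (μd := volume) (by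
        have := h.cont
        exact Continuous.measurable (by unfold Function.uncurry; fun_prop))
      (Eventually.of_forall fun θ => by
        rcases hε with rfl | rfl
        · simpa using map_sub_right_eq_self volume (q θ)
        · simpa using Measure.map_sub_left_eq_self volume (q θ))
    exact this
  have hB : MeasurableSet (σ ⁻¹' A₀) := hσm.measurable hm
  have himg : tangentPt p q ε '' A = framePt p '' (σ ⁻¹' A₀) := by
    ext w
    constructor
    · rintro ⟨x, hx, rfl⟩
      obtain ⟨j, hj, -⟩ := existsUnique_add_zsmul_mem_Ico two_pi_pos x.1.1 a
      refine ⟨((x.shift j).1.1, q (x.shift j).1.1 + ε * (x.shift j).1.2), ?_, ?_⟩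
      · refine ⟨⟨x.shift j, hT j x hx, ?_⟩, ?_⟩
        · refine Prod.ext rfl ?_
          simp only [σ]
          linear_combination -(x.shift j).1.2 * hεε
        · show x.1.1 + 2 * π * j ∈ Set.Ico a (a + 2 * π)
          rw [zsmul_eq_mul] at hj
          rwa [mul_comm (2 * π)]
      · exact h.tangentPt_shift ε j x
    · rintro ⟨z, ⟨⟨x, hx, hxz⟩, -⟩, rfl⟩
      refine ⟨x, hx, ?_⟩
      unfold tangentPt
      rw [hxz]
      congr 1
      refine Prod.ext rfl ?_
      simp only [σ]
      linear_combination (z.2 - q z.1) * hεε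
  have hinj : Set.InjOn (framePt p) (σ ⁻¹' A₀) := by
    rintro z ⟨⟨x, hx, hxz⟩, hza⟩ w ⟨⟨y, hy, hyw⟩, hwa⟩ e
    have unfolded : ∀ {z : ℝ × ℝ} {x : Strip}, x.1 = σ z →
        tangentPt p q ε x = framePt p z ∧ z = (x.1.1, q x.1.1 + ε * x.1.2) := by
      intro z x hxz
      have : (x.1.1, q x.1.1 + ε * x.1.2) = z := by
        rw [hxz]
        refine Prod.ext rfl ?_
        simp only [σ]
        linear_combination (z.2 - q z.1) * hεε
      exact ⟨by unfold tangentPt; rw [this], this.symm⟩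
    obtain ⟨ex, ez⟩ := unfolded hxz
    obtain ⟨ey, ew⟩ := unfolded hyw
    rw [← ex, ← ey] at e
    have hxa : x.1.1 ∈ Set.Ico a (a + 2 * π) := by rw [hxz]; exact hza
    have hya : y.1.1 ∈ Set.Ico a (a + 2 * π) := by rw [hyw]; exact hwa
    have : x = y := by
      rcases le_total x.1.1 y.1.1 with hle | hle
      · exact h.tangentPt_eq_of_lt hε e hle (by linarith [hxa.1, hya.2])
      · exact (h.tangentPt_eq_of_lt hε e.symm hle (by linarith [hya.1, hxa.2])).symm
    rw [ez, ew, this]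
  have hd : ∀ z ∈ σ ⁻¹' A₀, HasFDerivWithinAt (framePt p) (framePtDeriv p q z) (σ ⁻¹' A₀) z :=
    fun z _ => (h.hasFDerivAt_framePt z).hasFDerivWithinAt
  rw [himg]
  refine ⟨measurable_image_of_fderivWithin hB hd hinj, ?_⟩
  rw [← lintegral_abs_det_fderiv_eq_addHaar_image volume hB hd hinj,
    ← hσm.setLIntegral_comp_preimage hm (f := fun z => ENNReal.ofReal |z.2|) (by fun_prop)]
  refine lintegral_congr fun z => ?_
  rw [framePtDeriv_det]
  congr 1
  rcases hε with rfl | rfl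
  · simp only [σ, one_mul]; rw [abs_sub_comm]
  · simp only [σ]; congr 1; ring

lemma volume_lift {A : Set Strip} (hA : MeasurableSet A)
    (hT : ∀ j : ℤ, ∀ x ∈ A, x.shift j ∈ A) :
    volume (tangentPt p q (-1) '' (h.lift '' A)) = volume (tangentPt p q (-1) '' A) := by
  rw [(h.volume_tangentPt (.inr rfl) hA hT 0).2, ← (h.volume_tangentPt (.inl rfl) hA hT 0).2,
    Set.image_image]
  simp only [h.tangentPt_lift]

lemma volume_pos {A : Set Strip} (hA : IsOpen A)
    (hT : ∀ j : ℤ, ∀ x ∈ A, x.shift j ∈ A) (hne : A.Nonempty) :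
    0 < volume (tangentPt p q (-1) '' A) := by
  obtain ⟨x, hx⟩ := hne
  have ho : IsOpen (Subtype.val '' A : Set (ℝ × ℝ)) :=
    (isOpen_lt continuous_const continuous_snd).isOpenMap_subtype_val A hA
  rw [(h.volume_tangentPt (.inr rfl) hA.measurableSet hT (x.1.1 - π)).2]
  have hm : MeasurableSet (Subtype.val '' A ∩
      {z : ℝ × ℝ | z.1 ∈ Set.Ico (x.1.1 - π) (x.1.1 - π + 2 * π)}) :=
    ho.measurableSet.inter (measurable_fst measurableSet_Ico)
  rw [pos_iff_ne_zero, Ne, setLIntegral_eq_zero_iff hm (by fun_prop)]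
  intro hz
  have hz' : ∀ᵐ z : ℝ × ℝ, ¬ z ∈ (Subtype.val '' A ∩
      {z : ℝ × ℝ | z.1 ∈ Set.Ioo (x.1.1 - π) (x.1.1 - π + 2 * π)}) := by
    filter_upwards [hz] with z hz hmem
    have := hz ⟨hmem.1, Set.Ioo_subset_Ico_self hmem.2⟩
    obtain ⟨y, -, rfl⟩ := hmem.1
    rw [ENNReal.ofReal_eq_zero] at this
    exact absurd (abs_pos.2 y.2.ne') (not_lt.2 this)
  have ho2 : IsOpen (Subtype.val '' A ∩
      {z : ℝ × ℝ | z.1 ∈ Set.Ioo (x.1.1 - π) (x.1.1 - π + 2 * π)}) :=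
    ho.inter (isOpen_Ioo.preimage continuous_fst)
  have h0 := measure_eq_zero_iff_ae_notMem.2 hz'
  rw [ho2.measure_eq_zero_iff (volume : Measure (ℝ × ℝ))] at h0
  have : (x : ℝ × ℝ) ∈ (∅ : Set (ℝ × ℝ)) := by
    rw [← h0]
    exact ⟨⟨x, hx, rfl⟩, by constructor <;> linarith [pi_pos]⟩
  exact this

/-- A version of the Poincaré recurrence theorem. -/
lemma exists_recurrent {A : Set Strip} (hA : IsOpen A)
    (hT : ∀ j : ℤ, ∀ x ∈ A, x.shift j ∈ A) (hne : A.Nonempty) {C : ℝ}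
    (hC : ∀ n : ℕ, ∀ x ∈ A, (h.lift^[n] x).1.2 ≤ C) (k : ℕ) :
    ∃ n, k ≤ n ∧ ∃ x ∈ A, h.lift^[n] x ∈ A := by
  have hopen : ∀ n, IsOpen (h.lift^[n] '' A) := by
    intro n
    induction n with
    | zero => simpa using hA
    | succ n ih =>
      rw [Function.iterate_succ', Set.image_comp]
      exact h.lift.isOpenMap _ ih
  have hinv : ∀ n, ∀ j : ℤ, ∀ x ∈ h.lift^[n] '' A, x.shift j ∈ h.lift^[n] '' A := by
    intro n
    induction n with
    | zero => simpa using hT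
    | succ n ih =>
      rw [Function.iterate_succ', Set.image_comp]
      rintro j - ⟨x, hx, rfl⟩
      exact ⟨x.shift j, ih j x hx, h.lift_shift j x⟩
  have hvol : ∀ n, volume (tangentPt p q (-1) '' (h.lift^[n] '' A)) =
      volume (tangentPt p q (-1) '' A) := by
    intro n
    induction n with
    | zero => simp
    | succ n ih =>
      rw [Function.iterate_succ', Set.image_comp, h.volume_lift (hopen n).measurableSet (hinv n),
        ih]
  have hpos := h.volume_pos hA hT hne
  obtain ⟨M₁, hM₁⟩ := (h.periodic.isBounded_of_continuous two_pi_pos.ne'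
    h.continuous_p).exists_norm_le
  obtain ⟨M₂, hM₂⟩ := (h.periodic'.isBounded_of_continuous two_pi_pos.ne'
    h.cont).exists_norm_le
  have hbd : ∀ n, tangentPt p q (-1) '' (h.lift^[n] '' A) ⊆
      Metric.closedBall 0 (M₁ + (M₂ + C)) := by
    rintro n - ⟨-, ⟨x, hx, rfl⟩, rfl⟩
    set y := h.lift^[n] x
    have hy := hC n x hx
    have a := hM₁ (p y.1.1) ⟨_, rfl⟩
    have b := hM₂ (q y.1.1) ⟨_, rfl⟩
    have hy0 := y.2
    rw [Real.norm_eq_abs] at a b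
    have c : |q y.1.1 + -1 * y.1.2| ≤ M₂ + C := by
      rw [abs_le] at b ⊢
      constructor <;> linarith [b.1, b.2]
    have key : ∀ u v : ℝ, |u| ≤ 1 → |v| ≤ 1 →
        |p y.1.1 * u + (q y.1.1 + -1 * y.1.2) * v| ≤ M₁ + (M₂ + C) := by
      intro u v hu hv
      refine (abs_add_le _ _).trans (add_le_add ?_ ?_) <;> rw [abs_mul]
      · exact (mul_le_of_le_one_right (abs_nonneg _) hu).trans a
      · exact (mul_le_of_le_one_right (abs_nonneg _) hv).trans c
    rw [mem_closedBall_zero_iff, Prod.norm_def]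
    refine max_le ?_ ?_ <;> rw [Real.norm_eq_abs] <;> simp only [tangentPt, framePt]
    · have := key (cos y.1.1) (-sin y.1.1) (abs_cos_le_one _)
        (by rw [abs_neg]; exact abs_sin_le_one _)
      rwa [mul_neg, ← sub_eq_add_neg] at this
    · exact key _ _ (abs_sin_le_one _) (abs_cos_le_one _)
  have hnd : ¬ Pairwise (Function.onFun Disjoint
      fun i : ℕ => tangentPt p q (-1) '' (h.lift^[(k + 1) * i] '' A)) := by
    intro hd
    have hle : volume (⋃ i : ℕ, tangentPt p q (-1) '' (h.lift^[(k + 1) * i] '' A)) ≤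
        volume (Metric.closedBall (0 : ℝ × ℝ) (M₁ + (M₂ + C))) :=
      measure_mono (Set.iUnion_subset fun i => hbd _)
    rw [measure_iUnion hd fun i => (h.volume_tangentPt (.inr rfl) (hopen _).measurableSet
      (hinv _) 0).1] at hle
    simp only [hvol, ENNReal.tsum_const_eq_top_of_ne_zero hpos.ne'] at hle
    exact (measure_closedBall_lt_top (x := (0 : ℝ × ℝ))).not_ge hle
  obtain ⟨i, j, hij, x, hx, y, hy, e⟩ : ∃ i j : ℕ, i < j ∧ ∃ x ∈ A, ∃ y ∈ A,
      tangentPt p q (-1) (h.lift^[(k + 1) * i] x) =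
        tangentPt p q (-1) (h.lift^[(k + 1) * j] y) := by
    rw [Pairwise] at hnd
    push Not at hnd
    obtain ⟨i, j, hij, hd⟩ := hnd
    rw [Function.onFun, Set.not_disjoint_iff] at hd
    obtain ⟨-, ⟨-, ⟨x, hx, rfl⟩, rfl⟩, ⟨-, ⟨y, hy, rfl⟩, e⟩⟩ := hd
    rcases lt_or_gt_of_ne hij with hlt | hlt
    · exact ⟨i, j, hlt, x, hx, y, hy, e.symm⟩
    · exact ⟨j, i, hlt, y, hy, x, hx, e⟩
  obtain ⟨m, hm⟩ := h.exists_shift_of_eq (.inr rfl) e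
  obtain ⟨z, hz, ez⟩ := hinv ((k + 1) * i) m _ ⟨x, hx, rfl⟩
  rw [hm] at ez
  obtain ⟨d, rfl⟩ := Nat.exists_eq_add_of_lt hij
  refine ⟨(k + 1) * (d + 1), by nlinarith, y, hy, ?_⟩
  have : z = h.lift^[(k + 1) * (d + 1)] y := by
    apply h.lift.injective.iterate ((k + 1) * i)
    rw [ez, ← Function.iterate_add_apply]
    congr 2
    ring
  rwa [← this]

end SupportData

lemma isOpen_under {O : Set Strip} (hcl : IsClosed O) {c C : ℝ} (hc : 0 < c)
    (hO : ∀ x ∈ O, x.1.2 ∈ Set.Icc c C) : IsOpen (Under O) := by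
  have hZ : IsClosed {z : Strip × Set.Icc c C |
      (⟨(z.1.1.1, z.2.1), hc.trans_le z.2.2.1⟩ : Strip) ∈ O ∧ z.2.1 ≤ z.1.1.2} := by
    refine IsClosed.inter (hcl.preimage (Continuous.subtype_mk (by fun_prop) _)) ?_
    exact isClosed_le (f := fun z : Strip × Set.Icc c C => z.2.1) (g := fun z => z.1.1.2)
      (by fun_prop) (by fun_prop)
  have := isClosedMap_fst_of_compactSpace _ hZ
  rw [← isClosed_compl_iff]
  convert this using 1
  ext y
  simp only [Under, Set.mem_compl_iff, Set.mem_ofPred_eq, Set.mem_image, Prod.exists]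
  constructor
  · intro hy
    push Not at hy
    obtain ⟨x, hx, e, hle⟩ := hy
    refine ⟨y, ⟨x.1.2, hO x hx⟩, ⟨?_, hle⟩, rfl⟩
    convert hx using 1
    exact Subtype.ext (Prod.ext e.symm rfl)
  · rintro ⟨y', t, ⟨h1, h2⟩, rfl⟩ hy
    exact absurd (hy _ h1 rfl) (not_lt.2 h2)

/-- On each vertical there is a point of `O` approximated by points under `O`. -/
lemma exists_mem_closure_under {O : Set Strip} (hcl : IsClosed O) {c C : ℝ} (hc : 0 < c)
    (hO : ∀ x ∈ O, x.1.2 ∈ Set.Icc c C) (hl : HasLines O) (hne : O.Nonempty) (θ : ℝ) :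
    ∃ x ∈ O, x.1.1 = θ ∧ x ∈ closure {y ∈ Under O | y.1.1 = θ} := by
  obtain ⟨x₀, hx₀⟩ := hne
  obtain ⟨γ, hγ, hγO, -, hT, hB⟩ := hl x₀ hx₀
  have hcont : Continuous fun s => (γ s).1.1 := by fun_prop
  obtain ⟨s₁, hs₁⟩ := (hT.eventually_ge_atTop θ).exists
  obtain ⟨s₂, hs₂⟩ := (hB.eventually_le_atBot θ).exists
  obtain ⟨s, hs⟩ := mem_range_of_exists_le_of_exists_ge hcont ⟨s₂, hs₂⟩ ⟨s₁, hs₁⟩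
  set S : Set (Set.Icc c C) := {t | (⟨(θ, t.1), hc.trans_le t.2.1⟩ : Strip) ∈ O} with hS
  have hSc : IsCompact S :=
    (hcl.preimage (Continuous.subtype_mk (by fun_prop) _)).isCompact
  have hSn : S.Nonempty := by
    refine ⟨⟨(γ s).1.2, hO _ (hγO s)⟩, ?_⟩
    show (⟨(θ, (γ s).1.2), _⟩ : Strip) ∈ O
    convert hγO s using 1
    exact Subtype.ext (Prod.ext hs.symm rfl)
  obtain ⟨t, ht, hmin⟩ := hSc.exists_isMinOn hSn (f := fun t => (t : ℝ)) (by fun_prop)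
  have ht0 : 0 < (t : ℝ) := hc.trans_le t.2.1
  refine ⟨⟨(θ, t.1), ht0⟩, ht, rfl, ?_⟩
  have hunder : ∀ u : ℝ, ∀ hu : 0 < u, u < t → (⟨(θ, u), hu⟩ : Strip) ∈ Under O := by
    intro u hu hut x hx e
    refine hut.trans_le (hmin (a := ⟨x.1.2, hO x hx⟩) ?_)
    show (⟨(θ, x.1.2), _⟩ : Strip) ∈ O
    convert hx using 1
    exact Subtype.ext (Prod.ext e.symm rfl)
  set f : ℝ → Strip := fun u => ⟨(θ, |u| / 2 + t / 2), by positivity⟩ with hf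
  have hfc : Continuous f := Continuous.subtype_mk (by fun_prop) _
  have hft : f t = ⟨(θ, t.1), ht0⟩ := by
    refine Subtype.ext (Prod.ext rfl ?_)
    simp only [hf, abs_of_pos ht0]; ring
  rw [← hft]
  refine map_mem_closure hfc (s := Set.Ioo 0 (t : ℝ)) ?_ ?_
  · rw [closure_Ioo ht0.ne]; exact ⟨ht0.le, le_rfl⟩
  · intro u hu
    refine ⟨hunder _ _ ?_, rfl⟩
    rw [abs_of_pos hu.1]; linarith [hu.2]

namespace SupportData

variable {p q : ℝ → ℝ} (h : SupportData p q)
include h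

lemma iterate_shift (j : ℤ) (k : ℕ) (x : Strip) :
    h.lift^[k] (x.shift j) = (h.lift^[k] x).shift j :=
  Function.Semiconj.iterate_right (f := Strip.shift j) (ga := h.lift) (gb := h.lift)
    (fun x => (h.lift_shift j x).symm) k x |>.symm

section Invariant

variable {O : Set Strip} (hO : ∀ x, h.lift x ∈ O ↔ x ∈ O) (hl : HasLines O)
  (hne : O.Nonempty) (hT : ∀ (j : ℤ) (x : Strip), x.shift j ∈ O ↔ x ∈ O)
  (hcl : IsClosed O) {c C : ℝ} (hc : 0 < c) (hOc : ∀ x ∈ O, x.1.2 ∈ Set.Icc c C)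

omit h in
include hT in
lemma _root_.shift_mem_under {y : Strip} (hy : y ∈ Under O) (j : ℤ) : y.shift j ∈ Under O := by
  intro x hx e
  refine hy (x.shift (-j)) ((hT _ _).2 hx) ?_
  simp only [Strip.shift] at e ⊢
  rw [e]; push_cast; ring

include hO hl hne hT hOc in
/-- An open set of points under `O` is recurrent up to deck translations. -/
lemma exists_recurrent_under {V : Set Strip} (hV : IsOpen V) (hVn : V.Nonempty)
    (hVO : V ⊆ Under O) (k : ℕ) :
    ∃ n, k ≤ n ∧ ∃ y, ∃ i j : ℤ, y.shift i ∈ V ∧ (h.lift^[n] y).shift j ∈ V := by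
  set A : Set Strip := ⋃ j : ℤ, Strip.shift j ⁻¹' V with hA
  have hAO : IsOpen A := isOpen_iUnion fun j => hV.preimage (Strip.continuous_shift j)
  have hAT : ∀ j : ℤ, ∀ x ∈ A, x.shift j ∈ A := by
    intro j x hx
    obtain ⟨i, hi⟩ := Set.mem_iUnion.1 hx
    refine Set.mem_iUnion.2 ⟨i - j, ?_⟩
    show (x.shift j).shift (i - j) ∈ V
    have e : (x.shift j).shift (i - j) = x.shift i := by
      refine Subtype.ext (Prod.ext ?_ rfl)
      simp only [Strip.shift]; push_cast; ring
    rw [e]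
    exact hi
  have hAU : A ⊆ Under O := by
    intro x hx
    obtain ⟨i, hi⟩ := Set.mem_iUnion.1 hx
    have := shift_mem_under hT (hVO hi) (-i)
    have e : (x.shift i).shift (-i) = x := by
      refine Subtype.ext (Prod.ext ?_ rfl)
      simp [Strip.shift]
    rwa [e] at this
  have hAn : A.Nonempty := by
    obtain ⟨v, hv⟩ := hVn
    refine ⟨v, Set.mem_iUnion.2 ⟨0, ?_⟩⟩
    show v.shift 0 ∈ V
    have e : v.shift 0 = v := by
      refine Subtype.ext (Prod.ext ?_ rfl)
      simp [Strip.shift]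
    rwa [e]
  obtain ⟨n, hn, y, hy, hyn⟩ := h.exists_recurrent hAO hAT hAn (C := C) (fun n x hx => by
    obtain ⟨z, hz, -, hlt⟩ := h.exists_above hO hl hne (hAU hx) n
    exact hlt.le.trans (hOc z hz).2) k
  obtain ⟨i, hi⟩ := Set.mem_iUnion.1 hy
  obtain ⟨j, hj⟩ := Set.mem_iUnion.1 hyn
  exact ⟨n, hn, y, i, j, hi, hj⟩

include hO hl hne hT hcl hc hOc

lemma iterate_le_of_lt {y x : Strip} (hy : y ∈ Under O) (hx : x ∈ O) (hlt : y.1.1 < x.1.1)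
    (k : ℕ) : (h.lift^[k] y).1.1 ≤ (h.lift^[k] x).1.1 := by
  by_contra hcon
  push Not at hcon
  have hk : Continuous fun z : Strip => (h.lift^[k] z).1.1 := by
    have := h.lift.continuous.iterate k
    fun_prop
  set V : Set Strip := Under O ∩ ({z | z.1.1 < x.1.1} ∩
    {z | (h.lift^[k] x).1.1 < (h.lift^[k] z).1.1})
  have hV : IsOpen V := (isOpen_under hcl hc hOc).inter
    ((isOpen_lt (by fun_prop) continuous_const).inter (isOpen_lt continuous_const hk))
  obtain ⟨n, hn, z, i, j, hi, hj⟩ := h.exists_recurrent_under hO hl hne hT hOc hV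
    ⟨y, hy, hlt, hcon⟩ Set.inter_subset_left k
  have hzn : h.lift^[n] (z.shift i) ∈ Under O := by
    have := shift_mem_under hT hj.1 (i - j)
    rw [iterate_shift]
    convert this using 1
    refine Subtype.ext (Prod.ext ?_ rfl)
    simp only [Strip.shift]; push_cast; ring
  have := h.relPos_mono hO hl hi.1 hzn hx (Nat.zero_le k) hn
  have k1 : relPos (h.lift^[0] (z.shift i)) (h.lift^[0] x) = 3 := relPos_eq_three.2 hi.2.1
  rw [k1, relPos_eq_one.2 hi.2.2] at this
  omega

lemma symm_iterate_le_of_lt {y x : Strip} (hy : y ∈ Under O) (hx : x ∈ O)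
    (hlt : x.1.1 < y.1.1) (k : ℕ) :
    (h.lift.symm^[k] x).1.1 ≤ (h.lift.symm^[k] y).1.1 := by
  by_contra hcon
  push Not at hcon
  have hk : Continuous fun z : Strip => (h.lift.symm^[k] z).1.1 := by
    have := h.lift.symm.continuous.iterate k
    fun_prop
  set V : Set Strip := Under O ∩ ({z | x.1.1 < z.1.1} ∩
    {z | (h.lift.symm^[k] z).1.1 < (h.lift.symm^[k] x).1.1})
  have hV : IsOpen V := (isOpen_under hcl hc hOc).inter
    ((isOpen_lt continuous_const (by fun_prop)).inter (isOpen_lt hk continuous_const))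
  obtain ⟨n, hn, z, i, j, hi, hj⟩ := h.exists_recurrent_under hO hl hne hT hOc hV
    ⟨y, hy, hlt, hcon⟩ Set.inter_subset_left k
  have hz : z.shift j ∈ Under O := by
    have := shift_mem_under hT hi.1 (j - i)
    convert this using 1
    refine Subtype.ext (Prod.ext ?_ rfl)
    simp only [Strip.shift]; push_cast; ring
  rw [← iterate_shift] at hj
  set w := z.shift j
  have inv : ∀ m : ℕ, Function.LeftInverse (h.lift^[m]) (h.lift.symm^[m]) := fun m =>
    Function.LeftInverse.iterate h.lift.apply_symm_apply m
  have inv' : ∀ m : ℕ, Function.LeftInverse (h.lift.symm^[m]) (h.lift^[m]) := fun m =>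
    Function.LeftInverse.iterate h.lift.symm_apply_apply m
  have hx' : h.lift.symm^[n] x ∈ O := by
    rw [← h.iterate_mem_iff hO n, inv]; exact hx
  have := h.relPos_mono hO hl hz hj.1 hx' (Nat.sub_le n k) le_rfl
  rw [inv] at this
  obtain ⟨d, rfl⟩ := Nat.exists_eq_add_of_le hn
  rw [Nat.add_sub_cancel_left] at this
  have e1 : h.lift^[d] (h.lift.symm^[k + d] x) = h.lift.symm^[k] x := by
    rw [add_comm, Function.iterate_add_apply, inv]
  have e2 : h.lift.symm^[k] (h.lift^[k + d] w) = h.lift^[d] w := by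
    rw [Function.iterate_add_apply, inv']
  have k1 := hj.2.1
  have k2 := hj.2.2
  rw [Set.mem_ofPred_eq] at k1 k2
  rw [e2] at k2
  rw [e1, relPos_eq_three.2 k2, relPos_eq_one.2 k1] at this
  omega

/-- For any two angles there are orbits in `O` through these angles whose order is
preserved for all times. -/
theorem exists_ordered_orbits {θ₀ θ₁ : ℝ} (hθ : θ₀ < θ₁) :
    ∃ x₀ ∈ O, ∃ x₁ ∈ O, x₀.1.1 = θ₀ ∧ x₁.1.1 = θ₁ ∧
      ∀ k : ℕ, (h.lift^[k] x₀).1.1 ≤ (h.lift^[k] x₁).1.1 ∧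
        (h.lift.symm^[k] x₀).1.1 ≤ (h.lift.symm^[k] x₁).1.1 := by
  obtain ⟨x₀, hx₀, e₀, c₀⟩ := exists_mem_closure_under hcl hc hOc hl hne θ₀
  obtain ⟨x₁, hx₁, e₁, c₁⟩ := exists_mem_closure_under hcl hc hOc hl hne θ₁
  refine ⟨x₀, hx₀, x₁, hx₁, e₀, e₁, fun k => ⟨?_, ?_⟩⟩
  · have hk : Continuous fun z : Strip => (h.lift^[k] z).1.1 := by
      have := h.lift.continuous.iterate k
      fun_prop
    refine closure_minimal ?_ (isClosed_le hk (continuous_const (y := (h.lift^[k] x₁).1.1))) c₀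
    rintro y ⟨hy, hye⟩
    exact h.iterate_le_of_lt hO hl hne hT hcl hc hOc hy hx₁ (by rw [hye, e₁]; exact hθ) k
  · have hk : Continuous fun z : Strip => (h.lift.symm^[k] z).1.1 := by
      have := h.lift.symm.continuous.iterate k
      fun_prop
    refine closure_minimal ?_
      (isClosed_le (continuous_const (y := (h.lift.symm^[k] x₀).1.1)) hk) c₁
    rintro y ⟨hy, hye⟩
    exact h.symm_iterate_le_of_lt hO hl hne hT hcl hc hOc hy hx₀ (by rw [hye, e₀]; exact hθ) k

end Invariant

end SupportData

lemma tendsto_of_shift {γ : ℝ → Strip} (hγ : Continuous γ) {d : ℤ} (hd : 0 < d)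
    (hper : ∀ s, γ (s + 2 * π) = (γ s).shift d) :
    Tendsto (fun s => (γ s).1.1) atTop atTop ∧ Tendsto (fun s => (γ s).1.1) atBot atBot := by
  have hP : Function.Periodic (fun s => (γ s).1.1 - d * s) (2 * π) := fun s => by
    simp only [hper, Strip.shift]; ring
  have hb := hP.isBounded_of_continuous two_pi_pos.ne' (by fun_prop)
  obtain ⟨B, hB⟩ := hb.exists_norm_le
  have hB' : ∀ s, |(γ s).1.1 - d * s| ≤ B := fun s => hB _ ⟨s, rfl⟩
  have hd' : (0 : ℝ) < d := by exact_mod_cast hd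
  constructor
  · refine tendsto_atTop_mono (f := fun s => d * s + -B) (fun s => ?_)
      (tendsto_atTop_add_const_right _ _ (tendsto_id.const_mul_atTop hd'))
    linarith [(abs_le.1 (hB' s)).1]
  · refine tendsto_atBot_mono (f := fun s => d * s + B) (fun s => ?_)
      (tendsto_atBot_add_const_right _ _ (tendsto_id.const_mul_atBot hd'))
    linarith [(abs_le.1 (hB' s)).2]

namespace SupportData

variable {p q : ℝ → ℝ} (h : SupportData p q)
include h

lemma eventually_exists_tangentPt (x₀ : Strip) {ε : ℝ} (hε : 0 < ε) :
    ∀ᶠ z in 𝓝 (tangentPt p q (-1) x₀), ∃ x : Strip, tangentPt p q (-1) x = z ∧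
      |x.1.1 - x₀.1.1| < ε := by
  set z₀ := tangentPt p q (-1) x₀ with hz₀
  set θ := x₀.1.1 with hθ
  have hcp := h.continuous_p
  have hcq := h.cont
  have hg : 0 < q θ - (-z₀.1 * sin θ + z₀.2 * cos θ) := by
    rw [hz₀, tangentPt, framePt_tangent]
    linarith [x₀.2]
  have he0 : z₀.1 * cos θ + z₀.2 * sin θ - p θ = 0 := by
    rw [hz₀, tangentPt, framePt_inner]; simp [hθ]
  have hev : ∀ᶠ w : (ℝ × ℝ) × ℝ in 𝓝 z₀ ×ˢ 𝓝 θ,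
      0 < q w.2 - (-w.1.1 * sin w.2 + w.1.2 * cos w.2) := by
    rw [← nhds_prod_eq]
    have hc : ContinuousAt (fun w : (ℝ × ℝ) × ℝ =>
      q w.2 - (-w.1.1 * sin w.2 + w.1.2 * cos w.2)) (z₀, θ) := by fun_prop
    exact hc.eventually_const_lt hg
  obtain ⟨pa, hpa, pb, hpb, hab⟩ := eventually_prod_iff.1 hev
  obtain ⟨δ₀, hδ₀, hball⟩ := Metric.eventually_nhds_iff.1 hpb
  obtain ⟨δ, hδ, hδm⟩ := exists_between (lt_min hδ₀ hε)
  obtain ⟨hδ1, hδ2⟩ := lt_min_iff.1 hδm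
  have hpb' : ∀ φ ∈ Set.Icc (θ - δ) (θ + δ), pb φ := fun φ hφ => hball (by
    rw [Real.dist_eq, abs_lt]; constructor <;> linarith [hφ.1, hφ.2])
  have hanti : StrictAntiOn (fun φ => z₀.1 * cos φ + z₀.2 * sin φ - p φ)
      (Set.Icc (θ - δ) (θ + δ)) := by
    refine strictAntiOn_of_deriv_neg (convex_Icc _ _) (by fun_prop) fun φ hφ => ?_
    have hd : HasDerivAt (fun φ => z₀.1 * cos φ + z₀.2 * sin φ - p φ)
        (z₀.1 * (-sin φ) + z₀.2 * cos φ - q φ) φ :=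
      (((hasDerivAt_cos φ).const_mul _).add ((hasDerivAt_sin φ).const_mul _)).sub (h.hasDeriv φ)
    rw [hd.deriv]
    have := hab hpa.self_of_nhds (hpb' φ (interior_subset hφ))
    simp only at this
    linarith
  have h1 := hanti (a := θ - δ) (b := θ) ⟨le_rfl, by linarith⟩ ⟨by linarith, by linarith⟩
    (by linarith)
  have h2 := hanti (a := θ) (b := θ + δ) ⟨by linarith, by linarith⟩ ⟨by linarith, le_rfl⟩
    (by linarith)
  simp only [he0] at h1 h2
  have hc : ∀ φ : ℝ, ContinuousAt (fun z : ℝ × ℝ => z.1 * cos φ + z.2 * sin φ - p φ) z₀ :=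
    fun φ => by fun_prop
  filter_upwards [hpa, (hc (θ - δ)).eventually_const_lt h1,
    (hc (θ + δ)).eventually_lt_const h2] with z hz hz1 hz2
  obtain ⟨φ, hφ, hφ0⟩ := intermediate_value_Icc' (a := θ - δ) (b := θ + δ) (by linarith)
    (f := fun φ => z.1 * cos φ + z.2 * sin φ - p φ) (by fun_prop) ⟨hz2.le, hz1.le⟩
  refine ⟨⟨(φ, q φ - (-z.1 * sin φ + z.2 * cos φ)), hab hz (hpb' φ hφ)⟩, ?_, ?_⟩
  · refine (eq_framePt p ?_ ?_).symm
    · simp only at hφ0 ⊢; linarith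
    · ring
  · rw [abs_lt]; constructor <;> linarith [hφ.1, hφ.2]

lemma exists_continuous_angle {U : Set (ℝ × ℝ)} (hU : ∀ z ∈ U, ∃ x, tangentPt p q (-1) x = z) :
    ∃ Θ : U → AddCircle (2 * π), Continuous Θ ∧
      ∀ (z : U) (x : Strip), tangentPt p q (-1) x = z → Θ z = (x.1.1 : AddCircle (2 * π)) := by
  have : Nonempty Strip := ⟨⟨(0, 1), one_pos⟩⟩
  choose! X hX using hU
  have key : ∀ (z : U) (x : Strip), tangentPt p q (-1) x = z →
      ((X z).1.1 : AddCircle (2 * π)) = (x.1.1 : AddCircle (2 * π)) := fun z x hx => by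
    obtain ⟨j, rfl⟩ := h.exists_shift_of_eq (Or.inr rfl) ((hX z z.2).trans hx.symm)
    rw [Strip.shift, eq_comm, QuotientAddGroup.eq_iff_sub_mem]
    exact ⟨j, by simp [mul_comm]⟩
  refine ⟨fun z => ((X z).1.1 : AddCircle (2 * π)), ?_, key⟩
  refine continuous_iff_continuousAt.2 fun z₀ => ?_
  intro N hN
  have hcoe : ContinuousAt (fun t : ℝ => (t : AddCircle (2 * π))) (X z₀).1.1 :=
    (AddCircle.continuous_mk' _).continuousAt
  obtain ⟨ε, hε, hb⟩ := Metric.eventually_nhds_iff.1 (hcoe.eventually hN)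
  have hev := h.eventually_exists_tangentPt (X z₀) hε
  rw [hX _ z₀.2] at hev
  have hev' := (continuous_subtype_val.continuousAt (x := z₀)).eventually hev
  refine mem_map.2 ?_
  filter_upwards [hev'] with z hz
  obtain ⟨x, hx, hxε⟩ := hz
  rw [Set.mem_preimage, key z x hx]
  exact hb (by rwa [Real.dist_eq])

lemma exists_lift_loop {U : Set (ℝ × ℝ)} (hU : ∀ z ∈ U, ∃ x, tangentPt p q (-1) x = z)
    (ℓ : C(AddCircle (2 * π), U)) :
    ∃ (γ : ℝ → Strip) (d : ℤ), Continuous γ ∧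
      (∀ s : ℝ, tangentPt p q (-1) (γ s) = ℓ (s : AddCircle (2 * π))) ∧
      ∀ s, γ (s + 2 * π) = (γ s).shift d := by
  have hπ := two_pi_pos
  obtain ⟨Θ, hΘ, hΘx⟩ := h.exists_continuous_angle hU
  have hcov : IsCoveringMap (fun t : ℝ => (t : AddCircle (2 * π))) :=
    AddCircle.isCoveringMap_coe (2 * π)
  let f : C(ℝ, AddCircle (2 * π)) :=
    ⟨fun s => Θ (ℓ (s : AddCircle (2 * π))),
      hΘ.comp (ℓ.continuous.comp (AddCircle.continuous_mk' _))⟩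
  obtain ⟨e₀, he₀⟩ := QuotientAddGroup.mk_surjective (f 0)
  obtain ⟨F, ⟨-, hF⟩, -⟩ := hcov.existsUnique_continuousMap_lifts f 0 e₀ he₀
  have hcq := h.cont
  have hFs : ∀ s, (F s : AddCircle (2 * π)) = Θ (ℓ (s : AddCircle (2 * π))) := congrFun hF
  have hx : ∀ s : ℝ, ∃ x : Strip, x.1.1 = F s ∧
      tangentPt p q (-1) x = ℓ (s : AddCircle (2 * π)) := fun s => by
    obtain ⟨y, hy⟩ := hU _ (ℓ (s : AddCircle (2 * π))).2
    have e := hFs s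
    rw [hΘx _ y hy, QuotientAddGroup.eq_iff_sub_mem] at e
    obtain ⟨j, hj⟩ := e
    refine ⟨y.shift j, ?_, by rw [h.tangentPt_shift, hy]⟩
    simp only [zsmul_eq_mul] at hj
    simp only [Strip.shift]
    linarith
  choose γ hγ1 hγ2 using hx
  have hγ3 : ∀ s, (γ s).1.2 = q (F s) -
      (-(ℓ (s : AddCircle (2 * π))).1.1 * sin (F s) +
        (ℓ (s : AddCircle (2 * π))).1.2 * cos (F s)) := fun s => by
    have := framePt_tangent p ((γ s).1.1, q (γ s).1.1 + -1 * (γ s).1.2)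
    change -(tangentPt p q (-1) (γ s)).1 * sin (γ s).1.1 +
      (tangentPt p q (-1) (γ s)).2 * cos (γ s).1.1 = _ at this
    rw [hγ2, hγ1] at this
    simp only at this
    linarith
  have hℓ : Continuous fun s : ℝ => (ℓ (s : AddCircle (2 * π))).1 :=
    continuous_subtype_val.comp (ℓ.continuous.comp (AddCircle.continuous_mk' _))
  have hγc : Continuous γ := by
    refine Continuous.subtype_mk (f := fun s => (γ s).1) ?_ _
    have : (fun s => (γ s).1) = fun s => (F s, q (F s) -
      (-(ℓ (s : AddCircle (2 * π))).1.1 * sin (F s) +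
        (ℓ (s : AddCircle (2 * π))).1.2 * cos (F s))) :=
      funext fun s => Prod.ext (hγ1 s) (hγ3 s)
    rw [this]
    fun_prop
  have hper : ∀ s : ℝ, ((s + 2 * π : ℝ) : AddCircle (2 * π)) = s :=
    fun s => AddCircle.coe_add_period _ _
  obtain ⟨d, hd⟩ : ∃ d : ℤ, d • (2 * π) = F (0 + 2 * π) - F 0 := by
    have : (F (0 + 2 * π) : AddCircle (2 * π)) = F 0 := by rw [hFs, hFs, hper]
    exact QuotientAddGroup.eq_iff_sub_mem.1 this
  have hFd : (fun s => F (s + 2 * π)) = fun s => F s + 2 * π * d := by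
    refine hcov.eq_of_comp_eq (by fun_prop) (by fun_prop) ?_ 0 ?_
    · funext s
      simp only [Function.comp_apply]
      rw [hFs, hper, ← hFs, eq_comm, QuotientAddGroup.eq_iff_sub_mem]
      exact ⟨d, by simp [mul_comm]⟩
    · simp only [zsmul_eq_mul] at hd ⊢
      linarith
  refine ⟨γ, d, hγc, hγ2, fun s => ?_⟩
  have e : (γ (s + 2 * π)).1.1 = ((γ s).shift d).1.1 := by
    rw [hγ1]; simp only [Strip.shift, hγ1]; exact congrFun hFd s
  exact h.tangentPt_eq_of_lt (Or.inr rfl) (by rw [h.tangentPt_shift, hγ2, hγ2, hper])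
    e.le (by rw [← e]; linarith)

lemma nullhomotopic_of_lift {U : Set (ℝ × ℝ)} (hU' : ∀ x, tangentPt p q (-1) x ∈ U)
    (ℓ : C(AddCircle (2 * π), U)) {γ : ℝ → Strip} (hγ : Continuous γ)
    (hℓ : ∀ s : ℝ, tangentPt p q (-1) (γ s) = ℓ (s : AddCircle (2 * π)))
    (hper : Function.Periodic γ (2 * π)) : ℓ.Nullhomotopic := by
  have hcp := h.continuous_p
  have hcq := h.cont
  have hcont : Continuous (hper.lift : AddCircle (2 * π) → Strip) :=
    (QuotientAddGroup.isQuotientMap_mk _).continuous_iff.2 hγ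
  let g : C(AddCircle (2 * π), Strip) := ⟨hper.lift, hcont⟩
  let B : C(Strip, U) := ⟨fun x => ⟨tangentPt p q (-1) x, hU' x⟩,
    Continuous.subtype_mk (by unfold tangentPt framePt; fun_prop) _⟩
  have : ContractibleSpace Strip := by
    have : Convex ℝ {x : ℝ × ℝ | 0 < x.2} :=
      (convex_Ioi (0 : ℝ)).linear_preimage (LinearMap.snd ℝ ℝ ℝ)
    exact this.contractibleSpace ⟨(0, 1), by simp⟩
  have e : ℓ = B.comp ((ContinuousMap.id Strip).comp g) := by
    ext1 s
    obtain ⟨s, rfl⟩ := QuotientAddGroup.mk_surjective s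
    exact Subtype.ext (hℓ s).symm
  rw [e]
  exact ((id_nullhomotopic Strip).comp_left g).comp_right B

/-- A homotopically nontrivial loop lifts to lines crossing the strip. -/
lemma hasLines_of_not_nullhomotopic {U : Set (ℝ × ℝ)}
    (hU : ∀ z ∈ U, ∃ x, tangentPt p q (-1) x = z) (hU' : ∀ x, tangentPt p q (-1) x ∈ U)
    (ℓ : C(AddCircle (2 * π), U)) (hℓ : ¬ ℓ.Nullhomotopic) :
    HasLines {x | tangentPt p q (-1) x ∈ Subtype.val '' Set.range ℓ} := by
  obtain ⟨γ, d, hγ, hγℓ, hγd⟩ := h.exists_lift_loop hU ℓ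
  have hmem : ∀ s, tangentPt p q (-1) (γ s) ∈ Subtype.val '' Set.range ℓ := fun s =>
    ⟨_, ⟨_, rfl⟩, (hγℓ s).symm⟩
  obtain ⟨γ', hγ', hγ'm, hγ's, hT, hB⟩ : ∃ γ' : ℝ → Strip, Continuous γ' ∧
      (∀ s, tangentPt p q (-1) (γ' s) ∈ Subtype.val '' Set.range ℓ) ∧
      (∀ s, ∃ t, γ' t = γ s) ∧
      Tendsto (fun s => (γ' s).1.1) atTop atTop ∧ Tendsto (fun s => (γ' s).1.1) atBot atBot := by
    rcases lt_trichotomy d 0 with hd | hd | hd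
    · refine ⟨fun s => γ (-s), hγ.comp continuous_neg, fun s => hmem _,
        fun s => ⟨-s, by simp⟩, ?_⟩
      refine tendsto_of_shift (hγ.comp continuous_neg) (d := -d) (by omega) fun s => ?_
      have := hγd (-(s + 2 * π))
      rw [show -(s + 2 * π) + 2 * π = -s by ring] at this
      simp [this, Strip.shift]
    · refine absurd (h.nullhomotopic_of_lift hU' ℓ hγ hγℓ fun s => ?_) hℓ
      rw [hγd, hd]; simp [Strip.shift]
    · exact ⟨γ, hγ, hmem, fun s => ⟨s, rfl⟩, tendsto_of_shift hγ hd hγd⟩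
  rintro x ⟨_, ⟨s, rfl⟩, hs⟩
  obtain ⟨s, rfl⟩ := QuotientAddGroup.mk_surjective s
  obtain ⟨j, hj⟩ := h.exists_shift_of_eq (Or.inr rfl) ((hγℓ s).trans hs)
  obtain ⟨t, ht⟩ := hγ's s
  refine ⟨fun s => (γ' s).shift j, (Strip.continuous_shift j).comp hγ', fun s => ?_,
    ⟨t, by simp only [ht, hj]⟩, ?_, ?_⟩
  · rw [Set.mem_ofPred_eq, h.tangentPt_shift]; exact hγ'm s
  · exact tendsto_atTop_add_const_right _ _ hT
  · exact tendsto_atBot_add_const_right _ _ hB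

end SupportData

lemma hasDerivAt_neg_comp_neg {q : ℝ → ℝ} {r t : ℝ} (hq : HasDerivAt q r (-t)) :
    HasDerivAt (fun x => -q (-x)) r t := by
  have := (HasDerivAt.comp t hq (hasDerivAt_neg t) : HasDerivAt (q ∘ Neg.neg) (r * -1) t).neg
  rw [mul_neg_one, neg_neg] at this
  exact this

namespace SupportData

variable {p q : ℝ → ℝ} (h : SupportData p q)
include h

lemma hasDerivAt_lamP {b c : ℝ → ℝ} {b' c' q' s : ℝ} (hb : HasDerivAt b b' s)
    (hc : HasDerivAt c c' s) (hq : HasDerivAt q q' (b s)) (hs : sin (c s - b s) ≠ 0) :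
    HasDerivAt (fun s => lamP p q (b s) (c s))
      (lamM p q (b s) (c s) / sin (c s - b s) * c' -
        (q' + p (b s) - lamP p q (b s) (c s) * cos (c s - b s) / sin (c s - b s)) * b') s := by
  have hu := hc.sub hb
  have h1 := ((((h.hasDeriv (c s)).comp s hc).sub
    (((h.hasDeriv (b s)).comp s hb).mul hu.cos)).div hu.sin hs).sub (hq.comp s hb)
  refine h1.congr_deriv ?_
  have hsc := sin_sq_add_cos_sq (c s - b s)
  simp only [lamP, lamM, Pi.sub_apply, Function.comp_apply, Pi.mul_apply]
  generalize sin (c s - b s) = S at *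
  generalize cos (c s - b s) = C at *
  field_simp
  linear_combination p (b s) * c' * hsc

lemma hasDerivAt_lamM {a b : ℝ → ℝ} {a' b' q' s : ℝ} (ha : HasDerivAt a a' s)
    (hb : HasDerivAt b b' s) (hq : HasDerivAt q q' (b s)) (hs : sin (b s - a s) ≠ 0) :
    HasDerivAt (fun s => lamM p q (a s) (b s))
      (-(lamP p q (a s) (b s) / sin (b s - a s) * a') +
        (q' + p (b s) - lamM p q (a s) (b s) * cos (b s - a s) / sin (b s - a s)) * b') s := by
  have hq' : HasDerivAt (fun x => -q (-x)) q' (-b s) :=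
    hasDerivAt_neg_comp_neg (by rwa [neg_neg])
  have hs' : sin (-a s - -b s) ≠ 0 := by rwa [show -a s - -b s = b s - a s by ring]
  have := h.reflect.hasDerivAt_lamP hb.neg ha.neg hq' hs'
  simp only [Pi.neg_apply, lamP_reflect, lamM_reflect, neg_neg,
    show -a s - -b s = b s - a s by ring] at this
  exact this.congr_deriv (by ring)

/-- Two solutions of the dual billiards recurrence satisfy a linear three term relation whose
coefficients are evaluated on an interpolating triple. -/
lemma exists_three_term {a₀ b₀ c₀ a₁ b₁ c₁ : ℝ} (hab₀ : a₀ < b₀) (hbc₀ : b₀ < c₀)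
    (hab₁ : a₁ < b₁) (hbc₁ : b₁ < c₁) (hab₀' : b₀ < a₀ + π) (hbc₀' : c₀ < b₀ + π)
    (hab₁' : b₁ < a₁ + π) (hbc₁' : c₁ < b₁ + π)
    (h₀ : lamP p q b₀ c₀ = lamM p q a₀ b₀) (h₁ : lamP p q b₁ c₁ = lamM p q a₁ b₁)
    {ρ : ℝ → ℝ}
    (hq : ∀ s ∈ Set.Ioo (0 : ℝ) 1,
      HasDerivAt q (ρ (b₀ + s * (b₁ - b₀)) - p (b₀ + s * (b₁ - b₀))) (b₀ + s * (b₁ - b₀))) :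
    ∃ s ∈ Set.Ioo (0 : ℝ) 1, ∃ a b c : ℝ, a = a₀ + s * (a₁ - a₀) ∧ b = b₀ + s * (b₁ - b₀) ∧
      c = c₀ + s * (c₁ - c₀) ∧
      lamP p q a b / sin (b - a) * (a₁ - a₀) + lamM p q b c / sin (c - b) * (c₁ - c₀) =
        (2 * ρ b - lamP p q b c * cos (c - b) / sin (c - b) -
          lamM p q a b * cos (b - a) / sin (b - a)) * (b₁ - b₀) := by
  have hlin : ∀ x y s : ℝ, HasDerivAt (fun s : ℝ => x + s * (y - x)) (y - x) s := fun x y s => by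
    simpa using ((hasDerivAt_id s).mul_const (y - x)).const_add x
  have hpos : ∀ {x₀ y₀ x₁ y₁ s : ℝ}, x₀ < y₀ → x₁ < y₁ → y₀ < x₀ + π → y₁ < x₁ + π →
      s ∈ Set.Icc (0 : ℝ) 1 → 0 < sin (y₀ + s * (y₁ - y₀) - (x₀ + s * (x₁ - x₀))) := by
    intro x₀ y₀ x₁ y₁ s hx hy hx' hy' hs
    obtain ⟨hs0, hs1⟩ := hs
    have e : y₀ + s * (y₁ - y₀) - (x₀ + s * (x₁ - x₀)) = (1 - s) * (y₀ - x₀) + s * (y₁ - x₁) := by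
      ring
    rw [e]
    apply sin_pos_of_pos_of_lt_pi
    · rcases hs0.eq_or_lt with rfl | hs0
      · simpa using hx
      · nlinarith
    · rcases hs0.eq_or_lt with rfl | hs0
      · simp; linarith
      · nlinarith
  set g : ℝ → ℝ := fun s => lamP p q (b₀ + s * (b₁ - b₀)) (c₀ + s * (c₁ - c₀)) -
    lamM p q (a₀ + s * (a₁ - a₀)) (b₀ + s * (b₁ - b₀)) with hg
  have hcp := h.continuous_p
  have hcq := h.cont
  have hcont : ContinuousOn g (Set.Icc 0 1) := by
    intro s hs
    have h1 := (hpos hbc₀ hbc₁ hbc₀' hbc₁' hs).ne'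
    have h2 := (hpos hab₀ hab₁ hab₀' hab₁' hs).ne'
    apply ContinuousAt.continuousWithinAt
    simp only [hg, lamP, lamM]
    fun_prop (disch := assumption)
  have hg01 : g 0 = g 1 := by
    simp only [hg, zero_mul, add_zero, one_mul, add_sub_cancel, h₀, h₁, sub_self]
  have hder : ∀ s ∈ Set.Ioo (0 : ℝ) 1, HasDerivAt g _ s := fun s hs =>
    (h.hasDerivAt_lamP (hlin b₀ b₁ s) (hlin c₀ c₁ s) (hq s hs)
      (hpos hbc₀ hbc₁ hbc₀' hbc₁' ⟨hs.1.le, hs.2.le⟩).ne').sub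
    (h.hasDerivAt_lamM (hlin a₀ a₁ s) (hlin b₀ b₁ s) (hq s hs)
      (hpos hab₀ hab₁ hab₀' hab₁' ⟨hs.1.le, hs.2.le⟩).ne')
  obtain ⟨s, hs, h0⟩ := exists_hasDerivAt_eq_zero one_pos hcont hg01 hder
  exact ⟨s, hs, _, _, _, rfl, rfl, rfl, by linear_combination h0⟩

omit h in
lemma half_mul_le_div {m l u : ℝ} (hm : 0 ≤ m) (hu : 0 < sin u)
    (hl : m * (1 - cos u) ≤ l * sin u) : m / 2 ≤ l / sin u := by
  rw [le_div_iff₀ hu]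
  have hsc := sin_sq_add_cos_sq u
  have h1 := cos_le_one u
  have : m / 2 * sin u * sin u ≤ l * sin u :=
    le_trans (by nlinarith [mul_nonneg hm (sq_nonneg (1 - cos u))]) hl
  exact le_of_mul_le_mul_right this hu

/-- The three term inequality for two ordered orbits. -/
lemma three_term_le {a₀ b₀ c₀ a₁ b₁ c₁ : ℝ} (hab₀ : a₀ < b₀) (hbc₀ : b₀ < c₀)
    (hab₁ : a₁ < b₁) (hbc₁ : b₁ < c₁) (hab₀' : b₀ < a₀ + π) (hbc₀' : c₀ < b₀ + π)
    (hab₁' : b₁ < a₁ + π) (hbc₁' : c₁ < b₁ + π)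
    (h₀ : lamP p q b₀ c₀ = lamM p q a₀ b₀) (h₁ : lamP p q b₁ c₁ = lamM p q a₁ b₁)
    (ha : a₀ ≤ a₁) (hb : b₀ ≤ b₁) (hc : c₀ ≤ c₁) {ρ : ℝ → ℝ} {M mA mB η : ℝ} (hmA : 0 ≤ mA)
    (hmB : 0 ≤ mB) (hη : η ≤ 1)
    (hρ : ∀ s ∈ Set.Ioo (0 : ℝ) 1, ρ (b₀ + s * (b₁ - b₀)) ≤ M ∧
      HasDerivAt q (ρ (b₀ + s * (b₁ - b₀)) - p (b₀ + s * (b₁ - b₀))) (b₀ + s * (b₁ - b₀)))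
    (hA : ∀ s ∈ Set.Ioo (0 : ℝ) 1, ∀ a b : ℝ, a = a₀ + s * (a₁ - a₀) → b = b₀ + s * (b₁ - b₀) →
      1 - η ≤ cos (b - a) ∧ 0 < sin (b - a) ∧ mA * (1 - cos (b - a)) ≤ lamP p q a b * sin (b - a) ∧
      mA * (1 - cos (b - a)) ≤ lamM p q a b * sin (b - a))
    (hB : ∀ s ∈ Set.Ioo (0 : ℝ) 1, ∀ b c : ℝ, b = b₀ + s * (b₁ - b₀) → c = c₀ + s * (c₁ - c₀) →
      1 - η ≤ cos (c - b) ∧ 0 < sin (c - b) ∧ mB * (1 - cos (c - b)) ≤ lamP p q b c * sin (c - b) ∧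
      mB * (1 - cos (c - b)) ≤ lamM p q b c * sin (c - b)) :
    mA * (a₁ - a₀) + mB * (c₁ - c₀) ≤ (4 * M - (1 - η) * (mA + mB)) * (b₁ - b₀) := by
  obtain ⟨s, hs, a, b, c, ea, eb, ec, key⟩ := h.exists_three_term hab₀ hbc₀ hab₁ hbc₁ hab₀' hbc₀'
    hab₁' hbc₁' h₀ h₁ (fun s hs => (hρ s hs).2)
  obtain ⟨hA1, hA2, hA3, hA4⟩ := hA s hs a b ea eb
  obtain ⟨hB1, hB2, hB3, hB4⟩ := hB s hs b c eb ec
  have hρM := (hρ s hs).1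
  rw [← eb] at hρM
  have e1 := half_mul_le_div hmA hA2 hA3
  have e2 := half_mul_le_div hmB hB2 hB4
  have e3 := half_mul_le_div hmA hA2 hA4
  have e4 := half_mul_le_div hmB hB2 hB3
  have e5 : mA / 2 * (1 - η) ≤ lamM p q a b * cos (b - a) / sin (b - a) := by
    rw [mul_div_right_comm]
    exact mul_le_mul e3 hA1 (by linarith) (le_trans (by linarith) e3)
  have e6 : mB / 2 * (1 - η) ≤ lamP p q b c * cos (c - b) / sin (c - b) := by
    rw [mul_div_right_comm]
    exact mul_le_mul e4 hB1 (by linarith) (le_trans (by linarith) e4)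
  have f1 := mul_le_mul_of_nonneg_right e1 (sub_nonneg.2 ha)
  have f2 := mul_le_mul_of_nonneg_right e2 (sub_nonneg.2 hc)
  have f3 : (2 * ρ b - lamP p q b c * cos (c - b) / sin (c - b) -
      lamM p q a b * cos (b - a) / sin (b - a)) * (b₁ - b₀) ≤
      (2 * M - mB / 2 * (1 - η) - mA / 2 * (1 - η)) * (b₁ - b₀) :=
    mul_le_mul_of_nonneg_right (by linarith) (sub_nonneg.2 hb)
  nlinarith

end SupportData

namespace SupportData

variable {p q : ℝ → ℝ} (h : SupportData p q)
include h

lemma hasDerivAt_inner {e t r : ℝ} (hq : HasDerivAt q (r - p t) t) :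
    HasDerivAt (fun t => p t * cos (e - t) + q t * sin (e - t)) (r * sin (e - t)) t := by
  have hu : HasDerivAt (fun t : ℝ => e - t) (-1) t := (hasDerivAt_id t).const_sub e
  exact (((h.hasDeriv t).mul hu.cos).add (hq.mul hu.sin)).congr_deriv (by ring)

lemma le_inner_sub {x y e m : ℝ} (hxy : x ≤ y) (hye : y ≤ e) (hex : e ≤ x + π) {ρ : ℝ → ℝ}
    (hd : ∀ t ∈ Set.Ioo x y, HasDerivAt q (ρ t - p t) t ∧ m ≤ ρ t) :
    m * (cos (e - y) - cos (e - x)) ≤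
      (p y * cos (e - y) + q y * sin (e - y)) - (p x * cos (e - x) + q x * sin (e - x)) := by
  have hcp := h.continuous_p
  have hcq := h.cont
  have hmono : MonotoneOn (fun t => p t * cos (e - t) + q t * sin (e - t) - m * cos (e - t))
      (Set.Icc x y) := by
    refine monotoneOn_of_hasDerivWithinAt_nonneg (convex_Icc _ _) (by fun_prop)
      (f' := fun t => ρ t * sin (e - t) - m * sin (e - t)) (fun t ht => ?_) fun t ht => ?_
    · rw [interior_Icc] at ht
      have hu : HasDerivAt (fun t : ℝ => e - t) (-1) t := (hasDerivAt_id t).const_sub e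
      exact (((h.hasDerivAt_inner (hd t ht).1).sub (hu.cos.const_mul m)).congr_deriv
        (by ring)).hasDerivWithinAt
    · rw [interior_Icc] at ht
      have : 0 ≤ sin (e - t) :=
        sin_nonneg_of_nonneg_of_le_pi (by linarith [ht.2]) (by linarith [ht.1])
      nlinarith [(hd t ht).2]
  have := hmono ⟨le_rfl, hxy⟩ ⟨hxy, le_rfl⟩ hxy
  simp only at this
  linarith

lemma inner_sub_le {x y e m : ℝ} (hxy : x ≤ y) (hye : y ≤ e) (hex : e ≤ x + π) {ρ : ℝ → ℝ}
    (hd : ∀ t ∈ Set.Ioo x y, HasDerivAt q (ρ t - p t) t ∧ ρ t ≤ m) :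
    (p y * cos (e - y) + q y * sin (e - y)) - (p x * cos (e - x) + q x * sin (e - x)) ≤
      m * (cos (e - y) - cos (e - x)) := by
  have hcp := h.continuous_p
  have hcq := h.cont
  have hmono : MonotoneOn (fun t => m * cos (e - t) - (p t * cos (e - t) + q t * sin (e - t)))
      (Set.Icc x y) := by
    refine monotoneOn_of_hasDerivWithinAt_nonneg (convex_Icc _ _) (by fun_prop)
      (f' := fun t => m * sin (e - t) - ρ t * sin (e - t)) (fun t ht => ?_) fun t ht => ?_
    · rw [interior_Icc] at ht
      have hu : HasDerivAt (fun t : ℝ => e - t) (-1) t := (hasDerivAt_id t).const_sub e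
      exact (((hu.cos.const_mul m).sub (h.hasDerivAt_inner (hd t ht).1)).congr_deriv
        (by ring)).hasDerivWithinAt
    · rw [interior_Icc] at ht
      have : 0 ≤ sin (e - t) :=
        sin_nonneg_of_nonneg_of_le_pi (by linarith [ht.2]) (by linarith [ht.1])
      nlinarith [(hd t ht).2]
  have := hmono ⟨le_rfl, hxy⟩ ⟨hxy, le_rfl⟩ hxy
  simp only at this
  linarith

lemma inner_lt {x y e : ℝ} (hxy : x < y) (hye : y ≤ e) (hex : e ≤ x + π) {ρ : ℝ → ℝ}
    (hd : ∀ t ∈ Set.Ioo x y, HasDerivAt q (ρ t - p t) t ∧ 0 < ρ t) :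
    p x * cos (e - x) + q x * sin (e - x) < p y * cos (e - y) + q y * sin (e - y) := by
  have hcp := h.continuous_p
  have hcq := h.cont
  have hmono : StrictMonoOn (fun t => p t * cos (e - t) + q t * sin (e - t))
      (Set.Icc x y) := by
    refine strictMonoOn_of_hasDerivWithinAt_pos (convex_Icc _ _) (by fun_prop)
      (f' := fun t => ρ t * sin (e - t)) (fun t ht => ?_) fun t ht => ?_
    · rw [interior_Icc] at ht
      exact (h.hasDerivAt_inner (hd t ht).1).hasDerivWithinAt
    · rw [interior_Icc] at ht
      exact mul_pos (hd t ht).2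
        (sin_pos_of_pos_of_lt_pi (by linarith [ht.2]) (by linarith [ht.1]))
  exact hmono ⟨le_rfl, hxy.le⟩ ⟨hxy.le, le_rfl⟩ hxy

lemma lamP_lower {b τ c m : ℝ} (hbτ : b ≤ τ) (hτc : τ ≤ c) (hbc : b < c) (hπ : c < b + π)
    (hm : 0 ≤ m) {ρ : ℝ → ℝ} (h1 : ∀ t ∈ Set.Ioo b τ, HasDerivAt q (ρ t - p t) t ∧ 0 ≤ ρ t)
    (h2 : ∀ t ∈ Set.Ioo τ c, HasDerivAt q (ρ t - p t) t ∧ m ≤ ρ t) :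
    m * (1 - cos (c - b) - (τ - b)) ≤ lamP p q b c * sin (c - b) := by
  rw [lamP_mul (sin_pos' hbc hπ).ne']
  have e1 := h.le_inner_sub hbτ hτc hπ.le h1
  have e2 := h.le_inner_sub hτc le_rfl (by linarith) h2
  have e3 : cos (c - τ) ≤ cos (c - b) + (τ - b) := by
    have := abs_cos_sub_cos_le (c - τ) (c - b)
    rw [show c - τ - (c - b) = -(τ - b) by ring, abs_neg, abs_of_nonneg (sub_nonneg.2 hbτ)] at this
    linarith [le_abs_self (cos (c - τ) - cos (c - b))]
  simp only [sub_self, cos_zero, sin_zero] at e2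
  nlinarith

lemma lamM_lower {b τ c m : ℝ} (hbτ : b ≤ τ) (hτc : τ ≤ c) (hbc : b < c) (hπ : c < b + π)
    (hm : 0 ≤ m) {ρ : ℝ → ℝ} (h1 : ∀ t ∈ Set.Ioo b τ, HasDerivAt q (ρ t - p t) t ∧ 0 ≤ ρ t)
    (h2 : ∀ t ∈ Set.Ioo τ c, HasDerivAt q (ρ t - p t) t ∧ m ≤ ρ t) :
    m * (1 - cos (c - b) - (τ - b)) ≤ lamM p q b c * sin (c - b) := by
  have e1 := h.reflect.le_inner_sub (x := -c) (y := -τ) (e := -b) (m := m)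
    (ρ := fun t => ρ (-t)) (by linarith) (by linarith)
    (by linarith) fun t ht =>
      ⟨hasDerivAt_neg_comp_neg (h2 (-t) ⟨by linarith [ht.2], by linarith [ht.1]⟩).1,
      (h2 (-t) ⟨by linarith [ht.2], by linarith [ht.1]⟩).2⟩
  have e2 := h.reflect.le_inner_sub (x := -τ) (y := -b) (e := -b) (m := 0)
    (ρ := fun t => ρ (-t)) (by linarith) (by linarith)
    (by linarith) fun t ht =>
      ⟨hasDerivAt_neg_comp_neg (h1 (-t) ⟨by linarith [ht.2], by linarith [ht.1]⟩).1,
      (h1 (-t) ⟨by linarith [ht.2], by linarith [ht.1]⟩).2⟩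
  rw [lamM_mul (sin_pos' hbc hπ).ne']
  have e3 : 1 - (τ - b) ≤ cos (τ - b) := by
    have := abs_cos_sub_cos_le 0 (τ - b)
    rw [cos_zero, zero_sub, abs_neg, abs_of_nonneg (sub_nonneg.2 hbτ)] at this
    linarith [le_abs_self (1 - cos (τ - b))]
  simp only [neg_neg, sub_self, cos_zero, sin_zero, show ∀ x, -b - -x = x - b from
    fun x => by ring] at e1 e2
  nlinarith

lemma lamP_upper {b τ c m : ℝ} (hbτ : b ≤ τ) (hτc : τ ≤ c) (hbc : b < c) (hπ : c ≤ b + π / 2)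
    (hm : 0 ≤ m) {ρ : ℝ → ℝ} (h1 : ∀ t ∈ Set.Ioo b τ, HasDerivAt q (ρ t - p t) t ∧ ρ t ≤ m)
    (h2 : ∀ t ∈ Set.Ioo τ c, HasDerivAt q (ρ t - p t) t ∧ ρ t ≤ m) :
    lamP p q b c ≤ m * (c - b) := by
  have hs := sin_pos' hbc (by linarith [pi_pos])
  have key : lamP p q b c * sin (c - b) ≤ m * (1 - cos (c - b)) := by
    rw [lamP_mul hs.ne']
    have e1 := h.inner_sub_le hbτ hτc (by linarith [pi_pos]) h1
    have e2 := h.inner_sub_le hτc le_rfl (by linarith [pi_pos]) h2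
    simp only [sub_self, cos_zero, sin_zero] at e2
    linarith
  have hc : 0 ≤ cos (c - b) := cos_nonneg_of_neg_pi_div_two_le_of_le (by linarith) (by linarith)
  have hsc := sin_sq_add_cos_sq (c - b)
  have h3 : lamP p q b c * sin (c - b) ≤ m * sin (c - b) * sin (c - b) :=
    key.trans (by nlinarith [mul_nonneg hm (mul_nonneg hc (sub_nonneg.2 (cos_le_one (c - b))))])
  exact (le_of_mul_le_mul_right h3 hs).trans
    (mul_le_mul_of_nonneg_left (sin_le (by linarith)) hm)

/-- Short tangents make short steps. -/
lemma exists_step_bound {ρ : ℝ → ℝ} {t₀ r₀ w δ : ℝ} (hδ : 0 < δ) (hδπ : δ < π)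
    (hloc : ∀ t, t ≠ t₀ → |t - t₀| < r₀ → HasDerivAt q (ρ t - p t) t ∧ 0 < ρ t)
    (hw : w + δ < r₀) :
    ∃ m, 0 < m ∧ ∀ x, |x - t₀| ≤ w → ∀ y, x < y → y < x + π → lamP p q x y ≤ m → y < x + δ := by
  have hs : 0 < sin δ := sin_pos_of_pos_of_lt_pi hδ hδπ
  have hcp := h.continuous_p
  have hcq := h.cont
  have hpos : ∀ x, |x - t₀| ≤ w → 0 < lamP p q x (x + δ) := by
    intro x hx
    obtain ⟨hx1, hx2⟩ := abs_le.1 hx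
    have hsx : sin (x + δ - x) ≠ 0 := by rw [add_sub_cancel_left]; exact hs.ne'
    have hd : ∀ t ∈ Set.Ioo x (x + δ), t ≠ t₀ → HasDerivAt q (ρ t - p t) t ∧ 0 < ρ t :=
      fun t ht hne => hloc t hne (by rw [abs_lt]; constructor <;> linarith [ht.1, ht.2])
    have key : p x * cos (x + δ - x) + q x * sin (x + δ - x) < p (x + δ) := by
      have e : p (x + δ) = p (x + δ) * cos (x + δ - (x + δ)) +
        q (x + δ) * sin (x + δ - (x + δ)) := by simp
      rw [e]
      by_cases ht : t₀ ∈ Set.Ioo x (x + δ)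
      · exact (h.inner_lt ht.1 ht.2.le (by linarith) fun t h' =>
          hd t ⟨h'.1, h'.2.trans ht.2⟩ h'.2.ne).trans
          (h.inner_lt ht.2 le_rfl (by linarith [ht.1]) fun t h' =>
          hd t ⟨ht.1.trans h'.1, h'.2⟩ h'.1.ne')
      · exact h.inner_lt (by linarith) le_rfl (by linarith) fun t h' =>
          hd t h' fun e => ht (e ▸ h')
    have := lamP_mul (p := p) (q := q) hsx
    by_contra hc
    push Not at hc
    rw [add_sub_cancel_left] at *
    nlinarith
  rcases (Set.Icc (t₀ - w) (t₀ + w)).eq_empty_or_nonempty with he | hne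
  · refine ⟨1, one_pos, fun x hx => ?_⟩
    have : x ∈ Set.Icc (t₀ - w) (t₀ + w) := by
      obtain ⟨hx1, hx2⟩ := abs_le.1 hx
      constructor <;> linarith
    rw [he] at this
    exact this.elim
  have hcont : Continuous fun x => lamP p q x (x + δ) := by
    simp only [lamP, add_sub_cancel_left]
    fun_prop
  obtain ⟨x₁, hx₁, hmin⟩ := isCompact_Icc.exists_isMinOn hne hcont.continuousOn
  have hp1 := hpos x₁ (by rw [abs_le]; constructor <;> linarith [hx₁.1, hx₁.2])
  refine ⟨_, half_pos hp1, fun x hx y hxy hy hle => ?_⟩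
  by_contra hc
  push Not at hc
  obtain ⟨hx1, hx2⟩ := abs_le.1 hx
  have h1 := hmin (a := x) ⟨by linarith, by linarith⟩
  have h2 := h.lamP_mono (θ := x) (by linarith) hc hy
  simp only [Set.mem_ofPred_eq] at h1
  linarith

end SupportData

lemma lerp_le {x y u s : ℝ} (hs : s ∈ Set.Ioo (0 : ℝ) 1) (hx : x ≤ u) (hy : y ≤ u) :
    x + s * (y - x) ≤ u := by
  nlinarith [hs.1, hs.2, mul_nonneg hs.1.le (sub_nonneg.2 hy),
    mul_nonneg (sub_nonneg.2 hs.2.le) (sub_nonneg.2 hx)]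

lemma le_lerp {x y l s : ℝ} (hs : s ∈ Set.Ioo (0 : ℝ) 1) (hx : l ≤ x) (hy : l ≤ y) :
    l ≤ x + s * (y - x) := by
  nlinarith [hs.1, hs.2, mul_nonneg hs.1.le (sub_nonneg.2 hy),
    mul_nonneg (sub_nonneg.2 hs.2.le) (sub_nonneg.2 hx)]

/-- A nearly convex nonnegative sequence that starts by decreasing becomes negative. -/
lemma not_nearly_convex {ξ : ℕ → ℝ} {κ ν : ℝ} {N : ℕ} (h0 : 0 < ξ 0) (hξ : ∀ n, 0 ≤ ξ n)
    (h1 : ξ 1 ≤ (1 - κ) * ξ 0) (hrec : ∀ n < N, ξ n + ξ (n + 2) ≤ (2 + ν) * ξ (n + 1))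
    (hν : 0 ≤ ν) (hνN : ν * N ≤ κ / 2) (hN : 2 < N * κ) : False := by
  have key : ∀ n ≤ N, ξ n ≤ ξ 0 ∧ ξ (n + 1) - ξ n ≤ (-κ + ν * n) * ξ 0 ∧
      ξ n ≤ (1 - n * (κ / 2)) * ξ 0 := by
    intro n
    induction n with
    | zero => intro; exact ⟨le_rfl, by simp; linarith, by simp⟩
    | succ n ih =>
      intro hn
      obtain ⟨i1, i2, i3⟩ := ih (by omega)
      have hr := hrec n (by omega)
      have hnN : ν * n ≤ κ / 2 := le_trans (mul_le_mul_of_nonneg_left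
        (by exact_mod_cast (by omega : n ≤ N)) hν) hνN
      have hκ : 0 < κ := by
        by_contra hc
        push Not at hc
        nlinarith [(Nat.cast_nonneg N : (0 : ℝ) ≤ N)]
      have j1 : ξ (n + 1) - ξ n ≤ -(κ / 2) * ξ 0 :=
        i2.trans (mul_le_mul_of_nonneg_right (by linarith) h0.le)
      have j2 : ξ (n + 1) ≤ ξ 0 := by nlinarith
      refine ⟨j2, ?_, ?_⟩
      · push_cast
        have := mul_le_mul_of_nonneg_left j2 hν
        have : ξ (n + 1 + 1) = ξ (n + 2) := rfl
        nlinarith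
      · push_cast; nlinarith
  have h3 := (key N le_rfl).2.2
  have := hξ N
  nlinarith

/-- Bounds on the curvature radius `ρ` near `t₀`, two-sided to the right of `t₀` and only
nonnegativity on the short interval of length `σ` to its left. -/
structure CurvatureWindow (p q ρ : ℝ → ℝ) (t₀ w σ δ Δ m M η : ℝ) : Prop where
  left : ∀ t ∈ Set.Ioo (t₀ - σ) t₀, HasDerivAt q (ρ t - p t) t ∧ 0 ≤ ρ t
  right : ∀ t ∈ Set.Ioo t₀ (t₀ + w), HasDerivAt q (ρ t - p t) t ∧ m ≤ ρ t ∧ ρ t ≤ M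
  m_nonneg : 0 ≤ m
  η_nonneg : 0 ≤ η
  η_le : η ≤ 1
  δ_le : δ ≤ π / 2
  cos_δ : 1 - η ≤ cos δ
  Δ_nonneg : 0 ≤ Δ
  mix : σ ≤ η * (1 - cos Δ)

/-- A one-sided orbit of the dual billiards map, recorded by its tangent directions, with tangent
lengths at most `l`. -/
structure TangentSeq (p q : ℝ → ℝ) (l : ℝ) (X : ℕ → ℝ) : Prop where
  lt : ∀ n, X n < X (n + 1)
  lt_pi : ∀ n, X (n + 1) < X n + π
  rel : ∀ n, lamP p q (X (n + 1)) (X (n + 2)) = lamM p q (X n) (X (n + 1))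
  le : ∀ n, lamP p q (X n) (X (n + 1)) ≤ l

lemma TangentSeq.control {p q : ℝ → ℝ} {l : ℝ} {X : ℕ → ℝ} (hX : TangentSeq p q l X)
    {t₀ w δ : ℝ} (hstep : ∀ x, |x - t₀| ≤ w → ∀ y, x < y → y < x + π → lamP p q x y ≤ l → y < x + δ)
    (h0 : t₀ - δ ≤ X 0) (h0' : X 0 ≤ t₀ + δ) (hδ : 0 ≤ δ) {N : ℕ} (hN : (N + 1) * δ ≤ w) :
    ∀ n ≤ N, X (n + 1) ≤ X n + δ ∧ X n ≤ t₀ + (n + 1) * δ := by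
  have hlow : ∀ n, t₀ - δ ≤ X n := fun n =>
    h0.trans ((strictMono_nat_of_lt_succ hX.lt).monotone (Nat.zero_le n))
  have hup : ∀ n ≤ N, X n ≤ t₀ + (n + 1) * δ → X (n + 1) ≤ X n + δ := fun n hn hle => by
    have hn' : ((n : ℝ) + 1) * δ ≤ (N + 1) * δ :=
      mul_le_mul_of_nonneg_right (by exact_mod_cast (by omega : n + 1 ≤ N + 1)) hδ
    have hn0 : δ ≤ (N + 1) * δ :=
      le_mul_of_one_le_left hδ (by linarith [(Nat.cast_nonneg N : (0 : ℝ) ≤ N)])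
    refine (hstep _ ?_ _ (hX.lt n) (hX.lt_pi n) (hX.le n)).le
    rw [abs_le]
    constructor <;> linarith [hlow n]
  intro n
  induction n with
  | zero => intro hn; exact ⟨hup 0 hn (by simpa using h0'), by simpa using h0'⟩
  | succ n ih =>
    intro hn
    obtain ⟨i1, i2⟩ := ih (by omega)
    have : X (n + 1) ≤ t₀ + ((n + 1 : ℕ) + 1) * δ := by push_cast; linarith
    exact ⟨hup _ hn this, this⟩

namespace SupportData

variable {p q : ℝ → ℝ} (h : SupportData p q)
include h

lemma lam_bounds {ρ : ℝ → ℝ} {t₀ w σ δ Δ m M η : ℝ}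
    (H : CurvatureWindow p q ρ t₀ w σ δ Δ m M η) {a b : ℝ} (ha : t₀ - σ ≤ a) (hb : t₀ ≤ b)
    (hab : a < b) (hbw : b ≤ t₀ + w) (hbδ : b - a ≤ δ) (hΔ : Δ ≤ b - a ∨ t₀ ≤ a) :
    1 - η ≤ cos (b - a) ∧ 0 < sin (b - a) ∧
      m * (1 - η) * (1 - cos (b - a)) ≤ lamP p q a b * sin (b - a) ∧
      m * (1 - η) * (1 - cos (b - a)) ≤ lamM p q a b * sin (b - a) := by
  have hπ := pi_pos
  have hδ := H.δ_le
  have hη := H.η_nonneg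
  have hm := H.m_nonneg
  have hcos := cos_le_one (b - a)
  obtain ⟨τ, haτ, hτb, hτ₀, hmix, hτ⟩ : ∃ τ, a ≤ τ ∧ τ ≤ b ∧ t₀ ≤ τ ∧
      τ - a ≤ η * (1 - cos (b - a)) ∧ (a < τ → τ = t₀) := by
    rcases le_or_gt t₀ a with h1 | h1
    · refine ⟨a, le_rfl, hab.le, h1, ?_, fun h => (lt_irrefl _ h).elim⟩
      rw [sub_self]
      exact mul_nonneg hη (by linarith)
    · refine ⟨t₀, h1.le, hb, le_rfl, ?_, fun _ => rfl⟩
      have hΔ' := hΔ.resolve_right (not_le.2 h1)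
      have : cos (b - a) ≤ cos Δ :=
        cos_le_cos_of_nonneg_of_le_pi H.Δ_nonneg (by linarith) hΔ'
      have := H.mix
      nlinarith
  have hl : ∀ t ∈ Set.Ioo a τ, HasDerivAt q (ρ t - p t) t ∧ 0 ≤ ρ t := fun t ht =>
    H.left t ⟨by linarith [ht.1], by rw [← hτ (ht.1.trans ht.2)]; exact ht.2⟩
  have hr : ∀ t ∈ Set.Ioo τ b, HasDerivAt q (ρ t - p t) t ∧ m ≤ ρ t := fun t ht =>
    have := H.right t ⟨by linarith [ht.1], by linarith [ht.2]⟩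
    ⟨this.1, this.2.1⟩
  have hle : m * (1 - η) * (1 - cos (b - a)) ≤ m * (1 - cos (b - a) - (τ - a)) := by
    nlinarith [mul_le_mul_of_nonneg_left hmix hm]
  refine ⟨H.cos_δ.trans (cos_le_cos_of_nonneg_of_le_pi (by linarith) (by linarith) hbδ),
    sin_pos' hab (by linarith), ?_, ?_⟩
  · exact hle.trans (h.lamP_lower haτ hτb hab (by linarith) hm hl hr)
  · exact hle.trans (h.lamM_lower haτ hτb hab (by linarith) hm hl hr)

lemma three_term_of_window {ρ : ℝ → ℝ} {t₀ w σ δ Δ m M η : ℝ}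
    (H : CurvatureWindow p q ρ t₀ w σ δ Δ m M η) {a₀ b₀ c₀ a₁ b₁ c₁ : ℝ}
    (hab₀ : a₀ < b₀) (hbc₀ : b₀ < c₀) (hab₁ : a₁ < b₁) (hbc₁ : b₁ < c₁)
    (hab₀' : b₀ ≤ a₀ + δ) (hbc₀' : c₀ ≤ b₀ + δ) (hab₁' : b₁ ≤ a₁ + δ) (hbc₁' : c₁ ≤ b₁ + δ)
    (h₀ : lamP p q b₀ c₀ = lamM p q a₀ b₀) (h₁ : lamP p q b₁ c₁ = lamM p q a₁ b₁)
    (ha : a₀ ≤ a₁) (hb : b₀ ≤ b₁) (hc : c₀ ≤ c₁)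
    (ha₀ : t₀ - σ ≤ a₀) (hb₀ : t₀ < b₀) (hc₁ : c₁ ≤ t₀ + w)
    (hΔ : Δ ≤ b₀ - a₀ ∧ Δ ≤ b₁ - a₁ ∨ t₀ ≤ a₀) :
    m * (1 - η) * (a₁ - a₀) + m * (1 - η) * (c₁ - c₀) ≤
      (4 * M - (1 - η) * (m * (1 - η) + m * (1 - η))) * (b₁ - b₀) := by
  have hπ := pi_pos
  have hδ := H.δ_le
  have hm : 0 ≤ m * (1 - η) := mul_nonneg H.m_nonneg (by linarith [H.η_le])
  refine h.three_term_le hab₀ hbc₀ hab₁ hbc₁ (by linarith) (by linarith) (by linarith)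
    (by linarith) h₀ h₁ ha hb hc hm hm H.η_le (ρ := ρ) (fun s hs => ?_) ?_ ?_
  · have h1 : b₀ ≤ b₀ + s * (b₁ - b₀) := le_lerp hs le_rfl hb
    have h2 : b₀ + s * (b₁ - b₀) ≤ b₁ := lerp_le hs hb le_rfl
    have := H.right (b₀ + s * (b₁ - b₀)) ⟨by linarith, by linarith⟩
    exact ⟨this.2.2, this.1⟩
  · rintro s hs a b rfl rfl
    have h1 : b₀ ≤ b₀ + s * (b₁ - b₀) := le_lerp hs le_rfl hb
    have h2 : b₀ + s * (b₁ - b₀) ≤ b₁ := lerp_le hs hb le_rfl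
    have h3 : a₀ ≤ a₀ + s * (a₁ - a₀) := le_lerp hs le_rfl ha
    have e : b₀ + s * (b₁ - b₀) - (a₀ + s * (a₁ - a₀)) =
      (b₀ - a₀) + s * ((b₁ - a₁) - (b₀ - a₀)) := by ring
    refine h.lam_bounds H (by linarith) (by linarith) ?_ (by linarith) ?_ ?_
    · rw [← sub_pos, e]
      exact (lt_min (sub_pos.2 hab₀) (sub_pos.2 hab₁)).trans_le
        (le_lerp hs (min_le_left _ _) (min_le_right _ _))
    · rw [e]; exact lerp_le hs (by linarith) (by linarith)
    · rcases hΔ with hΔ | hΔ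
      · left; rw [e]; exact le_lerp hs hΔ.1 hΔ.2
      · right; linarith
  · rintro s hs b c rfl rfl
    have h1 : b₀ ≤ b₀ + s * (b₁ - b₀) := le_lerp hs le_rfl hb
    have h2 : c₀ + s * (c₁ - c₀) ≤ c₁ := lerp_le hs hc le_rfl
    have e : c₀ + s * (c₁ - c₀) - (b₀ + s * (b₁ - b₀)) =
      (c₀ - b₀) + s * ((c₁ - b₁) - (c₀ - b₀)) := by ring
    have h4 : b₀ + s * (b₁ - b₀) < c₀ + s * (c₁ - c₀) := by
      rw [← sub_pos, e]
      exact (lt_min (sub_pos.2 hbc₀) (sub_pos.2 hbc₁)).trans_le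
        (le_lerp hs (min_le_left _ _) (min_le_right _ _))
    refine h.lam_bounds H ?_ (by linarith) h4 (by linarith) ?_
      (Or.inr (by linarith))
    · rcases le_or_gt 0 σ with hσ | hσ <;> linarith
    · rw [e]; exact lerp_le hs (by linarith) (by linarith)

/-- Ordered orbits cannot approach each other to the right of `t₀`. -/
lemma not_contracting {ρ : ℝ → ℝ} {t₀ w σ δ Δ m M η l κ ν : ℝ} {N : ℕ}
    (H : CurvatureWindow p q ρ t₀ w σ δ Δ m M η) {X Y : ℕ → ℝ}
    (hX : TangentSeq p q l X) (hY : TangentSeq p q l Y) (hXY : ∀ n, X n ≤ Y n)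
    (hstep : ∀ x, |x - t₀| ≤ w → ∀ y, x < y → y < x + π → lamP p q x y ≤ l → y < x + δ)
    (hX0 : t₀ - σ ≤ X 0) (hσδ : σ ≤ δ) (hY0 : Y 0 ≤ t₀ + δ) (hX1 : t₀ < X 1)
    (hNw : (N + 3) * δ ≤ w) (hm : 0 < m * (1 - η))
    (hM : 4 * M - (1 - η) * (m * (1 - η) + m * (1 - η)) ≤ (2 + ν) * (m * (1 - η)))
    (hΔX : Δ ≤ X 1 - X 0) (hΔY : Δ ≤ Y 1 - Y 0) (h0 : X 0 < Y 0)
    (h1 : Y 1 - X 1 ≤ (1 - κ) * (Y 0 - X 0)) (hν : 0 ≤ ν) (hνN : ν * N ≤ κ / 2)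
    (hN : 2 < N * κ) : False := by
  have hδ0 : 0 ≤ δ := by linarith
  have hNw' : (((N + 2 : ℕ) : ℝ) + 1) * δ ≤ w := by push_cast; linarith
  have cX := hX.control hstep (by linarith) (by linarith) hδ0 hNw'
  have cY := hY.control hstep (by linarith) hY0 hδ0 hNw'
  have hXm := (strictMono_nat_of_lt_succ hX.lt).monotone
  refine not_nearly_convex (ξ := fun n => Y n - X n) (by linarith)
    (fun n => sub_nonneg.2 (hXY n)) h1 (fun n hn => ?_) hν hνN hN
  have hYw : Y (n + 2) ≤ t₀ + w := by
    refine (cY (n + 2) (by omega)).2.trans ?_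
    have : (((n + 2 : ℕ) : ℝ) + 1) * δ ≤ (((N + 2 : ℕ) : ℝ) + 1) * δ :=
      mul_le_mul_of_nonneg_right (by exact_mod_cast (by omega : n + 2 + 1 ≤ N + 2 + 1)) hδ0
    linarith
  have key := h.three_term_of_window H (hX.lt n) (hX.lt (n + 1)) (hY.lt n) (hY.lt (n + 1))
    (cX n (by omega)).1 (cX (n + 1) (by omega)).1 (cY n (by omega)).1 (cY (n + 1) (by omega)).1
    (hX.rel n) (hY.rel n) (hXY n) (hXY (n + 1)) (hXY (n + 2)) (hX0.trans (hXm (Nat.zero_le n)))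
    (hX1.trans_le (hXm (by omega))) hYw (by
      rcases Nat.eq_zero_or_pos n with rfl | hn
      · exact Or.inl ⟨hΔX, hΔY⟩
      · exact Or.inr (hX1.le.trans (hXm hn)))
  have h2 := mul_le_mul_of_nonneg_right hM (sub_nonneg.2 (hXY (n + 1)))
  have h3 := key.trans h2
  have h4 : m * (1 - η) * (Y n - X n + (Y (n + 2) - X (n + 2))) ≤
      m * (1 - η) * ((2 + ν) * (Y (n + 1) - X (n + 1))) := by linarith
  exact le_of_mul_le_mul_left h4 hm

end SupportData

/-- A two-sided orbit of the dual billiards map, recorded by its tangent directions, with tangent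
lengths between `l₀` and `l`. -/
structure TangentOrbit (p q : ℝ → ℝ) (l₀ l : ℝ) (X : ℤ → ℝ) : Prop where
  lt : ∀ n, X n < X (n + 1)
  lt_pi : ∀ n, X (n + 1) < X n + π
  rel : ∀ n, lamP p q (X (n + 1)) (X (n + 2)) = lamM p q (X n) (X (n + 1))
  ge : ∀ n, l₀ ≤ lamP p q (X n) (X (n + 1))
  le : ∀ n, lamP p q (X n) (X (n + 1)) ≤ l

lemma TangentOrbit.tangentSeq {p q : ℝ → ℝ} {l₀ l : ℝ} {X : ℤ → ℝ} (hX : TangentOrbit p q l₀ l X) :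
    TangentSeq p q l (fun n : ℕ => X n) where
  lt n := by exact_mod_cast hX.lt n
  lt_pi n := by exact_mod_cast hX.lt_pi n
  rel n := by exact_mod_cast hX.rel n
  le n := by exact_mod_cast hX.le n

lemma TangentOrbit.reflect {p q : ℝ → ℝ} {l₀ l : ℝ} {X : ℤ → ℝ} (hX : TangentOrbit p q l₀ l X) :
    TangentOrbit (fun x => p (-x)) (fun x => -q (-x)) l₀ l (fun n => -X (-n)) := by
  have e : ∀ n : ℤ, lamP (fun x => p (-x)) (fun x => -q (-x)) (-X (-n)) (-X (-(n + 1))) =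
      lamP p q (X (-n)) (X (-n + 1)) := fun n => by
    rw [lamP_reflect]
    have := hX.rel (-(n + 1))
    rw [show -(n + 1) + 1 = -n by ring, show -(n + 1) + 2 = -n + 1 by ring] at this
    exact this.symm
  refine ⟨fun n => ?_, fun n => ?_, fun n => ?_, fun n => ?_, fun n => ?_⟩
  · have := hX.lt (-(n + 1))
    rw [show -(n + 1) + 1 = -n by ring] at this
    linarith
  · have := hX.lt_pi (-(n + 1))
    rw [show -(n + 1) + 1 = -n by ring] at this
    linarith
  · have := e (n + 1)
    rw [show n + 1 + 1 = n + 2 by ring] at this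
    rw [this, lamM_reflect]
    congr 2
    ring
  · rw [e]; exact hX.ge _
  · rw [e]; exact hX.le _

lemma exists_parameters {r R : ℝ} (hr : 0 ≤ r) (hrR : r < R) :
    ∃ (κ ν ω : ℝ) (N : ℕ), 0 < ω ∧ ω < 1 ∧ ω < R ∧ 0 ≤ ν ∧ ν * N ≤ κ / 2 ∧ 2 < N * κ ∧ κ ≤ 1 ∧
      4 * (r + ω) - (1 - ω) * (max (r - ω) 0 * (1 - ω) + (R - ω) * (1 - ω)) ≤
        (1 - κ) * (max (r - ω) 0 * (1 - ω) + (R - ω) * (1 - ω)) ∧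
      4 * (R + ω) - (1 - ω) * ((R - ω) * (1 - ω) + (R - ω) * (1 - ω)) ≤
        (2 + ν) * ((R - ω) * (1 - ω)) ∧
      (0 < r → 0 < max (r - ω) 0 ∧
        4 * (r + ω) - (1 - ω) * (max (r - ω) 0 * (1 - ω) + max (r - ω) 0 * (1 - ω)) ≤
        (2 + ν) * (max (r - ω) 0 * (1 - ω))) := by
  have hR : 0 < R := hr.trans_lt hrR
  set κ := (R - r) / (R + r) with hκ
  have hκe : κ * (R + r) = R - r := div_mul_cancel₀ _ (by linarith)
  have hκ0 : 0 < κ := div_pos (by linarith) (by linarith)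
  have hκ1 : κ ≤ 1 := (div_le_one (by linarith)).2 (by linarith)
  obtain ⟨N, hN⟩ := exists_nat_gt (2 / κ)
  have hN0 : (0 : ℝ) < N := lt_trans (by positivity) hN
  have hNκ : 2 < N * κ := (div_lt_iff₀ hκ0).1 hN
  set ν := κ / (2 * N) with hν
  have hν0 : 0 < ν := by positivity
  have hνN : ν * N = κ / 2 := by rw [hν]; field_simp
  have hmax : max r 0 = r := max_eq_left hr
  have c1 : ContinuousAt (fun ω : ℝ => 4 * (r + ω) -
      (1 - ω) * (max (r - ω) 0 * (1 - ω) + (R - ω) * (1 - ω)) -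
        (1 - κ) * (max (r - ω) 0 * (1 - ω) + (R - ω) * (1 - ω))) 0 := by fun_prop
  have c2 : ContinuousAt (fun ω : ℝ => 4 * (R + ω) -
      (1 - ω) * ((R - ω) * (1 - ω) + (R - ω) * (1 - ω)) - (2 + ν) * ((R - ω) * (1 - ω))) 0 := by
    fun_prop
  have c3 : ContinuousAt (fun ω : ℝ => 4 * (r + ω) -
      (1 - ω) * (max (r - ω) 0 * (1 - ω) + max (r - ω) 0 * (1 - ω)) -
        (2 + ν) * (max (r - ω) 0 * (1 - ω))) 0 := by fun_prop
  have e1 := c1.eventually_lt_const (u := 0) (by simp only [sub_zero, hmax]; nlinarith)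
  have e2 := c2.eventually_lt_const (u := 0) (by simp only [sub_zero]; nlinarith)
  have e3 : ∀ᶠ ω : ℝ in 𝓝 0, 0 < r → 0 < max (r - ω) 0 ∧ 4 * (r + ω) -
      (1 - ω) * (max (r - ω) 0 * (1 - ω) + max (r - ω) 0 * (1 - ω)) -
        (2 + ν) * (max (r - ω) 0 * (1 - ω)) < 0 := by
    rcases hr.eq_or_lt with h0 | h0
    · exact Eventually.of_forall fun _ h => absurd h0 h.ne
    · have e4 := c3.eventually_lt_const (u := 0) (by simp only [sub_zero, hmax]; nlinarith)
      filter_upwards [e4, eventually_lt_nhds h0] with ω h1 h2 _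
      exact ⟨lt_max_of_lt_left (by linarith), h1⟩
  have hev : ∀ᶠ ω : ℝ in 𝓝[>] 0, _ := (e1.and (e2.and (e3.and ((eventually_lt_nhds one_pos).and
    (eventually_lt_nhds hR))))).filter_mono nhdsWithin_le_nhds
  obtain ⟨ω, ⟨h1, h2, h3, h4, h5⟩, h6⟩ := (hev.and self_mem_nhdsWithin).exists
  exact ⟨κ, ν, ω, N, h6, h4, h5, hν0.le, hνN.le, hNκ, hκ1, by linarith, by linarith,
    fun h => ⟨(h3 h).1, by linarith [(h3 h).2]⟩⟩

namespace SupportData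

variable {p q : ℝ → ℝ} (h : SupportData p q)
include h

/-- The three term inequality at the jump of the curvature radius. -/
lemma three_term_at_jump {ρ : ℝ → ℝ} {t₀ w σ δ Δ m₀ M₀ m₁ M₁ η : ℝ}
    (HR : CurvatureWindow p q ρ t₀ w σ δ Δ m₁ M₁ η)
    (HL : CurvatureWindow (fun x => p (-x)) (fun x => -q (-x)) (fun x => ρ (-x)) (-t₀) w 0 δ 0
      m₀ M₀ η) {a₀ c₀ a₁ c₁ : ℝ} (hσ : 0 < σ) (hσw : σ ≤ w)
    (hab₀ : a₀ < t₀ - σ) (hab₁ : a₁ < t₀) (hbc₁ : t₀ < c₁)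
    (hab₀' : t₀ - σ ≤ a₀ + δ) (hbc₀' : c₀ ≤ t₀ - σ + δ) (hab₁' : t₀ ≤ a₁ + δ)
    (hbc₁' : c₁ ≤ t₀ + δ)
    (h₀ : lamP p q (t₀ - σ) c₀ = lamM p q a₀ (t₀ - σ)) (h₁ : lamP p q t₀ c₁ = lamM p q a₁ t₀)
    (ha : a₀ ≤ a₁) (hc : c₀ ≤ c₁) (hc₀ : t₀ < c₀)
    (ha₀ : t₀ - w ≤ a₀) (hc₁ : c₁ ≤ t₀ + w) (hΔ₀ : Δ ≤ c₀ - (t₀ - σ)) (hΔ₁ : Δ ≤ c₁ - t₀) :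
    m₀ * (1 - η) * (a₁ - a₀) + m₁ * (1 - η) * (c₁ - c₀) ≤
      (4 * M₀ - (1 - η) * (m₀ * (1 - η) + m₁ * (1 - η))) * σ := by
  have hπ := pi_pos
  have hδ := HR.δ_le
  have hη : 0 ≤ 1 - η := by linarith [HR.η_le]
  have hbs : ∀ s ∈ Set.Ioo (0 : ℝ) 1, t₀ - σ + s * (t₀ - (t₀ - σ)) ∈ Set.Ioo (t₀ - σ) t₀ :=
    fun s hs => by
      rw [sub_sub_cancel]
      constructor <;> nlinarith [hs.1, hs.2]
  have := h.three_term_le hab₀ (by linarith) hab₁ hbc₁ (by linarith) (by linarith) (by linarith)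
    (by linarith) h₀ h₁ ha (by linarith) hc (ρ := ρ) (M := M₀) (mul_nonneg HL.m_nonneg hη)
    (mul_nonneg HR.m_nonneg hη) HR.η_le (fun s hs => ?_) ?_ ?_
  · simpa only [sub_sub_cancel] using this
  · have hb := hbs s hs
    have h2 := (HL.right (-(t₀ - σ + s * (t₀ - (t₀ - σ))))
      ⟨by linarith [hb.2], by linarith [hb.1]⟩).2.2
    rw [neg_neg] at h2
    exact ⟨h2, (HR.left _ hb).1⟩
  · rintro s hs a b rfl rfl
    have hb := hbs s hs
    have h3 : a₀ ≤ a₀ + s * (a₁ - a₀) := le_lerp hs le_rfl ha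
    have e : t₀ - σ + s * (t₀ - (t₀ - σ)) - (a₀ + s * (a₁ - a₀)) =
      (t₀ - σ - a₀) + s * ((t₀ - a₁) - (t₀ - σ - a₀)) := by ring
    have h4 : a₀ + s * (a₁ - a₀) < t₀ - σ + s * (t₀ - (t₀ - σ)) := by
      rw [← sub_pos, e]
      exact (lt_min (sub_pos.2 hab₀) (sub_pos.2 hab₁)).trans_le
        (le_lerp hs (min_le_left _ _) (min_le_right _ _))
    have h5 : t₀ - σ + s * (t₀ - (t₀ - σ)) - (a₀ + s * (a₁ - a₀)) ≤ δ := by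
      rw [e]; exact lerp_le hs (by linarith) (by linarith)
    have := h.reflect.lam_bounds HL (a := -(t₀ - σ + s * (t₀ - (t₀ - σ))))
      (b := -(a₀ + s * (a₁ - a₀))) (by linarith [hb.2]) (by linarith [hb.2]) (by linarith)
      (by linarith) (by linarith) (Or.inr (by linarith [hb.2]))
    rw [lamP_reflect, lamM_reflect, neg_sub_neg] at this
    exact ⟨this.1, this.2.1, this.2.2.2, this.2.2.1⟩
  · rintro s hs b c rfl rfl
    have hb := hbs s hs
    have h2 : c₀ ≤ c₀ + s * (c₁ - c₀) := le_lerp hs le_rfl hc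
    have h2' : c₀ + s * (c₁ - c₀) ≤ c₁ := lerp_le hs hc le_rfl
    have e : c₀ + s * (c₁ - c₀) - (t₀ - σ + s * (t₀ - (t₀ - σ))) =
      (c₀ - (t₀ - σ)) + s * ((c₁ - t₀) - (c₀ - (t₀ - σ))) := by ring
    refine h.lam_bounds HR hb.1.le (by linarith) (by linarith [hb.2]) (by linarith) ?_ (Or.inl ?_)
    · rw [e]; exact lerp_le hs (by linarith) (by linarith)
    · rw [e]; exact le_lerp hs hΔ₀ hΔ₁

set_option maxHeartbeats 1000000 in
/-- Near an upward jump of the curvature radius there are no two ordered orbits which are close to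
the boundary and pass through suitably chosen directions. -/
lemma no_ordered_orbits_of_lt {ρ : ℝ → ℝ} {t₀ r₀ r R : ℝ} (hr₀ : 0 < r₀)
    (hloc : ∀ t, t ≠ t₀ → |t - t₀| < r₀ → HasDerivAt q (ρ t - p t) t ∧ 0 < ρ t)
    (hminus : Tendsto ρ (𝓝[<] t₀) (𝓝 r)) (hplus : Tendsto ρ (𝓝[>] t₀) (𝓝 R)) (hrR : r < R) :
    ∃ l, 0 < l ∧ ∀ l₀, 0 < l₀ → ∃ θ₀ θ₁, θ₀ < θ₁ ∧ ∀ X Y : ℤ → ℝ, TangentOrbit p q l₀ l X →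
      TangentOrbit p q l₀ l Y → X 0 = θ₀ → Y 0 = θ₁ → (∀ n, X n ≤ Y n) → False := by
  have hπ := pi_pos
  have hr : 0 ≤ r := by
    refine ge_of_tendsto hminus ?_
    filter_upwards [Ioo_mem_nhdsLT (show t₀ - r₀ < t₀ by linarith)] with t ht
    exact (hloc t ht.2.ne (by rw [abs_lt]; constructor <;> linarith [ht.1, ht.2])).2.le
  obtain ⟨κ, ν, ω, N, hω, hω1, hωR, hν, hνN, hNκ, hκ1, hp0, hpR, hpr⟩ := exists_parameters hr hrR
  obtain ⟨w, hw, hwr, hwL, hwR⟩ : ∃ w, 0 < w ∧ w < r₀ ∧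
      (∀ t ∈ Set.Ioo (t₀ - w) t₀, |ρ t - r| < ω) ∧ ∀ t ∈ Set.Ioo t₀ (t₀ + w), |ρ t - R| < ω := by
    have h1 : ∀ᶠ t in 𝓝[<] t₀, |ρ t - r| < ω := by
      simpa [Real.dist_eq] using hminus.eventually (Metric.ball_mem_nhds r hω)
    have h2 : ∀ᶠ t in 𝓝[>] t₀, |ρ t - R| < ω := by
      simpa [Real.dist_eq] using hplus.eventually (Metric.ball_mem_nhds R hω)
    obtain ⟨u, hu, hu'⟩ := (mem_nhdsLT_iff_exists_Ioo_subset' (sub_one_lt t₀)).1 h1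
    obtain ⟨v, hv, hv'⟩ := (mem_nhdsGT_iff_exists_Ioo_subset' (lt_add_one t₀)).1 h2
    rw [Set.mem_Iio] at hu
    rw [Set.mem_Ioi] at hv
    refine ⟨min (r₀ / 2) (min (t₀ - u) (v - t₀)), ?_, ?_, fun t ht => hu' ⟨?_, ht.2⟩,
      fun t ht => hv' ⟨ht.1, ?_⟩⟩
    · exact lt_min (by linarith) (lt_min (by linarith) (by linarith))
    · exact (min_le_left _ _).trans_lt (by linarith)
    · have := (min_le_right (r₀ / 2) (min (t₀ - u) (v - t₀))).trans (min_le_left _ _)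
      linarith [ht.1]
    · have := (min_le_right (r₀ / 2) (min (t₀ - u) (v - t₀))).trans (min_le_right _ _)
      linarith [ht.2]
  obtain ⟨δ, hδ, hδπ, hδw, hδcos, hδr⟩ : ∃ δ, 0 < δ ∧ δ ≤ π / 2 ∧ (N + 3) * δ ≤ w ∧
      1 - ω ≤ cos δ ∧ w + δ < r₀ := by
    have h1 : ∀ᶠ δ in 𝓝 (0 : ℝ), 1 - ω < cos δ :=
      continuous_cos.continuousAt.eventually_const_lt (by rw [cos_zero]; linarith)
    have h2 : ∀ᶠ δ in 𝓝 (0 : ℝ), (N + 3) * δ < w :=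
      (by fun_prop : ContinuousAt (fun δ : ℝ => ((N : ℝ) + 3) * δ) 0).eventually_lt_const
        (by simpa using hw)
    have hev : ∀ᶠ δ in 𝓝[>] (0 : ℝ), _ := (h1.and (h2.and ((eventually_lt_nhds
      (show (0 : ℝ) < π / 2 by linarith)).and (eventually_lt_nhds
      (show 0 < r₀ - w by linarith))))).filter_mono nhdsWithin_le_nhds
    obtain ⟨δ, ⟨a1, a2, a3, a4⟩, a5⟩ := (hev.and self_mem_nhdsWithin).exists
    exact ⟨δ, a5, a3.le, a2.le, a1.le, by linarith⟩
  have hlocr : ∀ t, t ≠ -t₀ → |t - -t₀| < r₀ →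
      HasDerivAt (fun x => -q (-x)) (ρ (-t) - p (-t)) t ∧ 0 < ρ (-t) := fun t ht ht' => by
    have := hloc (-t) (fun e => ht (by linarith)) (by
      rwa [show -t - t₀ = -(t - -t₀) by ring, abs_neg])
    exact ⟨hasDerivAt_neg_comp_neg this.1, this.2⟩
  obtain ⟨lR, hlR, hstepR⟩ := h.exists_step_bound hδ (by linarith) hloc hδr
  obtain ⟨lL, hlL, hstepL⟩ := h.reflect.exists_step_bound (ρ := fun x => ρ (-x)) hδ (by linarith)
    hlocr hδr
  refine ⟨min lR lL, lt_min hlR hlL, fun l₀ hl₀ => ?_⟩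
  replace hstepR : ∀ x, |x - t₀| ≤ w → ∀ y, x < y → y < x + π → lamP p q x y ≤ min lR lL →
    y < x + δ := fun x hx y h1 h2 h3 => hstepR x hx y h1 h2 (h3.trans (min_le_left _ _))
  replace hstepL : ∀ x, |x - -t₀| ≤ w → ∀ y, x < y → y < x + π →
    lamP (fun x => p (-x)) (fun x => -q (-x)) x y ≤ min lR lL → y < x + δ :=
    fun x hx y h1 h2 h3 => hstepL x hx y h1 h2 (h3.trans (min_le_right _ _))
  have hN0 : (0 : ℝ) ≤ N := Nat.cast_nonneg N
  have hδw' : 3 * δ ≤ w := by nlinarith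
  have hRω : 0 < R + ω := by linarith
  set Δ := min (l₀ / (R + ω)) 1 with hΔ
  have hΔ0 : 0 < Δ := lt_min (by positivity) one_pos
  have hcosΔ : 0 < 1 - cos Δ := by
    have : cos Δ < cos 0 := cos_lt_cos_of_nonneg_of_le_pi le_rfl
      ((min_le_right _ _).trans (by linarith [pi_gt_three])) hΔ0
    rw [cos_zero] at this
    linarith
  obtain ⟨σ, hσ, hσm⟩ := exists_between (lt_min hδ (lt_min hΔ0 (mul_pos hω hcosΔ)))
  obtain ⟨hσδ, hσ'⟩ := lt_min_iff.1 hσm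
  obtain ⟨hσΔ, hσmix⟩ := lt_min_iff.1 hσ'
  have hR' : ∀ t ∈ Set.Ioo t₀ (t₀ + w),
      HasDerivAt q (ρ t - p t) t ∧ R - ω ≤ ρ t ∧ ρ t ≤ R + ω := fun t ht =>
    ⟨(hloc t ht.1.ne' (by rw [abs_lt]; constructor <;> linarith [ht.1, ht.2])).1,
      by linarith [(abs_lt.1 (hwR t ht)).1], by linarith [(abs_lt.1 (hwR t ht)).2]⟩
  have hL' : ∀ t ∈ Set.Ioo (t₀ - w) t₀,
      HasDerivAt q (ρ t - p t) t ∧ max (r - ω) 0 ≤ ρ t ∧ ρ t ≤ r + ω := fun t ht =>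
    have := hloc t ht.2.ne (by rw [abs_lt]; constructor <;> linarith [ht.1, ht.2])
    ⟨this.1, max_le (by linarith [(abs_lt.1 (hwL t ht)).1]) this.2.le,
      by linarith [(abs_lt.1 (hwL t ht)).2]⟩
  have HR : CurvatureWindow p q ρ t₀ w σ δ Δ (R - ω) (R + ω) ω :=
    { left := fun t ht => ⟨(hL' t ⟨by linarith [ht.1], ht.2⟩).1,
        (le_max_right _ _).trans (hL' t ⟨by linarith [ht.1], ht.2⟩).2.1⟩
      right := hR'
      m_nonneg := by linarith
      η_nonneg := hω.le
      η_le := hω1.le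
      δ_le := hδπ
      cos_δ := hδcos
      Δ_nonneg := hΔ0.le
      mix := hσmix.le }
  have HL : CurvatureWindow (fun x => p (-x)) (fun x => -q (-x)) (fun x => ρ (-x)) (-t₀) w 0 δ 0
      (max (r - ω) 0) (r + ω) ω :=
    { left := fun t ht => absurd ht.1 (by linarith [ht.2])
      right := fun t ht => by
        have := hL' (-t) ⟨by linarith [ht.2], by linarith [ht.1]⟩
        exact ⟨hasDerivAt_neg_comp_neg this.1, this.2⟩
      m_nonneg := le_max_right _ _
      η_nonneg := hω.le
      η_le := hω1.le
      δ_le := hδπ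
      cos_δ := hδcos
      Δ_nonneg := le_rfl
      mix := by simp }
  refine ⟨t₀ - σ, t₀, by linarith, fun X Y hX hY hX0 hY0 hXY => ?_⟩
  have hδN : (((N + 2 : ℕ) : ℝ) + 1) * δ ≤ w := by push_cast; linarith
  have sX := hX.tangentSeq
  have sY := hY.tangentSeq
  have sXr := hX.reflect.tangentSeq
  have sYr := hY.reflect.tangentSeq
  have cX := sX.control hstepR (by simp [hX0]; linarith) (by simp [hX0]; linarith) hδ.le hδN 0
    (by omega)
  have cY := sY.control hstepR (by simp [hY0]; linarith) (by simp [hY0]; linarith) hδ.le hδN 0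
    (by omega)
  have cXr := sXr.control hstepL (by simp [hX0]; linarith) (by simp [hX0]; linarith) hδ.le hδN 0
    (by omega)
  have cYr := sYr.control hstepL (by simp [hY0]; linarith) (by simp [hY0]; linarith) hδ.le hδN 0
    (by omega)
  have hΔle : ∀ b c, t₀ - σ ≤ b → b ≤ t₀ → b < c → c ≤ b + δ → l₀ ≤ lamP p q b c → Δ ≤ c - b := by
    intro b c hb hb' hbc hcδ hl
    obtain ⟨τ, hbτ, hτc, h1, h2⟩ : ∃ τ, b ≤ τ ∧ τ ≤ c ∧ τ ≤ t₀ ∧ (τ < c → t₀ ≤ τ) :=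
      ⟨min t₀ c, le_min hb' hbc.le, min_le_right _ _, min_le_left _ _, fun h => by
        rcases min_lt_iff.1 h with h | h
        · rw [min_eq_left h.le]
        · exact (lt_irrefl _ h).elim⟩
    have := h.lamP_upper (m := R + ω) (ρ := ρ) hbτ hτc hbc (by linarith) hRω.le
      (fun t ht => by
        have := hL' t ⟨by linarith [ht.1], by linarith [ht.2]⟩
        exact ⟨this.1, by linarith [this.2.2]⟩)
      (fun t ht => by
        have := hR' t ⟨by linarith [ht.1, h2 (ht.1.trans ht.2)], by linarith [ht.2]⟩
        exact ⟨this.1, this.2.2⟩)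
    refine (min_le_left _ _).trans ((div_le_iff₀ hRω).2 ?_)
    linarith
  have x1 : X 1 ≤ X 0 + δ := by simpa using cX.1
  have y1 : Y 1 ≤ Y 0 + δ := by simpa using cY.1
  have x2 : X 0 ≤ X (-1) + δ := by have := cXr.1; simp at this; linarith
  have y2 : Y 0 ≤ Y (-1) + δ := by have := cYr.1; simp at this; linarith
  have x3 : X 0 < X 1 := by simpa using hX.lt 0
  have y3 : Y 0 < Y 1 := by simpa using hY.lt 0
  have x4 : X (-1) < X 0 := by simpa using hX.lt (-1)
  have y4 : Y (-1) < Y 0 := by simpa using hY.lt (-1)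
  have rX : lamP p q (X 0) (X 1) = lamM p q (X (-1)) (X 0) := by simpa using hX.rel (-1)
  have rY : lamP p q (Y 0) (Y 1) = lamM p q (Y (-1)) (Y 0) := by simpa using hY.rel (-1)
  have gX : l₀ ≤ lamP p q (X 0) (X 1) := by simpa using hX.ge 0
  have gY : l₀ ≤ lamP p q (Y 0) (Y 1) := by simpa using hY.ge 0
  have dX : Δ ≤ X 1 - X 0 := hΔle _ _ hX0.ge (by linarith) x3 x1 gX
  have dY : Δ ≤ Y 1 - Y 0 := hΔle _ _ (by linarith) hY0.le y3 y1 gY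
  have key := h.three_term_at_jump HR HL (a₀ := X (-1)) (c₀ := X 1) (a₁ := Y (-1)) (c₁ := Y 1)
    hσ (by linarith) (by linarith) (by linarith) (by linarith) (by linarith) (by linarith)
    (by linarith) (by linarith) (by rw [← hX0]; exact rX) (by rw [← hY0]; exact rY) (hXY _) (hXY _)
    (by linarith) (by linarith) (by linarith) (by linarith) (by linarith)
  have hm₁ : 0 < (R - ω) * (1 - ω) := mul_pos (by linarith) (by linarith)
  by_cases hcase : Y 1 - X 1 ≤ (1 - κ) * σ
  · exact h.not_contracting HR sX sY (fun n => hXY n) hstepR (N := N) (ν := ν) (κ := κ) hX0.ge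
      hσδ.le (by simp [hY0]; linarith) (by simp; linarith) hδw hm₁ hpR (by simpa using dX)
      (by simpa using dY) (by simp; linarith) (by simp [hX0, hY0]; simpa using hcase) hν hνN hNκ
  · push Not at hcase
    have key' := key.trans (mul_le_mul_of_nonneg_right hp0 hσ.le)
    have hmax : 0 ≤ max (r - ω) 0 * (1 - ω) :=
      mul_nonneg (le_max_right _ _) (by linarith)
    have hlt : max (r - ω) 0 * (1 - ω) * (Y (-1) - X (-1)) <
        max (r - ω) 0 * (1 - ω) * ((1 - κ) * σ) := by
      have := mul_lt_mul_of_pos_left hcase hm₁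
      linarith
    have hcase' : Y (-1) - X (-1) < (1 - κ) * σ := lt_of_mul_lt_mul_left hlt hmax
    have hr' : 0 < r := hr.lt_of_ne fun e => by
      rw [← e, max_eq_right (by linarith)] at hlt
      simp at hlt
    obtain ⟨hm₀, hM₀⟩ := hpr hr'
    exact h.reflect.not_contracting HL sYr sXr (fun n => neg_le_neg (hXY _)) hstepL (N := N)
      (ν := ν) (κ := κ) (by simp [hY0]) hδ.le (by simp [hX0]; linarith) (by simp; linarith) hδw
      (mul_pos hm₀ (by linarith)) hM₀ (by simp; linarith) (by simp; linarith) (by simp; linarith)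
      (by simp [hX0, hY0]; linarith) hν hνN hNκ

/-- Near a jump of the curvature radius there are no two ordered orbits which are close to the
boundary and pass through suitably chosen directions. -/
lemma no_ordered_orbits {ρ : ℝ → ℝ} {t₀ r₀ r R : ℝ} (hr₀ : 0 < r₀)
    (hloc : ∀ t, t ≠ t₀ → |t - t₀| < r₀ → HasDerivAt q (ρ t - p t) t ∧ 0 < ρ t)
    (hminus : Tendsto ρ (𝓝[<] t₀) (𝓝 r)) (hplus : Tendsto ρ (𝓝[>] t₀) (𝓝 R)) (hrR : R ≠ r) :
    ∃ l, 0 < l ∧ ∀ l₀, 0 < l₀ → ∃ θ₀ θ₁, θ₀ < θ₁ ∧ ∀ X Y : ℤ → ℝ, TangentOrbit p q l₀ l X →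
      TangentOrbit p q l₀ l Y → X 0 = θ₀ → Y 0 = θ₁ → (∀ n, X n ≤ Y n) → False := by
  rcases hrR.lt_or_gt with hlt | hlt
  · obtain ⟨l, hl, H⟩ := h.reflect.no_ordered_orbits_of_lt (ρ := fun t => ρ (-t)) (t₀ := -t₀) hr₀
      (fun t ht ht' => by
        have := hloc (-t) (fun e => ht (by linarith)) (by
          rwa [show -t - t₀ = -(t - -t₀) by ring, abs_neg])
        exact ⟨hasDerivAt_neg_comp_neg this.1, this.2⟩)
      (hplus.comp (tendsto_neg_nhdsLT_neg)) (hminus.comp (tendsto_neg_nhdsGT_neg)) hlt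
    refine ⟨l, hl, fun l₀ hl₀ => ?_⟩
    obtain ⟨θ₀, θ₁, hθ, H⟩ := H l₀ hl₀
    refine ⟨-θ₁, -θ₀, by linarith, fun X Y hX hY hX0 hY0 hXY => ?_⟩
    exact H _ _ hY.reflect hX.reflect (by simp [hY0]) (by simp [hX0])
      fun n => neg_le_neg (hXY _)
  · exact h.no_ordered_orbits_of_lt hr₀ hloc hminus hplus hlt

end SupportData

lemma inner_le_suppFn {K : Set (ℝ × ℝ)} (hK : IsCompact K) {z : ℝ × ℝ} (hz : z ∈ K) (θ : ℝ) :
    z.1 * cos θ + z.2 * sin θ ≤ suppFn K θ :=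
  le_csSup (hK.image (by fun_prop)).bddAbove (Set.mem_image_of_mem _ hz)

lemma exists_inner_eq_suppFn {K : Set (ℝ × ℝ)} (hK : IsCompact K) (hne : K.Nonempty) (θ : ℝ) :
    ∃ z ∈ K, z.1 * cos θ + z.2 * sin θ = suppFn K θ :=
  (hK.image (by fun_prop)).sSup_mem (hne.image _)

lemma deriv_eq_of_inner_le {p : ℝ → ℝ} (hp : Differentiable ℝ p) {z : ℝ × ℝ} {θ : ℝ}
    (hle : ∀ φ, z.1 * cos φ + z.2 * sin φ ≤ p φ) (he : z.1 * cos θ + z.2 * sin θ = p θ) :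
    -z.1 * sin θ + z.2 * cos θ = deriv p θ := by
  have hd : HasDerivAt (fun φ => p φ - (z.1 * cos φ + z.2 * sin φ))
      (deriv p θ - (z.1 * (-sin θ) + z.2 * cos θ)) θ :=
    (hp θ).hasDerivAt.sub
      (((hasDerivAt_cos θ).const_mul z.1).add ((hasDerivAt_sin θ).const_mul z.2))
  have hmin : IsLocalMin (fun φ => p φ - (z.1 * cos φ + z.2 * sin φ)) θ :=
    Eventually.of_forall fun φ => by
      have := hle φ
      show p θ - _ ≤ p φ - _
      linarith
  linarith [hmin.hasDerivAt_eq_zero hd]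

lemma framePt_mem {K : Set (ℝ × ℝ)} (hK : IsCompact K) (hne : K.Nonempty)
    (hd : Differentiable ℝ (suppFn K)) (θ : ℝ) :
    framePt (suppFn K) (θ, deriv (suppFn K) θ) ∈ K := by
  obtain ⟨z, hz, e⟩ := exists_inner_eq_suppFn hK hne θ
  rwa [← eq_framePt _ e (deriv_eq_of_inner_le hd (inner_le_suppFn hK hz) e)]

lemma suppFn_add_pos {K : Set (ℝ × ℝ)} (hK : IsCompact K) (hKi : (interior K).Nonempty) (θ : ℝ) :
    0 < suppFn K θ + suppFn K (θ + π) := by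
  obtain ⟨z, hz⟩ := hKi
  have hc : ContinuousAt (fun t : ℝ => (z.1 + t * cos θ, z.2 + t * sin θ)) 0 := by fun_prop
  have hev : ∀ᶠ t in 𝓝[>] (0 : ℝ), (z.1 + t * cos θ, z.2 + t * sin θ) ∈ K :=
    (hc.eventually (by simpa using mem_interior_iff_mem_nhds.1 hz)).filter_mono nhdsWithin_le_nhds
  obtain ⟨t, ht, ht0⟩ := (hev.and self_mem_nhdsWithin).exists
  have h1 := inner_le_suppFn hK ht θ
  have h2 := inner_le_suppFn hK (interior_subset hz) (θ + π)
  rw [cos_add_pi, sin_add_pi] at h2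
  have := sin_sq_add_cos_sq θ
  have ht0 : 0 < t := ht0
  simp only at h1
  have e : (z.1 + t * cos θ) * cos θ + (z.2 + t * sin θ) * sin θ =
      z.1 * cos θ + z.2 * sin θ + t := by linear_combination t * this
  linarith

lemma supportData_suppFn {K : Set (ℝ × ℝ)} (hK : IsCompact K) (hKi : (interior K).Nonempty)
    (hd : Differentiable ℝ (suppFn K)) (hcont : Continuous (deriv (suppFn K))) :
    SupportData (suppFn K) (deriv (suppFn K)) := by
  have hper : Function.Periodic (suppFn K) (2 * π) := fun θ => by
    simp only [suppFn, cos_add_two_pi, sin_add_two_pi]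
  refine ⟨fun θ => (hd θ).hasDerivAt, hcont, hper, fun θ => ?_, fun θ φ => ?_,
    suppFn_add_pos hK hKi⟩
  · rw [← deriv_comp_add_const]
    congr 1
    exact funext hper
  · have := inner_le_suppFn hK (framePt_mem hK (hKi.mono interior_subset) hd θ) φ
    rwa [framePt_inner] at this

namespace SupportData

variable {p q : ℝ → ℝ} (h : SupportData p q)
include h

lemma continuous_tangentPt (ε : ℝ) : Continuous (tangentPt p q ε) := by
  have := h.cont
  have := h.continuous_p
  unfold tangentPt framePt
  fun_prop

lemma tangentPt_notMem {K : Set (ℝ × ℝ)} (hp : ∀ z ∈ K, ∀ θ, z.1 * cos θ + z.2 * sin θ ≤ p θ)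
    {ε : ℝ} (hε : ε ≠ 0) (x : Strip) : tangentPt p q ε x ∉ K := fun hx => by
  have e := h.q_of_contact (φ := x.1.1) (hp _ hx) (by simp [tangentPt, framePt_inner])
  rw [tangentPt, framePt_tangent] at e
  have := mul_ne_zero hε x.2.ne'
  exact this (by linarith)

/-- Points close to `K` have a short tangent. -/
lemma exists_infDist_bound {K : Set (ℝ × ℝ)} (hK : IsClosed K) (hconv : Convex ℝ K)
    (hp : ∀ z ∈ K, ∀ θ, z.1 * cos θ + z.2 * sin θ ≤ p θ) (hmem : ∀ θ, framePt p (θ, q θ) ∈ K)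
    {m : ℝ} (hm : 0 < m) :
    ∃ ε, 0 < ε ∧ ∀ x : Strip, Metric.infDist (tangentPt p q (-1) x) K < ε → x.1.2 ≤ m := by
  have hne : K.Nonempty := ⟨_, hmem 0⟩
  have hcont : Continuous fun θ : ℝ =>
      Metric.infDist (tangentPt p q (-1) (⟨(θ, m), hm⟩ : Strip)) K :=
    (Metric.continuous_infDist_pt K).comp ((h.continuous_tangentPt _).comp (by fun_prop))
  obtain ⟨θ₀, -, hθ₀⟩ := isCompact_Icc.exists_isMinOn (Set.nonempty_Icc.2 two_pi_pos.le)
    hcont.continuousOn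
  refine ⟨_, (hK.notMem_iff_infDist_pos hne).1
    (h.tangentPt_notMem hp (ε := -1) (by norm_num) ⟨(θ₀, m), hm⟩), fun x hx => ?_⟩
  by_contra! hlt
  obtain ⟨j, hj, -⟩ := existsUnique_add_zsmul_mem_Ico two_pi_pos x.1.1 0
  obtain ⟨w, hw, hwx⟩ := (Metric.infDist_lt_iff hne).1 hx
  have hmin := hθ₀ ⟨hj.1, by linarith [hj.2]⟩
  have e : tangentPt p q (-1) (⟨(x.1.1 + j • (2 * π), m), hm⟩ : Strip) =
      tangentPt p q (-1) ⟨(x.1.1, m), hm⟩ := by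
    rw [← h.tangentPt_shift (-1) j ⟨(x.1.1, m), hm⟩]
    simp [Strip.shift, mul_comm]
  simp only [Set.mem_ofPred_eq, e] at hmin
  set s := m / x.1.2 with hs
  have hs0 : 0 < s := div_pos hm x.2
  have hs1 : s ≤ 1 := (div_le_one x.2).2 hlt.le
  have hsx : s * x.1.2 = m := div_mul_cancel₀ _ x.2.ne'
  have hy : (1 - s) • framePt p (x.1.1, q x.1.1) + s • w ∈ K :=
    hconv (hmem _) hw (by linarith) hs0.le (by ring)
  have e2 : tangentPt p q (-1) (⟨(x.1.1, m), hm⟩ : Strip) =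
      (1 - s) • framePt p (x.1.1, q x.1.1) + s • tangentPt p q (-1) x := by
    ext
    · simp only [tangentPt, framePt, Prod.fst_add, Prod.smul_fst, smul_eq_mul, ← hsx]; ring
    · simp only [tangentPt, framePt, Prod.snd_add, Prod.smul_snd, smul_eq_mul, ← hsx]; ring
  have h1 := Metric.infDist_le_dist_of_mem (x := tangentPt p q (-1) (⟨(x.1.1, m), hm⟩ : Strip)) hy
  rw [e2, dist_add_left, dist_smul₀, Real.norm_eq_abs, abs_of_pos hs0, ← e2] at h1
  have h2 : s * dist (tangentPt p q (-1) x) w ≤ dist (tangentPt p q (-1) x) w :=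
    mul_le_of_le_one_left dist_nonneg hs1
  linarith

omit h in
lemma dist_tangentPt_le (x : Strip) :
    dist (tangentPt p q (-1) x) (framePt p (x.1.1, q x.1.1)) ≤ x.1.2 := by
  rw [Prod.dist_eq, Real.dist_eq, Real.dist_eq]
  have e1 : (tangentPt p q (-1) x).1 - (framePt p (x.1.1, q x.1.1)).1 = x.1.2 * sin x.1.1 := by
    simp only [tangentPt, framePt]; ring
  have e2 : (tangentPt p q (-1) x).2 - (framePt p (x.1.1, q x.1.1)).2 = -(x.1.2 * cos x.1.1) := by
    simp only [tangentPt, framePt]; ring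
  rw [e1, e2, abs_neg, abs_mul, abs_mul, abs_of_pos x.2]
  exact max_le (mul_le_of_le_one_right x.2.le (abs_sin_le_one _))
    (mul_le_of_le_one_right x.2.le (abs_cos_le_one _))

/-- The orbit of a point of the strip under the lifted map. -/
noncomputable def orbit (x : Strip) (n : ℤ) : ℝ := (((h.lift.toEquiv : Equiv.Perm Strip) ^ n) x).1.1

lemma orbit_natCast (x : Strip) (n : ℕ) : h.orbit x n = (h.lift^[n] x).1.1 := by
  rw [orbit, zpow_natCast, Equiv.Perm.coe_pow]
  rfl

lemma orbit_neg_natCast (x : Strip) (n : ℕ) : h.orbit x (-n) = (h.lift.symm^[n] x).1.1 := by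
  rw [orbit, zpow_neg, zpow_natCast, ← inv_pow, Equiv.Perm.coe_pow]
  rfl

lemma tangentOrbit {O : Set Strip} (hO : ∀ x, h.lift x ∈ O ↔ x ∈ O) {l₀ l : ℝ}
    (hl : ∀ x ∈ O, x.1.2 ∈ Set.Icc l₀ l) {x : Strip} (hx : x ∈ O) :
    TangentOrbit p q l₀ l (h.orbit x) := by
  set e : Equiv.Perm Strip := h.lift.toEquiv with he
  have hs : ∀ n : ℤ, (e ^ (n + 1)) x = h.lift ((e ^ n) x) := fun n => by
    rw [add_comm, zpow_one_add]; rfl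
  have hmem : ∀ n : ℤ, (e ^ n) x ∈ O := fun n => by
    induction n with
    | zero => simpa using hx
    | succ n ih => rw [hs]; exact (hO _).2 ih
    | pred n ih =>
      rw [← hO, ← hs]
      simpa using ih
  have ho : ∀ n, h.orbit x (n + 1) = h.angle ((e ^ n) x) := fun n => by
    rw [orbit, hs, lift_fst]
  have hlam : ∀ n, lamP p q (h.orbit x n) (h.orbit x (n + 1)) = ((e ^ n) x).1.2 := fun n => by
    rw [ho]; exact h.lamP_angle _
  refine ⟨fun n => ?_, fun n => ?_, fun n => ?_, fun n => ?_, fun n => ?_⟩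
  · rw [ho]; exact h.lt_angle _
  · rw [ho]; exact h.angle_lt _
  · rw [show n + 2 = n + 1 + 1 by ring, hlam, hs, lift_snd, ho]
    rfl
  · rw [hlam]; exact (hl _ (hmem n)).1
  · rw [hlam]; exact (hl _ (hmem n)).2

lemma exists_tangentPt_eq {K : Set (ℝ × ℝ)}
    (hp : ∀ z ∈ K, ∀ θ, z.1 * cos θ + z.2 * sin θ ≤ p θ) {Φ : ℝ × ℝ → ℝ × ℝ}
    (hΦ : ∀ z : ℝ × ℝ, z ∉ K → ∃ θ l : ℝ, ∃ a : ℝ × ℝ, 0 < l ∧ a ∈ K ∧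
      a.1 * cos θ + a.2 * sin θ = p θ ∧ z = a - l • ((-sin θ, cos θ) : ℝ × ℝ) ∧
      Φ z = (2 : ℝ) • a - z) {z : ℝ × ℝ} (hz : z ∉ K) :
    ∃ x, tangentPt p q (-1) x = z ∧ tangentPt p q 1 x = Φ z := by
  obtain ⟨θ, l, a, hl, ha, e, hze, hΦz⟩ := hΦ z hz
  have ea : a = framePt p (θ, q θ) := eq_framePt p e (h.q_of_contact (hp a ha) e).symm
  refine ⟨⟨(θ, l), hl⟩, ?_, ?_⟩
  · rw [hze, ea]
    ext <;> simp [tangentPt, framePt] <;> ring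
  · rw [hΦz, hze, ea]
    ext <;> simp [tangentPt, framePt] <;> ring

lemma apply_tangentPt {K : Set (ℝ × ℝ)}
    (hp : ∀ z ∈ K, ∀ θ, z.1 * cos θ + z.2 * sin θ ≤ p θ) {Φ : ℝ × ℝ → ℝ × ℝ}
    (hΦ : ∀ z ∉ K, ∃ x, tangentPt p q (-1) x = z ∧ tangentPt p q 1 x = Φ z) (x : Strip) :
    Φ (tangentPt p q (-1) x) = tangentPt p q (-1) (h.lift x) := by
  obtain ⟨y, hy, hy'⟩ := hΦ _ (h.tangentPt_notMem hp (ε := -1) (by norm_num) x)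
  obtain ⟨j, rfl⟩ := h.exists_shift_of_eq (.inr rfl) hy
  rw [← hy', h.tangentPt_lift, h.tangentPt_shift]

lemma lift_mem_iff {Φ : ℝ × ℝ → ℝ × ℝ}
    (hΦ : ∀ x, Φ (tangentPt p q (-1) x) = tangentPt p q (-1) (h.lift x)) {Ω : Set (ℝ × ℝ)}
    (hΩ : Φ '' Ω = Ω) (hsurj : ∀ z ∈ Ω, ∃ x, tangentPt p q (-1) x = z) (x : Strip) :
    tangentPt p q (-1) (h.lift x) ∈ Ω ↔ tangentPt p q (-1) x ∈ Ω := by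
  refine ⟨fun hx => ?_, fun hx => ?_⟩
  · rw [← hΩ] at hx
    obtain ⟨z, hz, e⟩ := hx
    obtain ⟨y, rfl⟩ := hsurj z hz
    rw [hΦ, h.tangentPt_lift, h.tangentPt_lift] at e
    obtain ⟨j, rfl⟩ := h.exists_shift_of_eq (.inl rfl) e
    rwa [h.tangentPt_shift]
  · rw [← hΦ, ← hΩ]
    exact Set.mem_image_of_mem _ hx

end SupportData

theorem stmt16
    (K : Set (ℝ × ℝ))
    (hKcomp : IsCompact K) (hKconv : Convex ℝ K) (hKstrict : StrictConvex ℝ K)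
    (hKint : (interior K).Nonempty)
    (p : ℝ → ℝ) (hp : ∀ θ : ℝ, p θ = suppFn K θ)
    (hpdiff : Differentiable ℝ p)
    (hplip : ∃ L : NNReal, LipschitzWith L (deriv p))
    (Φ : ℝ × ℝ → ℝ × ℝ)
    (hΦ : ∀ z : ℝ × ℝ, z ∉ K → ∃ θ l : ℝ, ∃ a : ℝ × ℝ, 0 < l ∧ a ∈ K ∧
      a.1 * Real.cos θ + a.2 * Real.sin θ = p θ ∧
      z = a - l • ((-Real.sin θ, Real.cos θ) : ℝ × ℝ) ∧
      Φ z = (2 : ℝ) • a - z)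
    (c d : ℝ) (hcd : c < d) (hlen : d - c < 2 * π)
    (θhat : ℝ) (hθhat : θhat ∈ Set.Ioo c d)
    (hpC2 : ContDiffOn ℝ 2 p (Set.Ioo c d \ {θhat}))
    (hρcont : ContinuousOn (fun θ => p θ + deriv (deriv p) θ) (Set.Ioo c d \ {θhat}))
    (hρpos : ∀ θ ∈ Set.Ioo c d \ {θhat}, 0 < p θ + deriv (deriv p) θ)
    (ρplus ρminus : ℝ)
    (hplus : Filter.Tendsto (fun θ => p θ + deriv (deriv p) θ)
      (nhdsWithin θhat (Set.Ioi θhat)) (nhds ρplus))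
    (hminus : Filter.Tendsto (fun θ => p θ + deriv (deriv p) θ)
      (nhdsWithin θhat (Set.Iio θhat)) (nhds ρminus))
    (hjump : ρplus ≠ ρminus) :
    ∃ ε : ℝ, 0 < ε ∧ ∀ Ω : Set (ℝ × ℝ), DBInvCircle K Φ Ω →
      ¬ (Ω ⊆ {z : ℝ × ℝ | z ∉ K ∧ Metric.infDist z K < ε}) := by
  obtain rfl : p = suppFn K := funext hp
  obtain ⟨L, hL⟩ := hplip
  have hne : K.Nonempty := hKint.mono interior_subset
  have h := supportData_suppFn hKcomp hKint hpdiff hL.continuous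
  have hle : ∀ z ∈ K, ∀ θ, z.1 * cos θ + z.2 * sin θ ≤ suppFn K θ :=
    fun z hz => inner_le_suppFn hKcomp hz
  have hopen : IsOpen (Set.Ioo c d \ {θhat}) := isOpen_Ioo.sdiff isClosed_singleton
  have hC1 : DifferentiableOn ℝ (deriv (suppFn K)) (Set.Ioo c d \ {θhat}) :=
    (hpC2.deriv_of_isOpen hopen (m := 1) (by norm_num)).differentiableOn one_ne_zero
  have hr₀ : 0 < min (θhat - c) (d - θhat) :=
    lt_min (sub_pos.2 hθhat.1) (sub_pos.2 hθhat.2)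
  obtain ⟨l, hl, H⟩ := h.no_ordered_orbits hr₀ (fun t ht ht' => by
    obtain ⟨h1, h2⟩ := lt_min_iff.1 ht'
    have hmem : t ∈ Set.Ioo c d \ {θhat} :=
      ⟨⟨by linarith [(abs_lt.1 h1).1], by linarith [(abs_lt.1 h2).2]⟩, ht⟩
    refine ⟨?_, hρpos t hmem⟩
    rw [add_sub_cancel_left]
    exact ((hC1 t hmem).differentiableAt (hopen.mem_nhds hmem)).hasDerivAt) hminus hplus hjump
  obtain ⟨ε, hε, hεl⟩ := h.exists_infDist_bound hKcomp.isClosed hKconv hle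
    (framePt_mem hKcomp hne hpdiff) hl
  refine ⟨ε, hε, ?_⟩
  rintro Ω ⟨hΩK, hΩc, hΩ, ℓ, -, hℓ, hΩℓ⟩ hΩε
  have hΦ' := fun z hz => h.exists_tangentPt_eq hle hΦ (z := z) hz
  have hsurj : ∀ z ∈ Kᶜ, ∃ x, tangentPt (suppFn K) (deriv (suppFn K)) (-1) x = z :=
    fun z hz => (hΦ' z hz).imp fun _ => And.left
  have hΩne : Ω.Nonempty := hΩℓ ▸ (Set.range_nonempty ℓ).image _
  obtain ⟨z₀, hz₀, hmin⟩ := hΩc.exists_isMinOn hΩne (Metric.continuous_infDist_pt K).continuousOn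
  set l₀ := Metric.infDist z₀ K
  have hl₀ : 0 < l₀ := (hKcomp.isClosed.notMem_iff_infDist_pos hne).1 (hΩK hz₀)
  set O : Set Strip := {x | tangentPt (suppFn K) (deriv (suppFn K)) (-1) x ∈ Ω} with hOdef
  have hO : ∀ x, h.lift x ∈ O ↔ x ∈ O := h.lift_mem_iff (h.apply_tangentPt hle hΦ') hΩ
    fun z hz => hsurj z (hΩK hz)
  have hlines : HasLines O := by
    rw [hOdef, hΩℓ]
    exact h.hasLines_of_not_nullhomotopic hsurj
      (h.tangentPt_notMem hle (ε := -1) (by norm_num)) ℓ hℓ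
  have hOl : ∀ x ∈ O, x.1.2 ∈ Set.Icc l₀ l := fun x hx =>
    ⟨(hmin hx).trans ((Metric.infDist_le_dist_of_mem (framePt_mem hKcomp hne hpdiff x.1.1)).trans
      (SupportData.dist_tangentPt_le x)), hεl x (hΩε hx).2⟩
  obtain ⟨θ₀, θ₁, hθ, H⟩ := H l₀ hl₀
  obtain ⟨x₀, hx₀, x₁, hx₁, e₀, e₁, hord⟩ := h.exists_ordered_orbits hO hlines
    ((hsurj z₀ (hΩK hz₀)).imp fun x hx => by rwa [hOdef, Set.mem_ofPred_eq, hx])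
    (fun j x => by rw [hOdef, Set.mem_ofPred_eq, Set.mem_ofPred_eq, h.tangentPt_shift])
    (hΩc.isClosed.preimage (h.continuous_tangentPt _)) hl₀ hOl hθ
  refine H _ _ (h.tangentOrbit hO hOl hx₀) (h.tangentOrbit hO hOl hx₁)
    (by simpa [SupportData.orbit] using e₀) (by simpa [SupportData.orbit] using e₁) fun n => ?_
  obtain ⟨k, rfl | rfl⟩ := n.eq_nat_or_neg
  · rw [h.orbit_natCast, h.orbit_natCast]
    exact (hord k).1
  · rw [h.orbit_neg_natCast, h.orbit_neg_natCast]
    exact (hord k).2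
end

section
/- There exist a 2π-periodic differentiable function ρ : ℝ → ℝ with ρ > 0 everywhere and a bi-infinite sequence (x_n)_{n∈ℤ} of real numbers with 0 < x_{n+1} − x_n < π for all n, satisfying the dual billiards recursion L(x_{n−1}, x_n) = R(x_n, x_{n+1}) for all n ∈ ℤ, such that (x_n) converges to a finite limit as n → +∞. (Such a sequence is the sequence of tangency angles of a crash orbit of the dual billiards map on a convex curve with differentiable radius of curvature ρ: an orbit converging to a single point of the curve.) -/
open Real

noncomputable def Rfun (ρ : ℝ → ℝ) (θ θ' : ℝ) : ℝ :=
  (∫ η in θ..θ', Real.sin (θ' - η) * ρ η) / Real.sin (θ' - θ)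

noncomputable def Lfun (ρ : ℝ → ℝ) (θ θ' : ℝ) : ℝ :=
  (∫ η in θ..θ', Real.sin (η - θ) * ρ η) / Real.sin (θ' - θ)

/-- A smooth compactly supported profile `B` vanishing at `0` with derivative `1` there, together with its first
two derivatives `B₁`, `B₂`. -/
theorem exists_bump_profile : ∃ (B B₁ B₂ : ℝ → ℝ) (K : ℝ),
    (∀ u, HasDerivAt B (B₁ u) u) ∧ (∀ u, HasDerivAt B₁ (B₂ u) u) ∧ Differentiable ℝ B₂ ∧
    (∀ u, 1 ≤ |u| → B u = 0 ∧ B₁ u = 0 ∧ B₂ u = 0) ∧ B 0 = 0 ∧ B₁ 0 = 1 ∧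
    (∀ u, |B u| ≤ K) ∧ (∀ u, |B₂ u| ≤ K) := by
  let f : ContDiffBump (0 : ℝ) := ⟨1 / 4, 1 / 2, by norm_num, by norm_num⟩
  have hf : ContDiff ℝ 4 (fun u => u * f u) := contDiff_id.mul f.contDiff
  have hf1 : ContDiff ℝ 3 (deriv fun u => u * f u) := hf.deriv'
  have hf2 : ContDiff ℝ 2 (deriv (deriv fun u => u * f u)) := hf1.deriv'
  have hcs : HasCompactSupport (fun u => u * f u) := f.hasCompactSupport.mul_left
  have hcs2 : HasCompactSupport (deriv (deriv fun u => u * f u)) := hcs.deriv.deriv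
  obtain ⟨K₁, hK₁⟩ := hcs.exists_bound_of_continuous hf.continuous
  obtain ⟨K₂, hK₂⟩ := hcs2.exists_bound_of_continuous hf2.continuous
  have hz : ∀ u : ℝ, 1 ≤ |u| → (fun u => u * f u) =ᶠ[nhds u] fun _ => 0 := by
    intro u hu
    have : ∀ᶠ v in nhds u, 1 / 2 < |v| :=
      (continuous_abs.tendsto u).eventually_const_lt (by linarith)
    filter_upwards [this] with v hv
    have : f v = 0 := f.zero_of_le_dist (by simpa [f] using hv.le)
    simp [this]
  have hz1 : ∀ u : ℝ, 1 ≤ |u| → deriv (fun u => u * f u) =ᶠ[nhds u] fun _ => 0 := by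
    intro u hu
    simpa using (hz u hu).deriv
  refine ⟨fun u => u * f u, deriv fun u => u * f u, deriv (deriv fun u => u * f u), max K₁ K₂,
    fun u => ((hf.differentiable (by norm_num)) u).hasDerivAt,
    fun u => ((hf1.differentiable (by norm_num)) u).hasDerivAt,
    hf2.differentiable (by norm_num), ?_, by simp, ?_,
    fun u => (hK₁ u).trans (le_max_left _ _), fun u => (hK₂ u).trans (le_max_right _ _)⟩
  · intro u hu
    exact ⟨(hz u hu).eq_of_nhds, (hz1 u hu).eq_of_nhds, by simpa using (hz1 u hu).deriv_eq⟩
  · have : (fun u => u * f u) =ᶠ[nhds 0] fun u => u := by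
      filter_upwards [f.eventuallyEq_one] with v hv
      simp [hv]
    simpa using this.deriv_eq

section SupportFunction

variable {ρ p p₁ p₂ : ℝ → ℝ} {a b : ℝ}

/-- `L` in terms of a support function `p` of the curve, for which `ρ = p + p₂`. -/
theorem Lfun_eq_of_support (hp : ∀ t, HasDerivAt p (p₁ t) t) (hp₁ : ∀ t, HasDerivAt p₁ (p₂ t) t)
    (hp₂ : Continuous p₂) (hab : a < b) (hπ : b - a < π)
    (hρ : ∀ t ∈ Set.Icc a b, ρ t = p t + p₂ t) :
    Lfun ρ a b = p₁ b + (p a - cos (b - a) * p b) / sin (b - a) := by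
  have hs : 0 < sin (b - a) := sin_pos_of_pos_of_lt_pi (by linarith) hπ
  have hpc : Continuous p := continuous_iff_continuousAt.2 fun t => (hp t).continuousAt
  have h : ∫ η in a..b, sin (η - a) * ρ η = ∫ η in a..b, sin (η - a) * (p η + p₂ η) := by
    refine intervalIntegral.integral_congr fun t ht => ?_
    rw [Set.uIcc_of_le hab.le] at ht
    simp only [hρ t ht]
  have hF : ∀ t, HasDerivAt (fun t => sin (t - a) * p₁ t - cos (t - a) * p t)
      (sin (t - a) * (p t + p₂ t)) t := by
    intro t
    have h₀ : HasDerivAt (fun t => t - a) 1 t := (hasDerivAt_id t).sub_const a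
    refine ((h₀.sin.mul (hp₁ t)).sub (h₀.cos.mul (hp t))).congr_deriv ?_
    ring
  rw [Lfun, h, intervalIntegral.integral_eq_sub_of_hasDerivAt (fun t _ => hF t)
    (Continuous.intervalIntegrable (by fun_prop) _ _)]
  simp only [sub_self, sin_zero, cos_zero]
  field_simp
  ring

/-- `R` in terms of a support function `p` of the curve, for which `ρ = p + p₂`. -/
theorem Rfun_eq_of_support (hp : ∀ t, HasDerivAt p (p₁ t) t) (hp₁ : ∀ t, HasDerivAt p₁ (p₂ t) t)
    (hp₂ : Continuous p₂) (hab : a < b) (hπ : b - a < π)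
    (hρ : ∀ t ∈ Set.Icc a b, ρ t = p t + p₂ t) :
    Rfun ρ a b = -p₁ a + (p b - cos (b - a) * p a) / sin (b - a) := by
  have hs : 0 < sin (b - a) := sin_pos_of_pos_of_lt_pi (by linarith) hπ
  have hpc : Continuous p := continuous_iff_continuousAt.2 fun t => (hp t).continuousAt
  have h : ∫ η in a..b, sin (b - η) * ρ η = ∫ η in a..b, sin (b - η) * (p η + p₂ η) := by
    refine intervalIntegral.integral_congr fun t ht => ?_
    rw [Set.uIcc_of_le hab.le] at ht
    simp only [hρ t ht]
  have hF : ∀ t, HasDerivAt (fun t => sin (b - t) * p₁ t + cos (b - t) * p t)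
      (sin (b - t) * (p t + p₂ t)) t := by
    intro t
    have h₀ : HasDerivAt (fun t => b - t) (-1) t := (hasDerivAt_id t).const_sub b
    refine ((h₀.sin.mul (hp₁ t)).add (h₀.cos.mul (hp t))).congr_deriv ?_
    ring
  rw [Rfun, h, intervalIntegral.integral_eq_sub_of_hasDerivAt (fun t _ => hF t)
    (Continuous.intervalIntegrable (by fun_prop) _ _)]
  simp only [sub_self, sin_zero, cos_zero]
  field_simp
  ring

end SupportFunction

theorem Lfun_neg_neg {ρ : ℝ → ℝ} (hρ : ∀ t, ρ (-t) = ρ t) (a b : ℝ) :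
    Lfun ρ (-b) (-a) = Rfun ρ a b := by
  simp only [Lfun, Rfun, ← intervalIntegral.integral_comp_neg, hρ, sub_neg_eq_add,
    neg_add_eq_sub]

theorem Rfun_neg_neg {ρ : ℝ → ℝ} (hρ : ∀ t, ρ (-t) = ρ t) (a b : ℝ) :
    Rfun ρ (-b) (-a) = Lfun ρ a b := by
  simp only [Lfun, Rfun, ← intervalIntegral.integral_comp_neg, hρ, sub_neg_eq_add,
    neg_add_eq_sub]

theorem one_sub_cos_two_mul_div_sin_two_mul {u : ℝ} (h₀ : 0 < u) (h₁ : u < π / 2) :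
    (1 - cos (2 * u)) / sin (2 * u) = tan u := by
  have hs : sin u ≠ 0 := (sin_pos_of_pos_of_lt_pi h₀ (by linarith [pi_pos])).ne'
  have hc : cos u ≠ 0 := (cos_pos_of_mem_Ioo ⟨by linarith, h₁⟩).ne'
  rw [cos_two_mul, sin_two_mul, tan_eq_sin_div_cos]
  field_simp
  nlinarith [sin_sq_add_cos_sq u]

theorem abs_tan_sub_tan_le {u v : ℝ} (hu : |u| ≤ 1 / 2) (hv : |v| ≤ 1 / 2) :
    |tan u - tan v| ≤ 2 * |u - v| := by
  have key : ∀ z : ℝ, |z| ≤ 1 / 2 → 3 / 4 ≤ cos z := fun z hz => by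
    have := one_sub_sq_div_two_le_cos (x := z)
    nlinarith [sq_abs z, abs_nonneg z]
  have hcu := key u hu
  have hcv := key v hv
  have h : tan u - tan v = sin (u - v) / (cos u * cos v) := by
    rw [tan_eq_sin_div_cos, tan_eq_sin_div_cos, sin_sub]
    have : cos u ≠ 0 := by linarith
    have : cos v ≠ 0 := by linarith
    field_simp
  have hpos : 1 / 2 ≤ cos u * cos v := by nlinarith
  rw [h, abs_div, abs_of_pos (by linarith : 0 < cos u * cos v), div_le_iff₀ (by linarith)]
  have := abs_sin_le_abs (x := u - v)
  nlinarith [abs_nonneg (u - v)]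

/-- The distance from the `n`-th tangency angle to the limit angle `c`. -/
noncomputable def gap (c : ℝ) : ℕ → ℝ
  | 0 => c
  | n + 1 => gap c n - gap c n ^ 3

/-- The nonnegative half of the sequence of tangency angles. -/
noncomputable def angle (c : ℝ) (n : ℕ) : ℝ := c - gap c n

/-- Half of the distance between consecutive tangency angles. -/
noncomputable def halfStep (c : ℝ) (n : ℕ) : ℝ := gap c n ^ 3 / 2

/-- The derivative at the `n`-th tangency angle of the perturbation of the support function. -/
noncomputable def bumpSlope (c : ℝ) : ℕ → ℝ
  | 0 => 0
  | n + 1 => (tan (halfStep c (n + 1)) - tan (halfStep c n)) / 2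

section Gap

variable {c : ℝ}

theorem gap_pos_and_le (h₀ : 0 < c) (h₁ : c ≤ 1 / 10) (n : ℕ) : 0 < gap c n ∧ gap c n ≤ c := by
  induction n with
  | zero => exact ⟨h₀, le_rfl⟩
  | succ n ih =>
    obtain ⟨ih₀, ih₁⟩ := ih
    have h3 : 0 < gap c n ^ 3 := by positivity
    have h2 : gap c n ^ 2 < 1 := by nlinarith
    simp only [gap]
    constructor <;> nlinarith

theorem halfStep_pos (h₀ : 0 < c) (h₁ : c ≤ 1 / 10) (n : ℕ) : 0 < halfStep c n := by
  have := (gap_pos_and_le h₀ h₁ n).1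
  unfold halfStep
  positivity

theorem halfStep_le (h₀ : 0 < c) (h₁ : c ≤ 1 / 10) (n : ℕ) : halfStep c n ≤ gap c n / 200 := by
  obtain ⟨h, h'⟩ := gap_pos_and_le h₀ h₁ n
  unfold halfStep
  have : gap c n ^ 2 ≤ 1 / 100 := by nlinarith
  nlinarith

theorem angle_succ (c : ℝ) (n : ℕ) : angle c (n + 1) = angle c n + 2 * halfStep c n := by
  simp only [angle, gap, halfStep]
  ring

theorem halfStep_succ_le (h₀ : 0 < c) (h₁ : c ≤ 1 / 10) (n : ℕ) :
    halfStep c (n + 1) ≤ halfStep c n := by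
  have h := (gap_pos_and_le h₀ h₁ n).1
  have h' := (gap_pos_and_le h₀ h₁ (n + 1)).1
  have : gap c (n + 1) ≤ gap c n := by
    have : 0 < gap c n ^ 3 := by positivity
    simp only [gap]
    linarith
  unfold halfStep
  gcongr

theorem angle_add_halfStep_le (h₀ : 0 < c) (h₁ : c ≤ 1 / 10) {i j : ℕ} (hij : i < j) :
    angle c i + halfStep c i ≤ angle c j - halfStep c j := by
  induction j, hij using Nat.le_induction with
  | base =>
    rw [angle_succ]
    linarith [halfStep_succ_le h₀ h₁ i]
  | succ j _ ih =>
    rw [angle_succ]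
    linarith [halfStep_succ_le h₀ h₁ j, halfStep_pos h₀ h₁ j]

theorem tendsto_gap (h₀ : 0 < c) (h₁ : c ≤ 1 / 10) :
    Filter.Tendsto (gap c) Filter.atTop (nhds 0) := by
  have hanti : Antitone (gap c) := antitone_nat_of_succ_le fun n => by
    have := (gap_pos_and_le h₀ h₁ n).1
    have : 0 < gap c n ^ 3 := by positivity
    simp only [gap]
    linarith
  have hl := tendsto_atTop_ciInf hanti ⟨0, by
    rintro _ ⟨n, rfl⟩
    exact (gap_pos_and_le h₀ h₁ n).1.le⟩
  set l := ⨅ n, gap c n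
  have h := tendsto_nhds_unique ((Filter.tendsto_add_atTop_iff_nat 1).2 hl) (hl.sub (hl.pow 3))
  have : l = 0 := eq_zero_of_pow_eq_zero (n := 3) (by linarith)
  rwa [this] at hl

theorem tendsto_angle (h₀ : 0 < c) (h₁ : c ≤ 1 / 10) :
    Filter.Tendsto (angle c) Filter.atTop (nhds c) := by
  have h := (tendsto_gap h₀ h₁).const_sub c
  rwa [sub_zero] at h

theorem abs_slope_le (h₀ : 0 < c) (h₁ : c ≤ 1 / 10) (n : ℕ) :
    |bumpSlope c n| ≤ 4 * gap c n ^ 2 * halfStep c n := by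
  cases n with
  | zero =>
    have := halfStep_pos h₀ h₁ 0
    simp only [bumpSlope, abs_zero]
    positivity
  | succ n =>
    obtain ⟨h, h'⟩ := gap_pos_and_le h₀ h₁ n
    have hw : ∀ k, |halfStep c k| ≤ 1 / 2 := fun k => by
      have := halfStep_pos h₀ h₁ k
      have := halfStep_le h₀ h₁ k
      have := (gap_pos_and_le h₀ h₁ k).2
      rw [abs_of_pos] <;> linarith
    have ht := abs_tan_sub_tan_le (hw (n + 1)) (hw n)
    rw [abs_of_nonpos (by linarith [halfStep_succ_le h₀ h₁ n] :
      halfStep c (n + 1) - halfStep c n ≤ 0)] at ht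
    simp only [bumpSlope, abs_div, abs_two]
    refine (div_le_div_of_nonneg_right ht zero_le_two).trans ?_
    simp only [halfStep, gap]
    set d := gap c n
    have hd2 : d ^ 2 ≤ 1 / 100 := by nlinarith
    have e1 : d - d ^ 3 = d * (1 - d ^ 2) := by ring
    rw [e1]
    have hq : (1 - d ^ 2) ≥ 99 / 100 := by linarith
    have h5 : (99 / 100 : ℝ) ^ 5 ≤ (1 - d ^ 2) ^ 5 := by gcongr
    have h6 : 1 - (1 - d ^ 2) ^ 3 ≤ 3 * d ^ 2 := by nlinarith [sq_nonneg d, sq_nonneg (d ^ 2)]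
    have hd3 : 0 < d ^ 3 := by positivity
    have hd5 : 0 < d ^ 5 := by positivity
    have l : d ^ 3 * (1 - (1 - d ^ 2) ^ 3) ≤ d ^ 3 * (3 * d ^ 2) := by gcongr
    have r : d ^ 5 * (99 / 100 : ℝ) ^ 5 ≤ d ^ 5 * (1 - d ^ 2) ^ 5 := by gcongr
    nlinarith

end Gap

/-- The contribution of the perturbation of the support function at the `n`-th tangency angle to
the radius of curvature. -/
noncomputable def bumpTerm (c : ℝ) (B B₂ : ℝ → ℝ) (n : ℕ) (t : ℝ) : ℝ :=
  bumpSlope c n * halfStep c n * B ((t - angle c n) / halfStep c n) +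
    bumpSlope c n / halfStep c n * B₂ ((t - angle c n) / halfStep c n)

/-- The total perturbation of the radius of curvature. -/
noncomputable def perturbation (c : ℝ) (B B₂ : ℝ → ℝ) (t : ℝ) : ℝ := ∑' n, bumpTerm c B B₂ n t

section Perturbation

variable {c K : ℝ} {B B₁ B₂ : ℝ → ℝ}

theorem one_le_abs_div {w s : ℝ} (hw : 0 < w) (h : w ≤ |s|) : 1 ≤ |s / w| := by
  rwa [abs_div, abs_of_pos hw, le_div_iff₀ hw, one_mul]

theorem bumpTerm_eq_zero (h₀ : 0 < c) (h₁ : c ≤ 1 / 10)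
    (hB : ∀ u, 1 ≤ |u| → B u = 0 ∧ B₁ u = 0 ∧ B₂ u = 0) {n : ℕ} {t : ℝ}
    (ht : halfStep c n ≤ |t - angle c n|) : bumpTerm c B B₂ n t = 0 := by
  obtain ⟨hB0, -, hB2⟩ := hB _ (one_le_abs_div (halfStep_pos h₀ h₁ n) ht)
  simp [bumpTerm, hB0, hB2]

theorem bumpTerm_zero (c : ℝ) (B B₂ : ℝ → ℝ) (t : ℝ) : bumpTerm c B B₂ 0 t = 0 := by
  simp [bumpTerm, bumpSlope]

theorem abs_bumpTerm_le (h₀ : 0 < c) (h₁ : c ≤ 1 / 10) (hK : ∀ u, |B u| ≤ K)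
    (hK₂ : ∀ u, |B₂ u| ≤ K) {n : ℕ} {t : ℝ} (ht : |t - angle c n| < halfStep c n) :
    |bumpTerm c B B₂ n t| ≤ 200 * K * (c - t) ^ 2 := by
  have hw := halfStep_pos h₀ h₁ n
  have hw' := halfStep_le h₀ h₁ n
  obtain ⟨hd, hd'⟩ := gap_pos_and_le h₀ h₁ n
  have hs := abs_slope_le h₀ h₁ n
  have hK0 : 0 ≤ K := (abs_nonneg _).trans (hK 0)
  set w := halfStep c n
  set d := gap c n
  have hct : d / 2 ≤ c - t := by
    have := (abs_lt.1 ht).2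
    simp only [angle] at this
    linarith
  have hcd : d ^ 2 ≤ 4 * (c - t) ^ 2 := by nlinarith
  have hs2 : |bumpSlope c n| / w ≤ 4 * d ^ 2 := by rwa [div_le_iff₀ hw]
  have hs1 : |bumpSlope c n| * w ≤ 4 * d ^ 2 := by
    refine le_trans ?_ hs2
    rw [le_div_iff₀ hw, mul_assoc]
    exact mul_le_of_le_one_right (abs_nonneg _) (by nlinarith)
  calc |bumpTerm c B B₂ n t| ≤ |bumpSlope c n| * w * K + |bumpSlope c n| / w * K := by
        unfold bumpTerm
        refine (abs_add_le _ _).trans ?_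
        rw [abs_mul, abs_mul, abs_mul, abs_div, abs_of_pos hw]
        gcongr
        · exact hK _
        · exact hK₂ _
    _ ≤ 4 * d ^ 2 * K + 4 * d ^ 2 * K := by gcongr
    _ ≤ 200 * K * (c - t) ^ 2 := by nlinarith [mul_le_mul_of_nonneg_left hcd hK0, sq_nonneg (c - t)]

theorem perturbation_eq_zero_of_le (h₀ : 0 < c) (h₁ : c ≤ 1 / 10)
    (hB : ∀ u, 1 ≤ |u| → B u = 0 ∧ B₁ u = 0 ∧ B₂ u = 0) {t : ℝ} (ht : t ≤ halfStep c 0) :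
    perturbation c B B₂ t = 0 := by
  have h : ∀ n, bumpTerm c B B₂ n t = 0 := by
    intro n
    rcases Nat.eq_zero_or_pos n with rfl | hn
    · exact bumpTerm_zero c B B₂ t
    · refine bumpTerm_eq_zero h₀ h₁ hB ?_
      have := angle_add_halfStep_le h₀ h₁ hn
      simp only [angle, gap] at this ⊢
      rw [abs_sub_comm]
      exact le_trans (by linarith) (le_abs_self _)
  simp [perturbation, h]

theorem perturbation_eq_zero_of_ge (h₀ : 0 < c) (h₁ : c ≤ 1 / 10)
    (hB : ∀ u, 1 ≤ |u| → B u = 0 ∧ B₁ u = 0 ∧ B₂ u = 0) {t : ℝ} (ht : c ≤ t) :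
    perturbation c B B₂ t = 0 := by
  have h : ∀ n, bumpTerm c B B₂ n t = 0 := by
    intro n
    refine bumpTerm_eq_zero h₀ h₁ hB (le_trans ?_ (le_abs_self _))
    have := halfStep_le h₀ h₁ n
    have := (gap_pos_and_le h₀ h₁ n).1
    simp only [angle]
    linarith
  simp [perturbation, h]

theorem abs_perturbation_le (h₀ : 0 < c) (h₁ : c ≤ 1 / 10) (hK : ∀ u, |B u| ≤ K)
    (hK₂ : ∀ u, |B₂ u| ≤ K) (hB : ∀ u, 1 ≤ |u| → B u = 0 ∧ B₁ u = 0 ∧ B₂ u = 0) (t : ℝ) :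
    |perturbation c B B₂ t| ≤ 200 * K * (c - t) ^ 2 := by
  have hK0 : 0 ≤ K := (abs_nonneg _).trans (hK 0)
  by_cases h : ∃ n, |t - angle c n| < halfStep c n
  · obtain ⟨n, hn⟩ := h
    rw [perturbation, tsum_eq_single n]
    · exact abs_bumpTerm_le h₀ h₁ hK hK₂ hn
    · intro k hk
      refine bumpTerm_eq_zero h₀ h₁ hB ?_
      rw [abs_lt] at hn
      rcases lt_or_gt_of_ne hk with hkn | hkn
      · have := angle_add_halfStep_le h₀ h₁ hkn
        exact le_trans (by linarith) (le_abs_self _)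
      · have := angle_add_halfStep_le h₀ h₁ hkn
        exact le_trans (by linarith) (neg_le_abs _)
  · push Not at h
    have : ∀ n, bumpTerm c B B₂ n t = 0 := fun n => bumpTerm_eq_zero h₀ h₁ hB (h n)
    simp only [perturbation, this, tsum_zero, abs_zero]
    positivity

theorem differentiable_perturbation (h₀ : 0 < c) (h₁ : c ≤ 1 / 10) (hK : ∀ u, |B u| ≤ K)
    (hK₂ : ∀ u, |B₂ u| ≤ K) (hB : ∀ u, 1 ≤ |u| → B u = 0 ∧ B₁ u = 0 ∧ B₂ u = 0)
    (hd : Differentiable ℝ B) (hd₂ : Differentiable ℝ B₂) :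
    Differentiable ℝ (perturbation c B B₂) := by
  intro t
  rcases lt_trichotomy t c with ht | rfl | ht
  · obtain ⟨M, hM⟩ := ((tendsto_angle h₀ h₁).eventually_const_lt ht).exists
    have h : perturbation c B B₂ =ᶠ[nhds t]
        fun s => ∑ n ∈ Finset.range (M + 1), bumpTerm c B B₂ n s := by
      filter_upwards [Iio_mem_nhds hM] with s hs
      refine tsum_eq_sum fun n hn => bumpTerm_eq_zero h₀ h₁ hB ?_
      have hMn : M < n := by simpa [Nat.lt_succ_iff] using hn
      have := angle_add_halfStep_le h₀ h₁ hMn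
      have := halfStep_pos h₀ h₁ M
      have := Set.mem_Iio.1 hs
      exact le_trans (by linarith) (neg_le_abs _)
    refine DifferentiableAt.congr_of_eventuallyEq ?_ h
    unfold bumpTerm
    fun_prop
  · refine HasDerivAt.differentiableAt (f' := 0) ?_
    rw [hasDerivAt_iff_isLittleO]
    rw [perturbation_eq_zero_of_ge h₀ h₁ hB le_rfl]
    simp only [smul_zero, sub_zero]
    have h1 : perturbation t B B₂ =O[nhds t] fun x => (x - t) ^ 2 :=
      Asymptotics.IsBigO.of_bound (200 * K) (Filter.Eventually.of_forall fun s => by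
        have := abs_perturbation_le h₀ h₁ hK hK₂ hB s
        rwa [norm_eq_abs, norm_eq_abs, abs_sq, ← neg_sub t s, neg_sq])
    exact h1.trans_isLittleO (by
      simpa only [norm_eq_abs, sq_abs] using Asymptotics.isLittleO_pow_sub_sub t one_lt_two)
  · have h : perturbation c B B₂ =ᶠ[nhds t] fun _ => 0 := by
      filter_upwards [Ioi_mem_nhds ht] with s hs
      exact perturbation_eq_zero_of_ge h₀ h₁ hB (le_of_lt hs)
    exact (differentiableAt_const 0).congr_of_eventuallyEq h

/-- The values of `L` and `R` between consecutive tangency angles. -/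
theorem Lfun_Rfun_angle {ρ : ℝ → ℝ} (h₀ : 0 < c) (h₁ : c ≤ 1 / 10)
    (hB : ∀ u, 1 ≤ |u| → B u = 0 ∧ B₁ u = 0 ∧ B₂ u = 0) (hd : ∀ u, HasDerivAt B (B₁ u) u)
    (hd₁ : ∀ u, HasDerivAt B₁ (B₂ u) u) (hc : Continuous B₂) (hB0 : B 0 = 0) (hB10 : B₁ 0 = 1)
    (hρ : ∀ t ∈ Set.Icc 0 c, ρ t = 1 + perturbation c B B₂ t) (n : ℕ) :
    Lfun ρ (angle c n) (angle c (n + 1)) = bumpSlope c (n + 1) + tan (halfStep c n) ∧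
      Rfun ρ (angle c n) (angle c (n + 1)) = -bumpSlope c n + tan (halfStep c n) := by
  have hw : ∀ k, 0 < halfStep c k := halfStep_pos h₀ h₁
  let u : ℕ → ℝ → ℝ := fun k t => (t - angle c k) / halfStep c k
  have hu : ∀ k t, HasDerivAt (u k) (1 / halfStep c k) t := fun k t =>
    ((hasDerivAt_id t).sub_const _).div_const _
  let p : ℝ → ℝ := fun t => 1 + (bumpSlope c n * halfStep c n * B (u n t) +
    bumpSlope c (n + 1) * halfStep c (n + 1) * B (u (n + 1) t))
  let p₁ : ℝ → ℝ := fun t => bumpSlope c n * B₁ (u n t) + bumpSlope c (n + 1) * B₁ (u (n + 1) t)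
  let p₂ : ℝ → ℝ := fun t => bumpSlope c n / halfStep c n * B₂ (u n t) +
    bumpSlope c (n + 1) / halfStep c (n + 1) * B₂ (u (n + 1) t)
  have hp : ∀ t, HasDerivAt p (p₁ t) t := by
    intro t
    have e : ∀ k, HasDerivAt (fun t => bumpSlope c k * halfStep c k * B (u k t))
        (bumpSlope c k * B₁ (u k t)) t := fun k => by
      refine (((hd (u k t)).comp t (hu k t)).const_mul _).congr_deriv ?_
      have := (hw k).ne'
      field_simp
    exact ((e n).add (e (n + 1))).const_add 1
  have hp₁ : ∀ t, HasDerivAt p₁ (p₂ t) t := by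
    intro t
    have e : ∀ k, HasDerivAt (fun t => bumpSlope c k * B₁ (u k t))
        (bumpSlope c k / halfStep c k * B₂ (u k t)) t := fun k => by
      refine (((hd₁ (u k t)).comp t (hu k t)).const_mul _).congr_deriv ?_
      ring
    exact (e n).add (e (n + 1))
  have hp₂ : Continuous p₂ := by
    simp only [p₂, u]
    fun_prop
  have hsub : angle c (n + 1) - angle c n = 2 * halfStep c n := by rw [angle_succ]; ring
  have hlt : angle c n < angle c (n + 1) := by linarith [hw n]
  have hsmall : halfStep c n ≤ 1 / 2 := by
    linarith [halfStep_le h₀ h₁ n, (gap_pos_and_le h₀ h₁ n).2]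
  have hπ : angle c (n + 1) - angle c n < π := by linarith [pi_gt_three]
  have hρp : ∀ t ∈ Set.Icc (angle c n) (angle c (n + 1)), ρ t = p t + p₂ t := by
    rintro t ⟨hta, htb⟩
    have htc : t ∈ Set.Icc 0 c := by
      constructor
      · refine le_trans ?_ hta
        have := (gap_pos_and_le h₀ h₁ n).2
        simp only [angle]
        linarith
      · refine htb.trans ?_
        have := (gap_pos_and_le h₀ h₁ (n + 1)).1
        simp only [angle]
        linarith
    rw [hρ t htc, perturbation, tsum_eq_sum (s := {n, n + 1}), Finset.sum_pair (by simp)]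
    · simp only [bumpTerm, p, p₂, u]
      ring
    · intro k hk
      simp only [Finset.mem_insert, Finset.mem_singleton, not_or] at hk
      refine bumpTerm_eq_zero h₀ h₁ hB ?_
      rcases lt_or_gt_of_ne hk.1 with hkn | hkn
      · have := angle_add_halfStep_le h₀ h₁ hkn
        have := hw n
        exact le_trans (by linarith) (le_abs_self _)
      · have := angle_add_halfStep_le h₀ h₁ (show n + 1 < k by omega)
        have := hw (n + 1)
        exact le_trans (by linarith) (neg_le_abs _)
  have huself : ∀ k, u k (angle c k) = 0 := fun k => by simp [u]
  have hua := hB (u n (angle c (n + 1))) (one_le_abs_div (hw n) (by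
    rw [hsub]
    exact le_trans (by linarith [hw n]) (le_abs_self _)))
  have hub := hB (u (n + 1) (angle c n)) (one_le_abs_div (hw (n + 1)) (by
    rw [abs_sub_comm, hsub]
    exact le_trans (by linarith [hw n, halfStep_succ_le h₀ h₁ n]) (le_abs_self _)))
  have hpa : p (angle c n) = 1 := by simp [p, huself, hB0, hub.1]
  have hpb : p (angle c (n + 1)) = 1 := by simp [p, huself, hB0, hua.1]
  have hp₁a : p₁ (angle c n) = bumpSlope c n := by simp [p₁, huself, hB10, hub.2.1]
  have hp₁b : p₁ (angle c (n + 1)) = bumpSlope c (n + 1) := by simp [p₁, huself, hB10, hua.2.1]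
  have htan := one_sub_cos_two_mul_div_sin_two_mul (hw n) (by linarith [pi_gt_three])
  rw [Lfun_eq_of_support hp hp₁ hp₂ hlt hπ hρp, Rfun_eq_of_support hp hp₁ hp₂ hlt hπ hρp,
    hpa, hpb, hp₁a, hp₁b, hsub, mul_one, htan]
  exact ⟨rfl, rfl⟩

/-- Folding a function that vanishes near `0` and near `π` preserves differentiability. -/
theorem differentiable_comp_arccos_cos {f : ℝ → ℝ} (hf : Differentiable ℝ f)
    (h0 : f =ᶠ[nhds 0] fun _ => 0) (hπ : f =ᶠ[nhds π] fun _ => 0) :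
    Differentiable ℝ fun t => f (arccos (cos t)) := by
  have hG : Differentiable ℝ fun v => f (arccos v) := by
    intro v
    have hz : f =ᶠ[nhds (arccos v)] (fun _ => 0) →
        DifferentiableAt ℝ (fun v => f (arccos v)) v := fun h =>
      (differentiableAt_const 0).congr_of_eventuallyEq
        (continuous_arccos.continuousAt.eventually h)
    by_cases h₁ : v = 1
    · exact hz (by simpa [h₁] using h0)
    by_cases h₂ : v = -1
    · exact hz (by simpa [h₂] using hπ)
    exact (hf _).comp v (differentiableAt_arccos.2 ⟨h₂, h₁⟩)
  exact hG.comp differentiable_cos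

end Perturbation

/-- The odd extension to `ℤ` of the sequence of tangency angles. -/
noncomputable def orbitAngle (c : ℝ) : ℤ → ℝ
  | Int.ofNat n => angle c n
  | Int.negSucc n => -angle c (n + 1)

theorem orbitAngle_natCast (c : ℝ) (n : ℕ) : orbitAngle c n = angle c n := rfl

theorem orbitAngle_neg_natCast (c : ℝ) (n : ℕ) : orbitAngle c (-n) = -angle c n := by
  cases n with
  | zero => simpa [angle, gap] using orbitAngle_natCast c 0
  | succ n => rfl

theorem stmt17 :
    ∃ ρ : ℝ → ℝ, Function.Periodic ρ (2 * π) ∧ Differentiable ℝ ρ ∧ (∀ t : ℝ, 0 < ρ t) ∧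
      ∃ x : ℤ → ℝ,
        (∀ n : ℤ, 0 < x (n + 1) - x n ∧ x (n + 1) - x n < π) ∧
        (∀ n : ℤ, Lfun ρ (x (n - 1)) (x n) = Rfun ρ (x n) (x (n + 1))) ∧
        ∃ c : ℝ, Filter.Tendsto (fun n : ℤ => x n) Filter.atTop (nhds c) := by
  obtain ⟨B, B₁, B₂, K, hd, hd₁, hd₂, hB, hB0, hB10, hK, hK₂⟩ := exists_bump_profile
  have hK0 : 0 ≤ K := (abs_nonneg _).trans (hK 0)
  obtain ⟨c, h₀, h₁, hcK⟩ : ∃ c : ℝ, 0 < c ∧ c ≤ 1 / 10 ∧ 200 * K * c ^ 2 < 1 := by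
    have h1 : 1 / (200 * (K + 1)) ≤ 1 / 10 := by
      apply one_div_le_one_div_of_le <;> linarith
    refine ⟨1 / (200 * (K + 1)), by positivity, h1, ?_⟩
    have : 200 * K * (1 / (200 * (K + 1))) ≤ 1 := by
      field_simp
      linarith
    have : 0 < 1 / (200 * (K + 1)) := by positivity
    nlinarith
  have hπ := pi_gt_three
  have hw := halfStep_pos h₀ h₁
  have hfold : ∀ t ∈ Set.Icc 0 c,
      1 + perturbation c B B₂ (arccos (cos t)) = 1 + perturbation c B B₂ t := fun t ht => by
    rw [arccos_cos ht.1 (by linarith [ht.2])]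
  have hLR := Lfun_Rfun_angle h₀ h₁ hB hd hd₁ hd₂.continuous hB0 hB10 hfold
  have heven : ∀ t, (fun t => 1 + perturbation c B B₂ (arccos (cos t))) (-t) =
      (fun t => 1 + perturbation c B B₂ (arccos (cos t))) t := fun t => by simp
  refine ⟨fun t => 1 + perturbation c B B₂ (arccos (cos t)), fun t => by simp, ?_, ?_,
    orbitAngle c, ?_, ?_, c, ?_⟩
  · refine (differentiable_comp_arccos_cos (differentiable_perturbation h₀ h₁ hK hK₂ hB
      (fun u => (hd u).differentiableAt) hd₂) ?_ ?_).const_add 1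
    · filter_upwards [Iio_mem_nhds (hw 0)] with t ht
      exact perturbation_eq_zero_of_le h₀ h₁ hB (le_of_lt ht)
    · filter_upwards [Ioi_mem_nhds (show c < π by linarith)] with t ht
      exact perturbation_eq_zero_of_ge h₀ h₁ hB (le_of_lt ht)
  · intro t
    beta_reduce
    set s := arccos (cos t)
    have hs : 0 ≤ s := arccos_nonneg _
    rcases le_total c s with hcs | hcs
    · rw [perturbation_eq_zero_of_ge h₀ h₁ hB hcs]
      norm_num
    · have h := abs_perturbation_le h₀ h₁ hK hK₂ hB s
      have h' : 200 * K * (c - s) ^ 2 ≤ 200 * K * c ^ 2 := by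
        gcongr
        linarith
      linarith [neg_abs_le (perturbation c B B₂ s)]
  · have hstep : ∀ n : ℕ, 0 < angle c (n + 1) - angle c n ∧ angle c (n + 1) - angle c n < π := by
      intro n
      rw [angle_succ]
      constructor <;> linarith [hw n, halfStep_le h₀ h₁ n, (gap_pos_and_le h₀ h₁ n).2]
    intro n
    rcases n with n | n
    · exact hstep n
    · rw [show (Int.negSucc n + 1 : ℤ) = -(n : ℕ) by omega, orbitAngle_neg_natCast]
      simpa [orbitAngle, neg_add_eq_sub] using hstep n
  · have hrec : ∀ n : ℕ, Lfun (fun t => 1 + perturbation c B B₂ (arccos (cos t))) (angle c n)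
        (angle c (n + 1)) = Rfun (fun t => 1 + perturbation c B B₂ (arccos (cos t)))
        (angle c (n + 1)) (angle c (n + 1 + 1)) := by
      intro n
      rw [(hLR n).1, (hLR (n + 1)).2]
      simp only [bumpSlope]
      ring
    intro n
    rcases n with (_ | n) | n
    · have h : orbitAngle c (Int.ofNat 0) = -angle c 0 := by simp [orbitAngle, angle, gap]
      have h' : (Int.ofNat 0 - 1 : ℤ) = Int.negSucc 0 := rfl
      rw [h', show orbitAngle c (Int.negSucc 0) = -angle c (0 + 1) from rfl, h,
        Lfun_neg_neg heven]
      simp [orbitAngle, angle, gap]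
    · rw [show (Int.ofNat (n + 1) - 1 : ℤ) = (n : ℕ) by simp]
      exact hrec n
    · rw [show (Int.negSucc n + 1 : ℤ) = -(n : ℕ) by omega,
        show (Int.negSucc n - 1 : ℤ) = Int.negSucc (n + 1) by omega, orbitAngle_neg_natCast]
      simp only [orbitAngle]
      rw [Lfun_neg_neg heven, Rfun_neg_neg heven]
      exact (hrec n).symm
  · rw [← Nat.map_cast_int_atTop, Filter.tendsto_map'_iff]
    exact tendsto_angle h₀ h₁
end
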